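/- For every integer n ≥ 5, every subgraph G of the complete bipartite graph K_{n+3,n+3} satisfies: G contains a cycle of length 2n, or the bipartite complement of G in K_{n+3,n+3} contains a cycle of length 8. (This is the upper bound BR(C_8, C_{2n}) ≤ n+3 for n ≥ 5.) -/

import Mathlib

open SimpleGraph Sum

/-- The complete bipartite graph `K_{t,t}` with both parts a copy of `Fin t`. -/
abbrev Kbb (t : ℕ) : SimpleGraph (Fin t ⊕ Fin t) := completeBipartiteGraph (Fin t) (Fin t)

/-- `G` contains a cycle of length `m`. -/
def HasCycleLen {V : Type*} (G : SimpleGraph V) (m : ℕ) : Prop :=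
  ∃ (v : V) (w : G.Walk v v), w.IsCycle ∧ w.length = m

/-- Every subgraph `G` of `K_{b,b}` contains a cycle of length `m`, or its bipartite
complement in `K_{b,b}` contains a cycle of length `n`. -/
def BRprop (m n b : ℕ) : Prop :=
  ∀ G : SimpleGraph (Fin b ⊕ Fin b), G ≤ Kbb b →
    HasCycleLen G m ∨ HasCycleLen (Kbb b \ G) n

/-- A cycle with `2 * k` vertices in the bipartite graph of the relation `h`. -/
def HasC {α β : Type*} (k : ℕ) (h : α → β → Prop) : Prop :=
  ∃ (r : Fin k → α) (c : Fin k → β), r.Injective ∧ c.Injective ∧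
    ∀ i, h (r i) (c i) ∧ h (r (finRotate k i)) (c i)

namespace Refute

/-- Evaluate `n` before passing it on. -/
noncomputable def force {α : Type} (n : ℕ) (k : ℕ → α) : α :=
  Nat.rec (k 0) (fun m _ => k (Nat.succ m)) n

theorem force_eq {α : Type} (n : ℕ) (k : ℕ → α) : force n k = k n := by
  cases n <;> rfl

/-- Truth of the literal with code `i`: the codes below `V` are the positive literals, those from
`V` to `2 * V` the negative ones. -/
def Lit (V : ℕ) (σ : ℕ → Prop) (i : ℕ) : Prop :=
  if i < V then σ i else i < 2 * V ∧ ¬ σ (i - V)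

/-- Truth of the clause whose literals are the set bits of `K`. -/
def Sat (V : ℕ) (σ : ℕ → Prop) (K : ℕ) : Prop := ∃ i, K.testBit i = true ∧ Lit V σ i

theorem not_sat_zero (V : ℕ) (σ : ℕ → Prop) : ¬ Sat V σ 0 := by
  rintro ⟨i, hi, -⟩; simp at hi

theorem sat_lor {V : ℕ} {σ : ℕ → Prop} {a b : ℕ} :
    Sat V σ (Nat.lor a b) ↔ Sat V σ a ∨ Sat V σ b := by
  have : ∀ i, (Nat.lor a b).testBit i = (a.testBit i || b.testBit i) := Nat.testBit_lor a b
  simp only [Sat, this, Bool.or_eq_true, or_and_right, exists_or]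

theorem sat_two_pow {V : ℕ} {σ : ℕ → Prop} {j : ℕ} :
    Sat V σ (Nat.shiftLeft 1 j) ↔ Lit V σ j := by
  rw [show Nat.shiftLeft 1 j = 2 ^ j from Nat.one_shiftLeft j]
  simp [Sat, Nat.testBit_two_pow]

theorem sat_xor {V : ℕ} {σ : ℕ → Prop} {a b : ℕ} (h : Sat V σ a) (hb : ¬ Sat V σ b) :
    Sat V σ (Nat.xor a b) := by
  obtain ⟨i, hi, hl⟩ := h
  refine ⟨i, (Nat.testBit_xor a b i).trans ?_, hl⟩
  have : b.testBit i = false := by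
    by_contra hc
    exact hb ⟨i, by simpa using hc, hl⟩
  rw [hi, this]; rfl

/-- The literals opposite to those of `K`; `M` masks the bits below `2 * V`. -/
def opp (V M K : ℕ) : ℕ :=
  Nat.lor (Nat.shiftRight K V) (Nat.land (Nat.shiftLeft K V) M)

theorem not_sat_opp {V : ℕ} {σ : ℕ → Prop} {j : ℕ} (M : ℕ) (h : Lit V σ j) :
    ¬ Sat V σ (opp V M (2 ^ j)) := by
  rintro ⟨i, hi, hl⟩
  have : (opp V M (2 ^ j)).testBit i =
      (((2 ^ j) >>> V).testBit i || (((2 ^ j) <<< V) &&& M).testBit i) := Nat.testBit_lor _ _ i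
  rw [this] at hi
  simp only [Nat.testBit_shiftRight, Nat.testBit_and, Nat.testBit_shiftLeft, Nat.testBit_two_pow,
    Bool.or_eq_true, Bool.and_eq_true, decide_eq_true_eq] at hi
  unfold Lit at h hl
  rcases hi with hi | ⟨⟨hi, hi'⟩, -⟩
  · rw [if_neg (by omega), hi, Nat.add_sub_cancel_left] at h
    rw [if_pos (by omega)] at hl
    exact h.2 hl
  · rw [if_neg (by omega), ← hi'] at hl
    rw [if_pos (by omega)] at h
    exact hl.2 h

/-- Resolve `C` with `K`, if they clash in exactly one literal. -/
noncomputable def resolve (V M C K : ℕ) : ℕ :=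
  force (Nat.land C (opp V M K)) fun p => Bool.rec (Bool.rec C
    (Nat.lor (Nat.xor C p) (Nat.xor K (opp V M p)))
    (Nat.beq (Nat.land p (Nat.sub p 1)) 0)) C (Nat.beq p 0)

theorem sat_resolve {V M : ℕ} {σ : ℕ → Prop} {C K : ℕ} (hC : Sat V σ C) (hK : K ≠ 0 → Sat V σ K) :
    Sat V σ (resolve V M C K) := by
  rw [resolve, force_eq]
  cases h : Nat.beq (Nat.land C (opp V M K)) 0
  · have hp := Nat.ne_of_beq_eq_false h
    have hK0 : K ≠ 0 := by
      rintro rfl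
      apply hp
      change C &&& ((0 >>> V) ||| ((0 <<< V) &&& M)) = 0
      simp
    generalize Nat.land C (opp V M K) = p at hp
    dsimp only
    cases h2 : Nat.beq (Nat.land p (Nat.sub p 1)) 0
    · exact hC
    obtain ⟨j, rfl⟩ := (Nat.and_sub_one_eq_zero_iff_isPowerOfTwo hp).1 (Nat.eq_of_beq_eq_true h2)
    dsimp only
    rw [sat_lor]
    by_cases hj : Lit V σ j
    · exact Or.inr (sat_xor (hK hK0) (not_sat_opp M hj))
    · refine Or.inl (sat_xor hC ?_)
      rw [← Nat.one_shiftLeft]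
      exact fun h => hj (sat_two_pow.1 h)
  · exact hC

/-- The clause number `j` from the top of a stack of clauses of `W` bits. -/
def get (W S j : ℕ) : ℕ := Nat.mod (Nat.shiftRight S (Nat.mul j W)) (Nat.pow 2 W)

/-- Push `C` to the stack and pass the result on. -/
noncomputable def push (W S C : ℕ) (k : ℕ → Bool) : Bool :=
  Bool.rec false (force (Nat.lor (Nat.shiftLeft S W) C) k) (Nat.beq (Nat.shiftRight C W) 0)

/-- All clauses on the stack are true; the entry `0` stands for a missing clause. -/
def Good (V : ℕ) (σ : ℕ → Prop) (W S : ℕ) : Prop := ∀ j, get W S j ≠ 0 → Sat V σ (get W S j)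

theorem good_zero (V : ℕ) (σ : ℕ → Prop) (W : ℕ) : Good V σ W 0 := by
  intro j h
  refine absurd ?_ h
  change (0 >>> (j * W)) % 2 ^ W = 0
  simp

theorem Good.push {V : ℕ} {σ : ℕ → Prop} {W S C : ℕ} {k : ℕ → Bool} (hS : Good V σ W S) (hC : C ≠ 0 → Sat V σ C)
    (h : push W S C k = true) : ∃ S', Good V σ W S' ∧ k S' = true := by
  rw [Refute.push, force_eq] at h
  cases hb : Nat.beq (Nat.shiftRight C W) 0 <;> rw [hb] at h
  · simp at h
  have hlt : C < 2 ^ W := by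
    have : C >>> W = 0 := Nat.eq_of_beq_eq_true hb
    rw [Nat.shiftRight_eq_div_pow] at this
    exact (Nat.div_eq_zero_iff_lt (by positivity)).1 this
  refine ⟨_, fun j => ?_, h⟩
  have e : Nat.lor (Nat.shiftLeft S W) C = S * 2 ^ W + C := by
    change S <<< W ||| C = _
    rw [← Nat.shiftLeft_add_eq_or_of_lt hlt, Nat.shiftLeft_eq]
  rw [e]
  cases j with
  | zero =>
    have : get W (S * 2 ^ W + C) 0 = C := by
      change ((S * 2 ^ W + C) >>> (0 * W)) % 2 ^ W = C
      rw [zero_mul, Nat.shiftRight_zero, Nat.mul_add_mod', Nat.mod_eq_of_lt hlt]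
    rw [this]
    exact hC
  | succ j =>
    have : get W (S * 2 ^ W + C) (j + 1) = get W S j := by
      change ((S * 2 ^ W + C) >>> ((j + 1) * W)) % 2 ^ W = (S >>> (j * W)) % 2 ^ W
      rw [show (j + 1) * W = W + j * W by ring, Nat.shiftRight_add, Nat.shiftRight_eq_div_pow _ W,
        mul_comm S, Nat.mul_add_div (by positivity), Nat.div_eq_of_lt hlt, add_zero]
    rw [this]
    exact hS j

/-- Resolve `C` successively with the clauses whose indices are the base `B` digits of `s`. -/
noncomputable def chain (W B V M S : ℕ) (f : ℕ) : ℕ → ℕ → ℕ :=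
  Nat.rec (fun _ C => C) (fun _ ih s C => Bool.rec
      (force (get W S (Nat.pred (Nat.mod s B))) fun K =>
        force (resolve V M C K) fun C' => force (Nat.div s B) fun s' => ih s' C') C (Nat.beq s 0)) f

theorem chain_succ (W B V M S f s C) : chain W B V M S (f + 1) s C = bif Nat.beq s 0 then C else
    chain W B V M S f (Nat.div s B) (resolve V M C (get W S (Nat.pred (Nat.mod s B)))) := by
  simp only [chain, force_eq]
  cases Nat.beq s 0 <;> rfl

theorem sat_chain {V : ℕ} {σ : ℕ → Prop} {W B M S : ℕ} (hS : Good V σ W S) :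
    ∀ f s {C}, Sat V σ C → Sat V σ (chain W B V M S f s C)
  | 0, _, _, hC => hC
  | f + 1, s, C, hC => by
    rw [chain_succ]
    cases Nat.beq s 0
    · exact sat_chain hS f _ (sat_resolve hC (hS _))
    · exact hC

/-- Derive the clauses described by the list and succeed on the empty clause. -/
noncomputable def derive (W B V M : ℕ) (l : List ℕ) : ℕ → Bool :=
  List.rec (fun _ => false) (fun s _ ih S =>
    force (get W S (Nat.pred (Nat.mod s B))) fun K => Bool.rec
      (force (force (Nat.div s B) fun s' => chain W B V M S 500 s' K) fun C =>
        Bool.rec (push W S C ih) true (Nat.beq C 0))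
      false (Nat.beq K 0)) l

theorem derive_cons (W B V M s t S) : derive W B V M (s :: t) S =
    bif Nat.beq (get W S (Nat.pred (Nat.mod s B))) 0 then false else
    (fun C => bif Nat.beq C 0 then true else push W S C (derive W B V M t))
      (chain W B V M S 500 (Nat.div s B) (get W S (Nat.pred (Nat.mod s B)))) := by
  simp only [derive, force_eq]
  cases Nat.beq (get W S (Nat.pred (Nat.mod s B))) 0
  · cases Nat.beq (chain W B V M S 500 (Nat.div s B) (get W S (Nat.pred (Nat.mod s B)))) 0 <;> rfl
  · rfl

theorem derive_sound {V : ℕ} {σ : ℕ → Prop} {W B M : ℕ} : ∀ (l : List ℕ) (S : ℕ),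
    Good V σ W S → derive W B V M l S = true → False
  | [], _, _, h => by simp [derive] at h
  | s :: t, S, hS, h => by
    rw [derive_cons] at h
    cases hK : Nat.beq (get W S (Nat.pred (Nat.mod s B))) 0 <;> rw [hK] at h
    · have hs := sat_chain (B := B) (V := V) (M := M) hS 500 (Nat.div s B)
        (hS (Nat.pred (Nat.mod s B)) (Nat.ne_of_beq_eq_false hK))
      simp only [cond_false] at h
      cases hb : Nat.beq (chain W B V M S 500 (Nat.div s B) (get W S (Nat.pred (Nat.mod s B)))) 0 <;>
        rw [hb] at h
      · obtain ⟨S', hS', h'⟩ := hS.push (fun _ => hs) h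
        exact derive_sound t _ hS' h'
      · rw [Nat.eq_of_beq_eq_true hb] at hs
        exact not_sat_zero V σ hs
    · simp at h

/-- Push the clauses `f x` for `x` in the list. -/
noncomputable def load {α : Type} (W : ℕ) (f : α → ℕ) (l : List α) : ℕ → (ℕ → Bool) → Bool :=
  List.rec (fun S k => k S) (fun x _ ih S k => force (f x) fun C =>
    push W S C fun S' => ih S' k) l

theorem load_cons {α : Type} (W : ℕ) (f : α → ℕ) (x t S k) : load W f (x :: t) S k =
    push W S (f x) fun S' => load W f t S' k := by
  simp only [load, force_eq]

theorem load_sound {V : ℕ} {σ : ℕ → Prop} {W : ℕ} {α : Type} {f : α → ℕ} :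
    ∀ (l : List α) (S : ℕ) (k),
    (∀ x ∈ l, f x ≠ 0 → Sat V σ (f x)) → Good V σ W S → load W f l S k = true →
    ∃ S', Good V σ W S' ∧ k S' = true
  | [], S, _, _, hS, h => ⟨S, hS, h⟩
  | x :: t, S, k, hf, hS, h => by
    rw [load_cons] at h
    obtain ⟨S', hS', hk⟩ := hS.push (hf x (by simp)) h
    exact load_sound t _ k (fun y hy => hf y (by simp [hy])) hS' hk

/-- The clause of the literal of the cell `(r, c)` in a table with `n` columns, with an offset `o`
that is `0` for the positive and the number of cells for the negative literal. -/
def cell (n o r c : ℕ) : ℕ := Nat.shiftLeft 1 (Nat.add (Nat.add (Nat.mul r n) c) o)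

/-- The edges of the closed walk through the (row, column) pairs of a list, ending in row `r₀`. -/
def edgesTo {α β : Type} (r₀ : α) : List (α × β) → List (α × β)
  | [] => []
  | [p] => [p, (r₀, p.2)]
  | p :: q :: t => p :: (q.1, p.2) :: edgesTo r₀ (q :: t)

/-- The edges of the cycle through the (row, column) pairs of a list. -/
def edges {α β : Type} : List (α × β) → List (α × β)
  | [] => []
  | p :: t => edgesTo p.1 (p :: t)

theorem mem_edgesTo {α β : Type} (r₀ : α) : ∀ (l : List (α × β)) (i : ℕ) (hi : i < l.length),
    l[i] ∈ edgesTo r₀ l ∧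
    ((if h : i + 1 < l.length then l[i + 1].1 else r₀), l[i].2) ∈ edgesTo r₀ l
  | [], i, hi => by simp at hi
  | [p], i, hi => by
    obtain rfl : i = 0 := by simpa using hi
    simp [edgesTo]
  | p :: q :: t, 0, hi => by simp [edgesTo]
  | p :: q :: t, i + 1, hi => by
    have := mem_edgesTo r₀ (q :: t) i (by simpa using hi)
    simp only [edgesTo, List.mem_cons, List.getElem_cons_succ] at this ⊢
    refine ⟨Or.inr (Or.inr this.1), Or.inr (Or.inr ?_)⟩
    convert this.2 using 3
    simp

theorem hasC_of_list {α β : Type} {h : α → β → Prop} (l : List (α × β))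
    (h₁ : (l.map Prod.fst).Nodup) (h₂ : (l.map Prod.snd).Nodup)
    (he : ∀ e ∈ edges l, h e.1 e.2) : HasC l.length h := by
  refine ⟨fun i => l[i].1, fun i => l[i].2, ?_, ?_, fun i => ?_⟩
  · intro i j hij
    have := (List.nodup_iff_injective_get.1 h₁) (a₁ := ⟨i, by simp⟩) (a₂ := ⟨j, by simp⟩)
      (by simpa using hij)
    simpa [Fin.ext_iff] using this
  · intro i j hij
    have := (List.nodup_iff_injective_get.1 h₂) (a₁ := ⟨i, by simp⟩) (a₂ := ⟨j, by simp⟩)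
      (by simpa using hij)
    simpa [Fin.ext_iff] using this
  · cases l with
    | nil => exact i.elim0
    | cons p t =>
      obtain ⟨a, b⟩ := mem_edgesTo p.1 (p :: t) i i.2
      refine ⟨he _ a, ?_⟩
      have key : ((finRotate (t.length + 1) i : Fin (t.length + 1)) : ℕ) =
          if (i : ℕ) + 1 < t.length + 1 then (i : ℕ) + 1 else 0 := by
        rw [finRotate_apply]
        split_ifs with hi
        · exact Fin.val_add_one_of_lt (by simpa [Fin.lt_def] using hi)
        · have : i = Fin.last _ := by
            ext; have := i.2; simp at hi this ⊢; omega
          subst this; simp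
      have h3 := he _ b
      simp only [Fin.getElem_fin, List.length_cons] at h3 ⊢
      split_ifs at h3 key with hi
      · simpa only [key] using h3
      · simpa only [key, List.getElem_cons_zero] using h3

/-- The list has no repetitions and no members among the set bits of `S`. -/
def fresh : ℕ → List ℕ → Bool
  | _, [] => true
  | S, a :: t => bif Nat.beq (Nat.land (Nat.shiftRight S a) 1) 1 then false else
      fresh (Nat.lor S (Nat.shiftLeft 1 a)) t

theorem fresh_sound : ∀ (l : List ℕ) (S : ℕ), fresh S l = true →
    l.Nodup ∧ ∀ a ∈ l, S.testBit a = false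
  | [], _, _ => by simp
  | a :: t, S, h => by
    rw [fresh] at h
    cases hb : Nat.beq (Nat.land (Nat.shiftRight S a) 1) 1 <;> rw [hb] at h
    · obtain ⟨h₁, h₂⟩ := fresh_sound t _ h
      have key : ∀ x ∈ t, S.testBit x = false ∧ a ≠ x := fun x hx => by
        have := h₂ x hx
        have e : Nat.lor S (Nat.shiftLeft 1 a) = S ||| 2 ^ a := by
          rw [← Nat.one_shiftLeft]; rfl
        rw [e, Nat.testBit_or, Nat.testBit_two_pow] at this
        simpa using this
      refine ⟨List.nodup_cons.2 ⟨fun ha => (key a ha).2 rfl, h₁⟩, ?_⟩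
      rintro x hx
      rcases List.mem_cons.1 hx with rfl | hx
      · have : Nat.beq ((S >>> x) &&& 1) 1 = false := hb
        have h3 := Nat.ne_of_beq_eq_false this
        rw [Nat.and_one_is_mod] at h3
        rw [Nat.shiftRight_eq_div_pow] at h3
        rw [Nat.testBit_eq_decide_div_mod_eq]
        exact decide_eq_false h3
      · exact (key x hx).1
    · simp at h

/-- The `k` pairs of base `b` digits of `x`. -/
noncomputable def pairs (b : ℕ) : ℕ → ℕ → List (ℕ × ℕ)
  | 0, _ => []
  | k + 1, x => force (Nat.mod x b) fun r => force (Nat.div x b) fun x =>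
      force (Nat.mod x b) fun c => force (Nat.div x b) fun x => (r, c) :: pairs b k x

theorem length_pairs (b : ℕ) : ∀ k x, (pairs b k x).length = k
  | 0, _ => rfl
  | k + 1, x => by simp [pairs, force_eq, length_pairs b k]

/-- The clause of the literals with offset `o` of the given cells. -/
noncomputable def cells (n o : ℕ) : List (ℕ × ℕ) → ℕ
  | [] => 0
  | p :: t => Nat.lor (cell n o p.1 p.2) (cells n o t)

/-- All pairs are in the table with `m` rows and `n` columns. -/
def inside (m n : ℕ) : List (ℕ × ℕ) → Bool
  | [] => true
  | p :: t => bif Nat.ble m p.1 then false else bif Nat.ble n p.2 then false else inside m n t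

theorem inside_sound {m n : ℕ} : ∀ {l : List (ℕ × ℕ)}, inside m n l = true →
    ∀ p ∈ l, p.1 < m ∧ p.2 < n
  | [], _ => by simp
  | q :: t, h => by
    rw [inside] at h
    cases h₁ : Nat.ble m q.1 <;> cases h₂ : Nat.ble n q.2 <;> rw [h₁] at h <;> try rw [h₂] at h
    · intro p hp
      rcases List.mem_cons.1 hp with rfl | hp
      · constructor
        · by_contra hc; rw [Nat.ble_eq_true_of_le (by omega)] at h₁; simp at h₁
        · by_contra hc; rw [Nat.ble_eq_true_of_le (by omega)] at h₂; simp at h₂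
      · exact inside_sound (by simpa using h) p hp
    all_goals simp at h

/-- The clause saying that one of the cells of a cycle is false (`o = m * n`) or true (`o = 0`),
or `0` if the code `x` is not that of a cycle. -/
noncomputable def cycleClause (m n b o k x : ℕ) : ℕ :=
  (fun l => bif inside m n (edges l) then bif fresh 0 (l.map Prod.fst) then
    bif fresh 0 (l.map Prod.snd) then cells n o (edges l) else 0 else 0 else 0) (pairs b k x)

/-- The valuation of the cells of a table with `n` columns given by a relation. -/
def val (n : ℕ) (h : ℕ → ℕ → Prop) (v : ℕ) : Prop := h (v / n) (v % n)

theorem val_cell {n : ℕ} {h : ℕ → ℕ → Prop} {r c : ℕ} (hc : c < n) :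
    val n h (r * n + c) = h r c := by
  rw [val, mul_comm, Nat.mul_add_div (by omega), Nat.div_eq_of_lt hc, add_zero, Nat.mul_add_mod,
    Nat.mod_eq_of_lt hc]

theorem cell_lt {m n r c : ℕ} (hr : r < m) (hc : c < n) : r * n + c < m * n := by
  nlinarith [Nat.mul_le_mul_right n (Nat.succ_le_of_lt hr)]

theorem sat_cells {m n o : ℕ} {h : ℕ → ℕ → Prop} {P : ℕ × ℕ → Prop}
    (ho : ∀ r c, r < m → c < n → (Lit (m * n) (val n h) (r * n + c + o) ↔ P (r, c))) :
    ∀ {l : List (ℕ × ℕ)}, (∀ p ∈ l, p.1 < m ∧ p.2 < n) →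
      (Sat (m * n) (val n h) (cells n o l) ↔ ∃ p ∈ l, P p)
  | [], _ => by simp [cells, not_sat_zero]
  | q :: t, hl => by
    rw [cells, sat_lor, cell, sat_two_pow, sat_cells ho fun p hp => hl p (by simp [hp])]
    have := ho q.1 q.2 (hl q (by simp)).1 (hl q (by simp)).2
    simp only [List.mem_cons, exists_eq_or_imp]
    exact or_congr this Iff.rfl

theorem sat_cells_pos {m n : ℕ} {h : ℕ → ℕ → Prop} {l : List (ℕ × ℕ)}
    (hl : ∀ p ∈ l, p.1 < m ∧ p.2 < n) :
    Sat (m * n) (val n h) (cells n 0 l) ↔ ∃ p ∈ l, h p.1 p.2 :=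
  sat_cells (P := fun p => h p.1 p.2) (fun r c hr hc => by
    rw [Lit, add_zero, if_pos (cell_lt hr hc), val_cell hc]) hl

theorem sat_cells_neg {m n : ℕ} {h : ℕ → ℕ → Prop} {l : List (ℕ × ℕ)}
    (hl : ∀ p ∈ l, p.1 < m ∧ p.2 < n) :
    Sat (m * n) (val n h) (cells n (m * n) l) ↔ ∃ p ∈ l, ¬ h p.1 p.2 :=
  sat_cells (P := fun p => ¬ h p.1 p.2) (fun r c hr hc => by
    have := cell_lt hr hc
    rw [Lit, if_neg (by omega), Nat.add_sub_cancel, val_cell hc]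
    exact and_iff_right (by omega)) hl

theorem sat_cycleClause {m n b o k : ℕ} {σ : ℕ → Prop} {g : ℕ → ℕ → Prop}
    (ho : ∀ l : List (ℕ × ℕ), (∀ p ∈ l, p.1 < m ∧ p.2 < n) →
      (Sat (m * n) σ (cells n o l) ↔ ∃ p ∈ l, ¬ g p.1 p.2))
    (hg : ¬ HasC k fun (i : Fin m) (j : Fin n) => g i j) (x : ℕ)
    (hx : cycleClause m n b o k x ≠ 0) : Sat (m * n) σ (cycleClause m n b o k x) := by
  unfold cycleClause at hx ⊢
  beta_reduce at hx ⊢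
  have hlen := length_pairs b k x
  generalize pairs b k x = l at hlen hx
  cases h₀ : inside m n (edges l)
  · rw [h₀] at hx; exact absurd rfl hx
  cases h₁ : fresh 0 (l.map Prod.fst)
  · rw [h₀, h₁] at hx; exact absurd rfl hx
  cases h₂ : fresh 0 (l.map Prod.snd)
  · rw [h₀, h₁, h₂] at hx; exact absurd rfl hx
  simp only [cond_true]
  have hin := inside_sound h₀
  rw [ho _ hin]
  by_contra! hcon
  obtain ⟨r, c, hr, hc, hrc⟩ := hasC_of_list (h := fun i j => (i < m ∧ j < n) ∧ g i j) l
    (fresh_sound _ _ h₁).1 (fresh_sound _ _ h₂).1 (fun e he => ⟨hin e he, hcon e he⟩)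
  subst hlen
  exact hg ⟨fun i => ⟨r i, (hrc i).1.1.1⟩, fun i => ⟨c i, (hrc i).1.1.2⟩,
    fun i j hij => hr (by simpa using hij), fun i j hij => hc (by simpa using hij),
    fun i => ⟨(hrc i).1.2, (hrc i).2.2⟩⟩

/-- The clause with the given positive and negative literals. -/
noncomputable def sideClause (m n : ℕ) (p : List (ℕ × ℕ) × List (ℕ × ℕ)) : ℕ :=
  Nat.lor (cells n 0 p.1) (cells n (Nat.mul m n) p.2)

/-- A refutation of the existence of an `m` by `n` table `h` that contains no cycle of length 8,
whose complement contains no cycle of length `2 * k`, and that satisfies the clauses `side`. The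
lists `C` and `D` encode cycles in base `b`, and `S` encodes resolution steps in base `B`. -/
noncomputable def check (m n b k : ℕ) (side : List (List (ℕ × ℕ) × List (ℕ × ℕ)))
    (C D : List ℕ) (B : ℕ) (S : List ℕ) : Bool :=
  inside m n (side.flatMap fun p => p.1 ++ p.2) &&
  force (Nat.mul m n) fun V => force (Nat.mul 2 V) fun W =>
  load W (sideClause m n) side 0 fun T =>
  load W (cycleClause m n b V 4) C T fun T =>
  load W (cycleClause m n b 0 k) D T fun T =>
  force (Nat.sub (Nat.pow 2 W) 1) fun M => derive W B V M S T

theorem check_sound {m n b k : ℕ} {side : List (List (ℕ × ℕ) × List (ℕ × ℕ))}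
    {C D : List ℕ} {B : ℕ} {S : List ℕ} (hcheck : check m n b k side C D B S = true)
    (h : ℕ → ℕ → Prop)
    (h₄ : C ≠ [] → ¬ HasC 4 fun (i : Fin m) (j : Fin n) => h i j)
    (hk : D ≠ [] → ¬ HasC k fun (i : Fin m) (j : Fin n) => ¬ h i j)
    (hside : ∀ p ∈ side, (∃ e ∈ p.1, h e.1 e.2) ∨ ∃ e ∈ p.2, ¬ h e.1 e.2) : False := by
  rw [check, Bool.and_eq_true] at hcheck
  obtain ⟨hin, hcheck⟩ := hcheck
  have hin := inside_sound hin
  simp only [force_eq] at hcheck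
  obtain ⟨T, hT, h'⟩ := load_sound (V := m * n) (σ := val n h) _ 0 _ (fun p hp _ => by
    rw [sideClause, sat_lor, sat_cells_pos fun e he => hin e (List.mem_flatMap.2 ⟨p, hp, by simp [he]⟩)]
    refine (hside p hp).imp_right (sat_cells_neg fun e he => hin e ?_).2
    exact List.mem_flatMap.2 ⟨p, hp, by simp [he]⟩) (good_zero _ _ _) hcheck
  obtain ⟨T, hT, h'⟩ := load_sound _ _ _ (fun x hx => sat_cycleClause
    (fun l hl => sat_cells_neg hl) (h₄ (List.ne_nil_of_mem hx)) x) hT h'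
  obtain ⟨T, hT, h'⟩ := load_sound _ _ _ (fun x hx => sat_cycleClause (g := fun i j => ¬ h i j)
    (fun l hl => by simpa only [not_not] using sat_cells_pos hl)
    (hk (List.ne_nil_of_mem hx)) x) hT h'
  exact derive_sound _ _ hT h'

end Refute

namespace Refute

/-- A clause: one of the cells in the first list is true or one in the second list is false. -/
abbrev Clause := List (ℕ × ℕ) × List (ℕ × ℕ)

/-- All clauses of the list are true. -/
def Holds (h : ℕ → ℕ → Prop) (s : List Clause) : Prop :=
  ∀ p ∈ s, (∃ e ∈ p.1, h e.1 e.2) ∨ ∃ e ∈ p.2, ¬ h e.1 e.2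

/-- The cells in the rows `R` and columns `C`. -/
def rect (R C : List ℕ) : List (ℕ × ℕ) := R.flatMap fun r => C.map fun c => (r, c)

/-- The cells of the list are true. -/
def ones (l : List (ℕ × ℕ)) : List Clause := l.map fun e => ([e], [])

/-- The cells of the list are false. -/
def zeros (l : List (ℕ × ℕ)) : List Clause := l.map fun e => ([], [e])

/-- At least `k` cells of the list are true. -/
def atLeast (k : ℕ) (l : List (ℕ × ℕ)) : List Clause :=
  (List.sublistsLen (l.length + 1 - k) l).map fun t => (t, [])

/-- If some cell of `B` is true, then so is some cell of `A`. -/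
def imp (A B : List (ℕ × ℕ)) : List Clause := B.map fun e => (A, [e])

/-- The rows `a` and `b` have no common true cell in the columns `C`. -/
def disj (a b : ℕ) (C : List ℕ) : List Clause := C.map fun c => ([], [(a, c), (b, c)])

/-- Each of the first `m` rows has at least `k` true cells among the first `n`. -/
def rowsAtLeast (k m n : ℕ) : List Clause :=
  (List.range m).flatMap fun r => atLeast k (rect [r] (List.range n))

/-- The true cells of row `r` among the first `n` are those in the columns `S`. -/
def row (r n : ℕ) (S : List ℕ) : List Clause :=
  ones (rect [r] S) ++ zeros (rect [r] ((List.range n).filter fun c => ! S.elem c))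

/-- The position of `j` relative to three thresholds. -/
def lab (a b c j : ℕ) : ℕ := if j < a then 0 else if j < b then 1 else if j < c then 2 else 3

/-- Among the first three rows, only row `lab a b c j` has a true cell in column `o + j`. -/
def labels (n o a b c : ℕ) : List Clause :=
  (List.range n).flatMap fun j =>
    ones (((List.range 3).filter fun i => i == lab a b c j).map fun i => (i, o + j)) ++
    zeros (((List.range 3).filter fun i => i != lab a b c j).map fun i => (i, o + j))

/-- The edge `ab` of a graph as a cell above the diagonal. -/
def edge (a b : ℕ) : ℕ × ℕ := (min a b, max a b)

/-- A graph on 7 vertices without independent triples and without 4-cycles. -/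
def sideGraph : List Clause :=
  ((List.sublistsLen 3 (List.range 7)).map fun t =>
    ([(t.getD 0 0, t.getD 1 0), (t.getD 0 0, t.getD 2 0), (t.getD 1 0, t.getD 2 0)], [])) ++
  (List.range 7).flatMap fun a => (List.range 7).flatMap fun b => (List.range 7).flatMap fun c =>
    ((List.range 7).filter fun d => a < b && a < c && b < d && c != b && c != d).map fun d =>
      ([], [edge a b, edge b c, edge c d, edge a d])

/-- Seven rows of size 4, where the first four rows meet consecutively in the first two columns. -/
def sidePair : List Clause :=
  rowsAtLeast 4 7 8 ++ row 0 8 [0, 1, 2, 3] ++ row 1 8 [0, 1, 4, 5] ++ ones (rect [2, 3] [0, 1]) ++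
  disj 1 2 [2, 3, 4, 5, 6, 7] ++ disj 2 3 [2, 3, 4, 5, 6, 7]

/-- Seven rows of size 4, where three rows pairwise meet in the first three columns and are
disjoint from a fourth row elsewhere. -/
def sideTriple : List Clause :=
  rowsAtLeast 4 7 8 ++ row 1 8 [0, 1, 2, 3] ++ row 2 8 [0, 1, 2, 4] ++ row 3 8 [0, 1, 2, 5] ++
  zeros (rect [0] [3, 4, 5])

/-- Six rows of size 4 in seven columns, the first two meeting in `t` columns. -/
def sideMeet (t : ℕ) : List Clause :=
  rowsAtLeast 4 6 7 ++ row 0 7 [0, 1, 2, 3] ++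
  row 1 7 (List.range t ++ (List.range (4 - t)).map (4 + ·))

/-- Five rows of size 3 in five columns, no three of which have three common columns. -/
def sideFive : List Clause :=
  rowsAtLeast 3 5 5 ++ ones (rect [0] [0, 1, 2]) ++
  (List.sublistsLen 3 (List.range 5)).flatMap fun R =>
    (List.sublistsLen 3 (List.range 5)).map fun C => ([], rect R C)

/-- Two blocks meeting in a column that three further rows miss. -/
def sideBlocks : List Clause :=
  ones (rect [0, 1, 2] [0, 1, 2, 3]) ++ ones (rect [3, 4, 5] [3, 4, 5, 6]) ++
  zeros (rect [6, 7, 8] [3])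

/-- A cubic graph where the neighbourhoods of row 0 and column 0 are not completely joined. -/
def sideCubic : List Clause :=
  ones (rect [0] [0, 1, 2]) ++ zeros (rect [0] [3, 4, 5]) ++
  ones (rect [0, 1, 2] [0]) ++ zeros (rect [3, 4, 5] [0]) ++
  ((List.range 6).flatMap fun i => (List.sublistsLen 4 (List.range 6)).flatMap fun q =>
    ([], rect [i] q) :: ([], rect q [i]) :: (List.range 6).flatMap fun j =>
      [(rect [i] q, [(i, j)]), (rect q [i], [(j, i)])]) ++
  [([], rect [1, 2] [1, 2])]

/-- An 8 by 8 table with a block of size 3 by 3, with rows and columns sorted. -/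
def sideEight (a b c : ℕ) : List Clause :=
  ones (rect [0, 1, 2] [0, 1, 2]) ++ labels 5 3 a b c ++
  ([3, 4, 5, 6].flatMap fun r => [[0], [0, 1], [0, 1, 2]].flatMap fun K =>
    imp (rect [r] K) (rect [r + 1] K)) ++
  (List.range 4).flatMap fun j =>
    if lab a b c j = lab a b c (j + 1) then imp [(7, 3 + j)] [(7, 4 + j)] else []

/-- A 9 by 9 table with an isolated block of size 3 by 3 in the first 6 rows and columns, with
rows and columns sorted. -/
def sideNine (a b c : ℕ) : List Clause :=
  ones (rect [0, 1, 2] [0, 1, 2]) ++ zeros (rect [0, 1, 2] [3, 4, 5]) ++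
  zeros (rect [3, 4, 5] [0, 1, 2]) ++ labels 3 6 a b c ++
  ([6, 7, 8].flatMap fun r => atLeast 3 (rect [r] (List.range 6))) ++
  ([6, 7, 8].flatMap fun c => atLeast 3 (rect (List.range 6) [c])) ++
  ([3, 4, 6, 7].flatMap fun r => imp [(r, 6)] [(r + 1, 6)]) ++
  [3, 4].flatMap fun j => imp [(6, j)] [(6, j + 1)]

/-- The data of a refutation. -/
structure Cert where
  /-- The cycles of length 8. -/
  C : List ℕ
  /-- The cycles in the complement. -/
  D : List ℕ
  /-- The base of the steps. -/
  B : ℕ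
  /-- The resolution steps. -/
  S : List ℕ

/-- The certificate refutes the clauses. -/
noncomputable def Cert.Refutes (c : Cert) (m n b k : ℕ) (side : List Clause) : Prop :=
  check m n b k side c.C c.D c.B c.S = true

set_option maxRecDepth 100000

/-- A refutation of `sideGraph`. -/
def certGraph : Cert where
  C := []
  D := []
  B := 277
  S := [
    9624955, 2077350, 386140, 7763314, 667826683286, 5909420563364560340809357621, 10698678,
    997091604756229, 1277041429198150009242712, 355877102177, 4686889753232785370265,
    62320183246061356672743, 1240818, 10776138, 1141574698926768478, 5925161, 2467935,
    115317126823294213439828, 2503272375506685253, 1143335485416156, 29565943929142237760762,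
    43568779217582547978178, 5840975, 402671846800885157743031036, 72476088165458412412083,
    11476457, 1594188855219710183294617903, 30398797685958334142755, 89860888, 11017230,
    2775809204680063525496165835611, 134467830266137869729297, 3705154018891389023462708926,
    499461774636896976478945, 2771, 11093661, 13162323, 2626325943563795311210532770, 12626309,
    3618624, 1341499221966163523974613242863, 79774010500193775, 5397351563892079829889166,
    123919119558563240409, 38447073226249379704423, 615891736934713422346346872832,
    232642032004877, 736251062149487257924833993795309, 8166675,
    848414381437883713691086939781981, 3267665114578006156578570954525, 575811170786531241,
    259751107595969, 3879844245905754281690659066674, 85660026072370698,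
    329256576295996253365839590462608733, 14707714, 1300609776559848241433326157491379,
    3004759523622647760, 18423967912150655551576032841, 5309738081795732297540345251544,
    1527526774094787691098325451412933, 38167855113020394139, 20208314167067305639095,
    1140029582103648098, 37254234861967920710121240202493757870108,
    10662992828578417044563223501747178810003266, 87885041046797545177132567, 2723958178151,
    304408717440872, 752645980451606723255885401261, 7769849268081, 3100036407715247969512,
    1555258490403315, 269317466884674086009, 1634492288026586096344244813130, 4371598711351922,
    12606249456085702156139011, 4971822955966341, 74883781041, 1581656659506234434336026741651,
    16326492, 326903707, 42587638559265047762183734, 591486540248684026, 2261113512281644,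
    1075192374946596793780593841110330, 53257047009882001983895199, 9852961795937953,
    134314083402, 16951588468612677028970804416, 23626854530, 152100920999,
    407429341955278748510746528231222357, 1526372209262555968831104836482666,
    1583247612843188373101178227018158, 125916187885127365650366557793174437181,
    296107051217237985221903, 1752637030809539801308078556145301,
    1809406762275743287315807414913670, 24314153076744593369352056171, 90441910549858312618623566,
    7142833966501524774979129027585, 2038153380314491338754156689783843, 87212, 12097657,
    177534062694745473889118989084582, 2683427095290, 2325539055603628,
    3699379916626531818001570475, 38843808567, 19038941359578446361271686, 14687755721534,
    122432458603175716795588404, 5886055376189215497, 2453149184472370786844430005557,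
    70940456436, 737677874116466997926987019011103, 1899978132522287423, 145818446141780254411169,
    509409401177396047485439, 462862679318236, 66157963667795530370840820820382258946201,
    41307317312860382910516364522, 4084883986377702955357659648980,
    91235404700014330879763505498126364847, 93334, 160357, 490884974068211,
    1481591339349233503349675612, 46482532941682765389566931484, 47221859413283974795075605723,
    282348362155649511995378006020603911320, 95283, 162306, 5930463806]

theorem certGraph_refutes : certGraph.Refutes 7 7 7 4 sideGraph := by
  unfold Cert.Refutes; decide +kernel

/-- A refutation of `sideTriple`. -/
def certTriple : Cert where
  C := [
    5161601, 4771713, 3073153, 6019785, 5165193, 5164873, 9954002, 5163137, 7595145, 3071874,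
    3067777, 5009225, 5750921, 2968962, 5460609, 2715393, 8041105, 5751425, 2959745, 7856337,
    5169793, 2702209, 5040257, 5419649, 5036161, 5496969, 7942785, 7557777, 7480017, 7680137,
    2779841, 7906497, 7823497, 6017665, 7873233, 9876226, 2967681, 8004305, 4743049, 7516801,
    7856785, 3070081, 5492873, 5681793, 7857345, 3630209, 7418497, 7381201, 2977602, 7611089,
    3585281, 3889281, 7648385, 2776961, 5165697, 5167241, 7742161, 9954506, 5037441, 5024065,
    2778305, 7348945, 9913730, 2971777, 5168513, 5984393, 5032065]
  D := []
  B := 566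
  S := [
    48140, 48705, 49271, 49836, 25358526, 25999802, 26320724, 26641646, 26962568, 26958040,
    27607807, 54361, 8944620531101, 17074066189, 9150239749410, 9357311460690, 29529944, 29854828,
    17077279578, 30492710, 9871359186670, 54927, 17619644549, 19617705487, 60007,
    3326561997839724944, 11925732698408, 7420590182174619464068732734403807573011887183694,
    13223474780486945715981648163905105872965444937, 12642532520582, 686784417857480212067100489,
    365154515254477937202514107554, 40928108349919845381372176708330217000541, 642655602683,
    7483934417999640158472643047846231800136327571065,
    12447726710085763203633122492782602165823511990, 4018501404465396730,
    1200913958743341243228217, 140738874267191509081408956044173239,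
    135338102727287484625397662005488898, 427814557917042489,
    4919667054621502754426883099894827652572, 3572328220535941129972004288059506582336388,
    402288201375359506168747346100, 34781443069817110689617578301761,
    779910183489353310741348737511265181211765605102294398993973, 93716037,
    40544520036468975165913903093501, 254469062252895568922546247350034,
    82118445016357550676179723414634652699,
    51826673915294191635991805405483658490381156857975577038388, 3977,
    16458151632691339923414541886837322932816998508856374762069603187675788008848771,
    45448142741675470806340300713320302440409, 25922763442682184606091472920274941182051859,
    502922601147618860974362016293, 162420568069519429449855066497818592,
    7740389780576664947142299540880, 23022095943070266807, 105720687156, 211245313420,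
    311339905451, 989385552, 51340912411109119442760645932652876669248,
    1387134872178826792353410975812431562208, 5661, 1926126, 1926133, 593391060, 248283538981137,
    305525273164113, 206163502858, 308973111993, 254653087643421544339729592509635028540079361,
    591, 369371063, 23615460063065302739, 42256994109299944303, 116278219289586]

theorem certTriple_refutes : certTriple.Refutes 7 8 8 8 sideTriple := by
  unfold Cert.Refutes; decide +kernel

/-- A refutation of `sideMeet 2`. -/
def certMeetTwo : Cert where
  C := [
    3102484, 2295748, 2295412, 2987236, 3061828, 2312555, 2263163, 1456427, 2312219, 2197307,
    2147915, 1341179, 2305499, 2138507, 2187563, 2329362, 2263506, 1456770, 2329026, 1035762,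
    2214114, 2148258, 1341522, 1038114, 2322306, 2138850, 2346169, 2345833, 3136098, 3086706,
    1473234, 3135762, 2971458, 1021650, 3129042, 3152905, 3087049, 3152569, 3037657, 2971801,
    1038457, 3145849, 3079993, 3063193, 2945593, 3169712, 3169376, 3054464, 1506848, 1036448,
    1391600, 1375136, 1022336, 1038800, 1382192, 1523655, 1408407, 1523998, 1408750, 1039486,
    3103513, 2296777, 2988265, 3062857, 3103856, 2297120, 2988608, 2181872, 2330391, 2313927,
    2198679, 2323335, 2306871, 2347198, 2347541, 3153934, 3137470, 3022222, 3146878, 3130414,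
    3170741, 3171084, 2988272, 3129056, 3079664, 3011456, 3145863, 3080007, 2215150, 2323342,
    2306878, 2205742, 2232300, 3146885, 3130421, 3012821, 3055843, 3146892, 3130428]
  D := []
  B := 494
  S := [
    6265930377065, 6325604988711, 6385279355827, 6444953479895, 6802274163069, 6564302459151,
    6564423257465, 6624819727599, 6743325561487, 6862432945103, 6803120727905, 6863517198039,
    6922348909341, 6982023276951, 7041818197851, 7637352914667, 7101613364269, 7162009834403,
    7756822448201, 7281478878877, 7459417973301, 7399985202319, 7460381672453, 7520176349317,
    7578887751365, 7638562118975, 8174663820773, 8234338187889, 7936812670145, 7936933468459,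
    7997330182629, 8115835772481, 8115956571289, 8176473594713, 8235184752725, 8830840266373,
    8295100472433, 8890635432297, 8533556346245, 8474123575263, 8534640598687, 8593351756699,
    8653989332919, 9129334854037, 8772495412819, 8951276919515, 9010951286631, 9070625654735,
    9071589352899, 9071709907177, 9190817534829, 9368515521191, 9310286579303, 9310407377617,
    9368998469917, 9489189372879, 9548141882001, 9548984538803, 9607937047925, 9667491105293,
    9786838864369, 9846513476015, 9906187599589, 10322941298275, 9965982765513, 10025657377159,
    10085331500733, 10145006112379, 10265076704605, 10264354847599, 10502328261745,
    10383462475251, 10443137329945, 10979238544659, 11038792358485, 10682797277381,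
    10682075176833, 10920048590979, 10801182804485, 10860857902721, 10980326216569,
    10980447014883, 11099554397511, 11159228764627, 11218903132237, 11278577499847,
    11278698298161, 11338372665771, 11457600847207, 11457601091737, 11517275702889,
    11576950070499, 12112930730935, 11696298318141, 11755973172835, 11815647053361,
    11875441974755, 11934995788087, 11994670155697, 68955088, 130334771, 5910333331, 189996403,
    7100922666711901436353, 2681359238993, 51824234269882001, 7239635218899716074,
    17747519948318878650641, 5191548420254, 43105559124800364193, 178923068589, 58221177541992947,
    3953, 3673634, 94767735110, 251497, 24207717, 29113452909295739, 43644697535264654, 64307053,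
    14376556464593202429, 88332558845064, 22738136, 23198051, 43658574514528093, 29094437,
    29213618640020720, 21301326441271671242158, 101779885418366533, 28391748610580247960141,
    15781133215600805961884099, 3047620427567, 143617276753603049677, 617987655842327,
    647466781972955, 81608390397954803234420, 2753585362658, 76291933, 151365358,
    3965865847837667708266892980, 19318674, 21294147534328043529288, 206115051763451, 34724076,
    64643886785690404290, 35509396255868210657208, 60417253523, 86182199432452200777,
    382632780944419, 5994493373354942419768974939912, 17920933322059773, 119307399881,
    88377628181780, 58221184537071002, 35912151210622972025, 588509120039244, 617988258118259,
    1483, 1483, 1284029057, 12352982988745354847389333, 45581344301476378392334179, 1977,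
    14945686268609066, 50848107849301263091741017, 44071074209455174, 496, 124949001, 245747336,
    59802982297]

theorem certMeetTwo_refutes : certMeetTwo.Refutes 6 7 7 7 (sideMeet 2) := by
  unfold Cert.Refutes; decide +kernel

/-- A refutation of `sideMeet 3`. -/
def certMeetThree : Cert where
  C := [
    2121707, 3135769, 986027, 1774199, 2836323, 3129042, 2197307, 2227694, 1844507, 1403116,
    2917467, 2326625, 2919672, 3078292, 3020521, 2843043, 2944564, 1407721, 1842155, 2977492,
    2954658, 1778315, 1790999, 1520568, 2961364, 1844171, 1793008, 3086706, 2187899, 3037321,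
    2936479, 988379, 1779001, 3021193, 3152905, 2215150, 2329362, 2181529, 3170748, 1020327,
    1841469, 3136448, 3055507, 3069906, 2893457, 1846229, 3038007, 1845200, 2131115, 3169712,
    2978864, 1846222, 2147915, 3054128, 1776649, 1021307, 2962050, 3741018, 2343768, 3062850,
    3153255, 2347205, 1472548, 2953636, 2970100, 1842848, 1021650, 3054807, 2960692, 2305499,
    3136112, 1456427, 1842841, 1341179, 1247050, 3152576, 3169376, 2971458, 2180500, 2953972,
    1364699, 3170055, 2256107, 3153934, 1391600, 988722, 2945257, 2327997, 1794772, 3061828,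
    3095428, 2231950, 3038693, 3011106, 2295412, 2962064, 1778658, 1022336, 1795115, 3020864,
    3129392, 3085348, 2296784, 2988272, 3129385, 3037328, 1374107, 3069220, 2345833, 2180164,
    3096457, 3096464, 2263163, 2986900, 1841819, 2970772, 3068884, 3102484]
  D := []
  B := 504
  S := [
    65596, 31564082, 63074, 32073122, 32073626, 69122, 32579138, 8340290543666, 16678253162,
    35374825, 33601753, 33856273, 34106257, 36397441, 68617, 69625, 37155961, 35637409, 35890921,
    36145441, 18215817049, 36401473, 36910009, 77185, 18730710505, 37672561, 37674073,
    9633338680465, 38183113, 19370325313, 38945161, 78193, 39201193, 20141265889, 39960217,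
    20139996817, 40473289, 10279990772929, 20527115185, 20653619185, 21037437865, 20910175345,
    21038199913, 10732429342225, 21551059225, 21551060737, 11377798142329, 43014961, 43269985,
    22192452145, 22064428585, 22320985249, 22323014857, 11378953410625, 22705566985, 45050617,
    22962378169, 22962378673, 45814681, 23218682833, 23475492505, 23859312193, 47086777,
    24756240169, 24116630905, 23988354337, 24116631409, 12219691002193, 25269609025, 25014832822,
    12413392073282, 12542824503794, 12994364360954, 12736653445730, 3382987551942375907,
    13424395942889446916069166, 417599508463121174544404312, 435196417153926624969505064,
    56524930366452401424401787833021143, 1345153851, 14494983781510258816212196407073193197461,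
    56791233727857982413865862395906961, 884404159610132641070519, 431022254215416305030031406,
    857780113514953046841612, 1779121, 13616787042167, 301898808789862262, 318321361398198039,
    113225039141671452687608651599600, 452055559751996016411160531, 1009, 7200895724864933,
    118558966803846152826791728148483, 14395163444148, 3579444027451669126960951267014007357,
    29033506007334611995270704187, 121228664705447131518987562320762, 482711161584234540,
    62174330583265819789233730324744045, 1082015969421555669034225491926143383323294,
    3695281630052880464, 70206809049968522505753551, 123899019723269204448634222384182, 4832857,
    2352389237935, 10065092629130420886065694154748513, 3892255401244638151,
    485708197684635184444126016, 535861528604732094097747535001121209071344875959771212,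
    996988874696522508881592, 2740815764617, 1398496099872091, 7742638342832201,
    20684416951562233756, 261732610251129166713810896621, 99625137095040706057600244, 3306241,
    999615912832611733831006, 21169, 263440682140930414496939052253, 7983601911021499,
    34404254735904488980453347422315673519, 4154791603401991707,
    1909066110771762267614137668299552040647222, 20698, 1009, 133516539866538010618669326560335,
    7635364216, 1967869041367630, 2143693741564281642985, 1024694292550340398,
    136723072762308941384720317837184,
    2025067984427812697177509073988321730987983608263896397437098, 3029, 33312212944,
    2152053159619052949073, 5593393, 3366241054347016686641200894047274,
    4812082124615756086312045808518647535656, 17914222368318983955587241278497600031089, 4033,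
    9166882903593984515463788719266212213958877, 1147184416192124105765736, 17615299530613,
    575262420020169588259004915, 146862984290575920169186735865228, 1009,
    9304860341529761226982723122908329189870562, 335394773692884682270000,
    296695216870110404791690566175, 9123453803294033, 28078168730942507696959591194,
    301999821887630545976610307820, 1922254237691859799050584953570133363478,
    360358602683979962496007, 46673395897562345232754648227239, 520, 1026, 509600, 129184919463]

theorem certMeetThree_refutes : certMeetThree.Refutes 6 7 7 7 (sideMeet 3) := by
  unfold Cert.Refutes; decide +kernel

/-- A refutation of `sideFive`. -/
def certFive : Cert where
  C := [
    285736, 219930, 101850, 371551, 185705, 121775, 140275, 124825, 122850, 117975, 207425,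
    217355, 187325, 215530, 233180, 301836, 140400, 190455, 208025, 124100, 120975, 370236,
    349236, 274351, 232580, 151825, 182725, 154650, 216725, 185825, 367101, 155425, 220405,
    232330, 207975, 230055, 232950, 200730, 223575, 119975, 365066, 232305, 133100, 108550,
    218275, 209300, 229900, 132425, 189905, 118575, 352591, 184305, 230530, 364101, 218555,
    202530, 154700, 199350, 230525, 284311, 217280, 137425, 186725, 183105, 118700, 229950,
    383551, 137150, 193650, 199950, 154050, 183350, 213180, 376581, 177300, 229330, 134300,
    346706, 183925, 368301, 204980, 199275, 229325, 124150, 217100, 185730, 216305, 283936,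
    366991, 380426, 204230, 151775, 362306, 150950, 204855, 183230, 116825, 198900, 135550,
    137175, 174805, 202100, 286936, 202700, 221055, 102425, 296436, 124225, 147925, 202650,
    102350, 348866, 199355, 188730, 206180, 188605, 107975, 232955, 183680, 190405, 140425,
    233525, 365301, 362066, 218300, 121575, 134175, 154825, 184330, 187330, 222925, 135600,
    148700, 137400, 352351, 186930, 183805, 184300, 233300, 199900, 108425, 220580, 229405,
    295226, 280226, 213975, 223700, 233155, 132900, 105600, 216355, 132300, 220455, 215555,
    193700, 218550, 189780, 149150, 346466, 198855, 187305, 216730, 288976, 201075, 135975,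
    352356, 220530, 233550, 202355, 224300, 176850, 233555, 139100, 232700, 101725, 193525,
    214355, 218155, 116725, 178050, 228925, 199455, 198100, 222950, 186730, 109050, 183725,
    382581, 198975, 105925, 213675, 229575, 223050, 198105, 215550, 217350, 368191, 201905,
    124700, 201080, 192975, 187075, 223650, 229305, 105300, 202350, 176700, 349116, 216680,
    108475, 202955, 186100, 368316, 198075, 132975, 136150, 149175, 121825, 199955, 218180,
    202580, 139225, 186105, 154175, 229905, 192900, 231930, 200850, 202950, 118100, 213350,
    365061, 199405, 176825, 109075, 104725, 177350, 230550, 149275, 232050, 140300, 151200,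
    183300, 213780, 151175, 379701, 152400, 193100, 204905, 149300, 187050, 191850, 204355,
    147950, 198080, 209175, 108600, 230555, 183950, 376706, 221180, 286226, 368551, 199575,
    151575, 174930, 173730, 219805, 349466, 213900, 209275, 207900, 301826, 154775, 177425,
    224150, 138600, 102925, 213855, 186355, 213230, 132475, 379716, 148650, 362061, 360866,
    202025, 221030, 206055, 183180, 206155, 224175, 207350, 134150, 380066, 383556, 118025,
    133025, 213725, 139150, 232325, 376461, 229300, 290551, 216905, 201980, 286236, 154075,
    218525, 216980, 119700, 365316, 379466, 186475, 224275, 121225, 150925, 132350, 152175,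
    215175, 208100, 229455, 174830, 119725, 176725, 230175, 268111, 152425, 228805, 122975,
    118650, 285976, 232530, 189980, 382591, 352716, 177475, 232300, 214350, 271836, 368556,
    148525, 232905, 199525, 232900, 380316, 190580, 271226, 201105, 138550, 216475, 185850,
    223525, 136225, 305551, 134275, 229525, 148050, 229955, 213730, 189855, 138425, 197605,
    104950, 101700, 103050, 188705, 107850]
  D := []
  B := 1217
  S := [
    572349, 572349, 698167702, 574783, 701132314, 702614620, 579650, 705579231, 580867, 583301,
    584518, 711508452, 714473064, 714474281, 717437676, 717438893, 718921199, 721884593,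
    721884593, 723366899, 724850422, 726331511, 727815034, 729296123, 730779646, 735222913,
    733743040, 738187524, 739669830, 738191175, 739673481, 741155787, 744119182, 744119182,
    748563666, 747083793, 748566099, 750048404, 751530710, 754495322, 754496539, 755978845,
    757459933, 760424545, 760425762, 761906851, 766351335, 932649779597, 766354987, 769318381,
    769319598, 770801904, 773765299, 773766516, 775247605, 776731127, 778212216, 781176828,
    781178044, 782659132, 784142655, 785624961, 788588356, 788589573, 790070662, 791552968,
    793035271, 795999883, 797482188, 797482188, 798964494, 803408978, 801930323, 804893718,
    806376024, 806376024, 807859547, 809341852, 810822941, 815267425, 816749730, 816752164,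
    995788646277, 818235688, 822678955, 821199082, 822681388, 824163694, 825646000, 830090484,
    828610612, 830092918, 831575224, 834539836, 834541053, 836023357, 840466624, 840469058,
    841951364, 841951364, 843433670, 844917193, 849360460, 849362894, 850845200, 850845199,
    852327505, 853811028, 855293334, 856775640, 861218907, 859739035, 861221341, 862704862,
    864187168, 865668257, 868632869, 871595047, 870115175, 873079787, 873079787, 874562093,
    876045616, 877527922, 879009011, 881973623, 881973622, 883455928, 884938234, 886421756,
    890865023, 889385150, 890868673, 892349762, 893833285, 895315591, 896796680, 901241164,
    899762509, 904205776, 902727121, 904208210, 905690516, 910135000, 908656345, 910138651,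
    911619740, 913103263, 914585569, 916066658, 920511142, 919032487, 920514792, 924958059,
    923479404, 924961710, 926444016, 927925105, 929408628, 930890934, 932372022, 936816506,
    1140106055917, 1141910023507, 938301248, 939784771, 941267077, 942749383, 944230472,
    948674956, 947196301, 948678607, 950159695, 954604179, 953124307, 954607830, 956090135,
    960533402, 960535836, 962018142, 964980320, 963500448, 964982754, 966465060, 970909544,
    969429672, 972394284, 972394284, 973877807, 975358896, 976842419, 978324725, 982767992,
    981289337, 982770425, 984253948, 988697215, 990179521, 988700866, 990183172, 993146567,
    993147784, 996111179, 997593485, 997594702, 999075791, 1002040403, 1003522708, 1003523925,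
    1005005014, 1007969626, 1007970843, 1009453149, 1010934238, 1013898850, 1013898850,
    1015382373, 1019825640, 1018345768, 1019829291, 1021310379, 1022793900, 1025757295,
    1025757295, 1027239601, 1028721907, 1030205429, 1031687735, 1033170041, 1036133435,
    1036134652, 1037616958, 1042060225, 1043542531, 1042062659, 1043544965, 1045027271,
    1049471755, 1049474188, 1049475403, 1050956492, 1052438798, 1053921104, 1055403410,
    1056886933, 1058369239, 1061332634, 1062814938, 1064297244, 1064298461, 1067261856,
    1067263073, 1068745378, 1070226466, 1071708772, 1074673383, 1074674600, 1076155689,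
    1080600173, 1079121516, 1080603822, 1085047089, 1085049523, 1088011701, 1088014135,
    1088015352, 1089497658, 1090978747, 1092461053, 1096905537, 1095426882, 1096909188,
    1099872582, 1099872582, 1104317066, 1104319500, 1104319499, 1105801805, 1107285326,
    1108767632, 1110249938, 1113213331, 1113213331, 1114696854, 1116179160, 1117660248,
    1119142553, 1122107165, 1122108382, 1123590688, 1125072994, 1129516261, 1129518694,
    1129519911, 1132483306, 1380033749327, 1133965613, 1135447919, 1136930225, 1139894837,
    1139894837, 1144339321, 1145821627, 1147303933, 1396269457947, 1147306368, 1151750852,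
    1455797426486, 1765129123691752, 1992379483, 456193248, 1446780544630, 344502951239,
    346306898170, 496864860355, 463709452, 1203638741, 201568873, 4445733052039754,
    4458919985426511, 410542378, 1211050311, 573519397422, 1228837836,
    52804563145936736797058092146403741645, 28887775896211195763798253, 1230317675,
    10692167806206591568395281, 22968897104384463631767983689575,
    44582114187309745066810319145288323930, 5713399140757811054780841572921139,
    2721604903740281140559, 7932893920979893507857, 14421557109, 2198905196078362811,
    9628507611152247827181997, 1230321486, 11718382116188476410671036443, 1248105496,
    28642643917675565094163740855255, 244593997038, 3057996100,
    8581860211547101428332948357247836831556, 31664311389392870623891, 43522982953186541439838,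
    47453175293427494117403, 625748462174472, 218922366967342950549148417910124697504676494,
    136489842, 3069858402, 21812409554994580911056913065787, 3724272659775, 3053553095, 483171731,
    3969919052938461563267097275, 163032618, 43864147797565908716677898, 39558269517368044432347,
    1868317592606202, 57754513819420052471757604, 1289602900, 1825098017357901,
    2819007807760223137312246213493065583, 23503043275039024347991439959,
    728466358537644998393729, 1297019188, 4028371173350953801705547419, 1511017692452, 3103951336,
    23662361191710962709434584425209675313779575477375560928, 344607644655892, 452101773,
    579128355622253440374594744495503452422494449034556, 1592904885306, 1830630501, 280411058,
    1580271192523, 296653145, 63609256452802926420555036354918889342, 1929775444188623,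
    6519336128442850670, 5568878077612901191, 369536178828496207746023359959896219404,
    3183453541898615, 11891918247756652566043239323, 1614552496533, 2201185144,
    95769210276648229030733089007914622570249997479, 1885871198702962, 517056725,
    31771522368387071619121, 5899969877083556372076062436, 1543272645456,
    64639460100308332173371259112, 2215604414731, 4411984514052,
    6177045454277172684484525617157610, 1960518584785675, 148585617, 505329734, 3828023738917,
    43752665910649632954808400538296061, 13187390309099, 1639811015856,
    103002991318498494114907432488722639472099, 74861266570433211, 1342965726, 1359271286,
    338506921876622492802190303561218262445796665048603551, 2351271087584512581,
    393691167588861542103774168705360379578836383001493, 9310680569039811876335286635853259428074,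
    290512812816, 10788903620414544896569, 52940997830, 33741788045593264966595089913139,
    224096615054, 5341534076385783, 15713106958381845986987009, 62321708072,
    43318716773922046591122620, 604379490845, 95460738360980871076354868103746768, 1353341774,
    4454734438609072440984492948, 39379407058237581, 623811985, 51987902779447592953,
    15433907418686, 39488389117886, 457658664643763174388190049417133596236173437999303,
    1365200559, 83815666387478141096495, 234322146142652335427928808842526286780,
    4338517376434394467, 2524877677898012325, 17578200275060860191150282631, 866997233106803581,
    35793050257559590632050351702899, 9605927689529791547181309644083025008139, 616511207,
    3160281549, 1683098820265, 85437294263460823, 158815413365227227057631551, 92787598358329981,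
    93809820710623322, 3221048836, 390588589360545373622598734306580473657,
    6997505318810621707061, 139282016994, 422260642506506957047636866461234814168,
    156845049125026362114744196987373, 10954736635399601224945, 171299483469447883988597451525298,
    312918402, 19851211101653824894966984015104, 422706991728003042472340219567696597880917421,
    110844218423635246890115594058274125918171285884461, 1434873871, 144386509589327130181001323,
    17606051677823283055370071680, 51477923444998287025260452921122941230229,
    64334771764638753702660201289756748730705, 93942201642297283391594871301817101906301606,
    54587230130, 185485322023028676068373683776312422118402196821992,
    485816506829622852024316149562257247, 278007128311733346272878796,
    918878962350501624629458991057030729113817141, 236350879839771689634106, 1448219287,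
    965835032998946684856316796614636916770358607,
    140125892160054930978602967345024159048224456875418,
    89966763561541653241839379038587725849543, 125136335659263230681546829821875928800461000,
    32479188845576099866350176553596780246312826298319080818513,
    13551206628306934568973582954139988376962, 220220791069420888079, 14707930415640333554189048,
    42828062109194589778316695383883097073, 20924078, 283837613387736975955855,
    163471532525463671261171163866404975233432616359378, 62742066535316922503134662987157,
    11755984838931120491261715299, 1448210559, 11731932804404265941877691119,
    104095375176225358189828986094829524, 157255059507044778603908973229332,
    834099607641288655932554744866990215384,
    56917112809808350038170989103943086803568302618800385, 17690519514942136160601877226,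
    23551526073495989140675439758, 24168063050760993727478964,
    52243246295650910903045104342526892, 22820547510952597115,
    77162412434940477205824873997274698992066, 73968166283416846373229656211905974992,
    277566140588552881984510722774726118, 116398920065547594097830241987273193538,
    72460325377520396079774760902621766895116655448,
    986408726678679645811224810932481828648759881774482365,
    395354286470015630468803579380043143340467749616012383, 5708621405113566206920416293439,
    6600397899057400016, 26142005623195024863034400618036383, 105603917842746497026220808861,
    3262343695233099583, 5865838381871275921474707539, 22798830781043458152,
    84636712030466168220213635553444346163, 591483978299743625394578492251,
    22785211676933693876059543849121350854907818295014242, 54926850335905,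
    411229168551535559434326, 48250703883556683838829481666375031624754691,
    27842415005733059441078918012186208402394251624784399943,
    12705281376276487010334497192437993025172211, 8587573868759122106914599743103433733,
    638372030768177372609824752367, 1522134826849283711403749756447565967612549875612287571,
    4634691561770494341156468413851103391023914492262750309757913, 5939768350024485515025802,
    7598373573110623, 14443878929263047638086386, 28518762140020685564961118474725,
    846750599789014591, 3375187890340725408504, 73915932124933018111918481375909981063,
    69423974335990454451246464637697219, 38853675576169522752835, 493985261989279,
    43500240675305226696792, 70288734517317251844487815223, 76139409416889715365667768595,
    67391574236342670063265147, 34738999056748, 250245642868142311900238601049388060238388439,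
    12974926305649935894986936615113993070271483, 156195010095230072213912724029684561,
    52964708239220868, 3291244135910477612160, 221695762261951517667348949376669465382,
    87032985131868350414413, 2974617990, 66317315907221610, 224142533358371622652288899755455440,
    659585822, 647872336372, 16725773320238060854849833958, 77436809179933364, 2209590551627,
    416696973, 153991565708205582836662794, 7244122239269997023698921152430,
    104118132328195887638208687701473530, 4066737786517, 1559384957, 934462614894,
    488201038596096996544026319551032942163879, 277981664949049130661175428294996, 72604971177,
    27687147211188823080590, 364345685664301323713975258841124976,
    818154733621554044929145806681496853620665859295, 381707030349906578085999659487806062,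
    4994850345753729319822565735, 4999666291979867947169110617, 185846631836450326567529,
    230979435242659718073603566, 1593486542, 240618674034391644784265817,
    303689465427998171143697945254, 1546047316, 1547529620, 1551974101, 1275993, 1277210, 70427,
    1279639, 1280856, 1282073, 75300, 76514, 77730, 78951, 80173, 424072046,
    359631785844276845757655876484829905739742827, 531783366333996717989111475116111544754856521,
    263903742822842148561448789863887126623, 26072745532363649408522692644822946179419,
    8723446132345323034525613079903397, 38178102879531189583275292799811230371339323730,
    278086451502150323882263257423896, 234256745913319751393839665962,
    13279092688508436533180824180992393322161, 799173501762585395841653968721778785973397608232,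
    281769752972925, 21493072916615213488755735327375069102, 38981934996, 2958004409554741,
    1416204518, 723757169550703814576351149653707017130731679925,
    1134814113517007228068938851185957264382108555701120, 48000651022,
    797857139277313918126539021926509292908140962, 39481241233, 9711049688262931097234637,
    31866769598130868130414262879026049665, 28648614526966478024850135368507,
    9643829178333108642700270, 35262370163729329248529723387, 33790777914771264179774437,
    5894797336471506419514577964, 6521997059966652725, 31754042104478602359890253946539222558,
    92657270278632509251350950679610981781862847796395, 127015562037950089311942412815783042020,
    2254659265, 304498, 29968422524646225942119757611967380, 13000950510163028873, 659559275,
    6585085962227, 6220025576371860715, 102801009815322661808190553872430899773003, 1007467744387,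
    3490833495, 47038111003827725361806, 7783179895, 716886320522,
    218977819422726524507610890417963064299987743, 234624550311919004448739552482457224190843323,
    250271324048287095760711419533073411477560170, 1698724299,
    190106666705376217534646170160043608362, 361706611197259751289532347087874978007980959985,
    380748747849606024414335583510727076523564414789, 671603940, 1035303337278,
    163943675732607148505931552016900, 1677972139, 390924453160788161669926412956815663366946571,
    84491306523306563828, 74585290192011969, 199607900629285176812220737257275,
    206740750423031519948960048222988, 2321510665268, 5481870306176641, 9923215026918473441,
    147106141953409, 242335037895818967106956487986006, 249479908318814614208619054664096,
    256582832352733157970972174231140, 704026229309691518905093370939591912134385922368,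
    270848493175700283238050956104215, 338339772917650676078082696894556942,
    285090772812518040262337539664390, 292223617794278622242756006832477,
    799174325350218758228783427556987619007543900295,
    995942909087285785589932358642705039676064077811896, 1297, 2512, 3729, 3963851037016464761706,
    24067865953684240820453159, 34715568235412373716926215032918522,
    63368915225551678154244188530997480652, 19792640719699536276202,
    41022237860027743311825744851, 69452499879811545780096212596397146,
    468442455466295428765783237088160587, 477116006681312290135626535855627867,
    85582422552298117832300284231622, 95501655816293717390977955275074919,
    229369642705479625937378, 42276468278403620919, 235279838303260798318704034464148089809956884,
    357304690396292357226057717384, 537887834208683639107624835617476070, 5410384046, 36077033996,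
    142601772700525, 1562592, 3044895, 4527205, 5345908311075837, 69417254929323879,
    495111172998206125675789110714721748322247859410, 2244132756238, 2731111333787953,
    5352456749111846, 1805453539]

theorem certFive_refutes : certFive.Refutes 5 5 5 5 sideFive := by
  unfold Cert.Refutes; decide +kernel

/-- A refutation of `sideBlocks`. -/
def certBlocks : Cert where
  C := [
    16351641, 17400663, 10172142, 16333830, 33214422, 17272692, 17288406, 16875063, 31546116,
    17332470, 6059044, 16763445, 21588049, 16331958, 17407962, 16881634, 6060421, 16327098,
    26430067, 16748300, 15537825, 11549719, 16216786, 15044544, 17270181, 26301296, 15511743,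
    17389737, 32749221, 17383340, 14934465, 31109781, 26763147, 21980178, 31153987]
  D := [
    15995393613099, 17344262118060, 14801971669822, 15715886018778, 17065276319259,
    14763182499820, 17064544643100, 13490591150062, 14523411555261, 13490595873982,
    17343793918539, 17343826985979, 17344176556059, 17064501596379]
  B := 136
  S := [
    8069, 8205, 8066, 8474, 8610, 8746, 8608, 1192759, 8879, 9287, 8181, 9556, 1433884, 8590,
    8998, 27583596606, 9271, 9407, 1397712, 9680, 10785, 1601577, 10090, 10226, 31024907971,
    217857355, 230713707, 1471821, 72878628676996875, 29289243835, 74611671660867527,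
    554995737215458, 561364011540136, 4170477095919, 78079705545261675, 78946622503382191,
    586868069070905, 593287233699610, 88438041436811794, 4826613781680, 91039170300977864,
    91906127971807056, 650235972480361, 91899666688792726, 5014435111248, 5061340782144,
    37065314494504335165751,
    151424153116450211367552968997554154089514599726378253109977334829639,
    23231011023585245384067211287085627478238324278719089306585803611451593,
    16328309082406593292803470940711608234913651064553373214600404682364483079381858348143,
    1195590732154231633790583151634204109279831363413630680543297011978,
    440218572879910891710049863829193524143240216269941563722982523013074651603,
    223385202885247340836775633939049310253, 5903320471121, 11674550610042,
    71741644725794033700354723580532877296796459384108521774349981, 6454513921019378600360478020,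
    88666930126990555798388718, 93702823089]

theorem certBlocks_refutes : certBlocks.Refutes 9 7 9 7 sideBlocks := by
  unfold Cert.Refutes; decide +kernel

/-- A refutation of `sideCubic`. -/
def certCubic : Cert where
  C := [
    730584, 549324, 557964, 540036, 736812, 505296, 365328, 788010, 402660, 1087201, 464688,
    826890, 730800, 785232, 777240, 836856, 556668, 450612, 494928, 782754, 499680, 494712,
    442836, 655494, 820188, 774828, 1061713, 781308, 822600, 541584, 533592, 773532, 836820,
    549360, 548676, 496836, 805968, 542664, 510264, 774648, 746100, 502020, 822564, 419508,
    779616, 357336, 610134, 780234, 761472, 746136, 410652, 732318, 741354, 730764, 830160,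
    418212, 804636, 836604, 738540, 829692, 655710, 512856, 820657, 497484, 1367137, 733578,
    655458, 834666, 837468, 738654, 409356, 610386, 785196, 744738, 807012, 550224, 826272,
    546768, 835308, 512604, 778974, 820620, 759312, 610350, 655530, 489744, 550656, 837900,
    709848, 834264, 441756, 822780, 534852, 400932, 817854, 655746, 464904, 774864, 807048,
    556452, 827964, 461016, 541332, 786750, 542880, 761436, 416916, 774978, 458640, 792792,
    781740, 532476, 402228, 542844, 484344, 487152, 826704, 715212, 681948, 777420, 807264,
    362736, 504612, 502668, 828042, 610170, 691962, 822816, 807228, 512388, 745920, 826782,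
    714996, 837936, 504864, 494892, 501372, 533808, 1570393, 829260, 512640, 489708, 1373617,
    825630, 792540, 736962, 458604, 542628, 489312, 836172, 828942, 821916, 822642, 826746,
    355608, 833406, 830592, 805752, 1654633, 532044, 792834, 354312, 713700, 541548, 777204,
    549972, 512820, 744804, 741996, 504828, 486936, 696636, 538776, 761652, 489276, 371592,
    830556, 830124, 759060, 1109233, 821304, 819114, 371160, 740094, 774612, 838116, 550188,
    494676, 835524, 792576, 683244, 489528, 489492, 550620, 356040, 838152, 457956, 610098,
    441540, 759096, 761868, 356256, 829374, 558000, 804204, 829296, 777456, 756504, 505260,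
    730548, 792756, 689292, 634896, 508716, 782322, 609918]
  D := []
  B := 1859
  S := [
    2755238, 2757097, 2758952, 2760811, 2762670, 2764529, 2766388, 2768247, 2762833, 2772863,
    2773823, 2775682, 2777540, 2779399, 2781254, 2783113, 2785995, 2786832, 2788691, 2790548,
    2792407, 2794264, 2796123, 2797982, 2799841, 2801699, 2803558, 2805417, 2807276, 2809135,
    2810994, 2812852, 2814711, 2816570, 2811167, 2820289, 2822148, 2824007, 2825866, 2827724,
    2830675, 2831443, 2826041, 2835162, 2829703, 2838880, 2841781, 2842596, 2844455, 2846314,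
    2848173, 2850031, 2851890, 2848554, 2855607, 2857464, 2852101, 2861183, 2863042, 2864901,
    2866760, 2868619, 2870475, 2873483, 2875191, 2876054, 2872782, 2879772, 2881631, 2883489,
    2885348, 2879955, 2892968, 2890924, 2892783, 2894642, 2896501, 2902208, 2901327, 2902077,
    2903936, 2905795, 2900399, 2907655, 2909514, 2913232, 2914126, 2916951, 5425196098, 2924598,
    2920668, 2924386, 5442495952, 2932088, 5445955552, 2926690, 5456326913, 5456328772,
    5459786512, 5466700133, 5470157873, 5470159732, 5473604459, 5480531093, 2947660, 5483990693,
    5490904314, 5490893160, 19047562602740525, 10220425927322, 5504735275, 5759, 2967370,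
    37637522391, 44065462910, 10265417567370, 10259929628990, 5528939457, 2973618, 20634,
    5539312678, 24352, 13788, 2978728, 31076, 2982390, 2993434, 35511, 19286553428305334,
    10349008928878, 3002959, 19262661640824651, 3004552, 37703221320, 10375563440721, 5587709892,
    3011934, 191908094858, 3004563, 38072515, 3021473, 3012224, 10432572155631, 10439839388175,
    236903678494, 114866141587, 249759559532, 3036632, 62240, 269043381091, 10484834971810,
    3034970, 10497690852849, 294755143168, 10504191368728, 10516974674406, 3049176,
    10523475190286, 198405190184, 333322786283, 10548275084977, 217689011741, 224116952260,
    3066350, 10574826139079, 3056820, 3064939, 3071663, 5701815324, 3062191, 10606969299418,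
    19740643297891865, 3067741, 10631838311730, 19776491922171906, 10645533484793, 10651961425312,
    449025715631, 455453656150, 10671245246869, 10671248704609, 10734633469767, 10684173703267,
    3103566, 494021299265, 500449239784, 3095926, 10721829478998, 10722672228763, 526161001861,
    19967684584998788, 3114354, 545444823419, 3106885, 10761239871879, 3123745, 3118712,
    10786948176217, 10792536824711, 3126429, 248994674, 10806304573135, 10819087878813, 3136686,
    179850, 500514938711, 10843960311686, 10844803098631, 648291871729, 189108, 3138435, 155466,
    545538156382, 551941918747, 10896223165046, 10896226622786, 3162861, 706143336404, 380314440,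
    3155295, 3159104, 20338120369225881, 3167098, 44145308328164018625661,
    843379432484533101453080333476267202, 5428238943505235121614913365165247424719485169,
    38097242794929774344, 357614321492057943543084920850313991649147278,
    8741206308648757329915161, 56221937724945206016822525310924565, 38167132315062952867,
    4422236667032640580237770179276843564734249584929056602460, 38211550372555449568,
    5197413054099427853085, 132208145901010098321579857, 847885099167321309342379930407458530,
    5578, 1312888566443328, 846835619125070100960214765720466320,
    18812604602664597113053462655266884968170160215531969,
    10125624759151543228194537437996637978847110977089, 456082166541815683475939274307664,
    38275147645530107360, 65165409956825120483710008227752521533030006389389277679362,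
    852822187938726094005619752791033902, 38341790109552812765, 887062538007,
    18890692161947415481443867819080430550313153359919619, 5049058,
    2708370557319519197429706197732917565334081474610252546142806324121914580917556, 12852430798,
    5904910814588911653805, 226380713382530221876204675420096736264446278921949283764115471224,
    20815556240981661916915374345, 248627703377471407606713645244, 38632043376670978816,
    121996830732004743588627184477225231715535301289982764743729242,
    460573704376645459327191546707948,
    785568827085708621097483490956952816429373886768981186367391449178332706,
    10255214111323710710230434377804763821644536890752,
    10279535330844890733457325909964988904725823605401, 6718368492,
    863178699856503493578649459865725908,
    788672532982487492921523392179256235137402477415216441857639228745857309,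
    862616588324621755506586059198983124, 134587178828091250949619721,
    35644232078787586607708664641696159136747028009190209855,
    66419064633887234943409958345722950554646699855627198923371,
    2976234208264643424145984836768235586398550, 38966690001665078001,
    465651168077944850723649304263983,
    1470344510311746379465833179974610317486544446786505001018694126305743733786,
    867055168979093773418117711849517865, 81373768430909223573965268307444390,
    5573546201521287658369884307459189531837513857, 869590366436948023089317819577690749,
    3437298363091475524053599285176640110144406171944752291, 6189034067257225602727,
    5596140026560618436799551179654744099536756960, 250758454298961597287773342759,
    72601373079178746998448, 19284889827934395444066822851506356590469794376418486,
    430357557413905657442798916624143159356850370560062834426468402480177,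
    10390696554856899558971720065793649303120761908365, 468039642366396772374143612037153,
    86408180, 7061820105512125774007,
    81289263497588095812690420760797378672409405276255454418338963417952657,
    73137559277486096035321,
    470006301289786951796162185723011807542122402558687891845955221108452807177139498,
    849696182752897326070496880, 40950834216088423218622898512742285035639489080,
    136659958540775573959098936, 873961900815135872228964394313007388, 7716371068173501338066,
    64509700004644573638467665794449314861689688316,
    419484437377468828920213495549659360306286012159407624264,
    1581874762196349677635148011769872979565245173801967863257441896,
    24959967964819650966632274684261949659260820543188290347804844615, 73591817641275467447889,
    4004846263994327014986871635631, 159415308768071614874430280471135438939,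
    14958890808466794342271302,
    808107061644565500238741123755010012584383274857810907505427114650211037,
    882835614546716102846051921412068642, 137267841994115623232781606,
    303406271162156259064273257964692307959121, 630247267760665286105718666541370265941397296,
    141097663224634944775116637221149551005822235782, 41051742430657096455671446529013406270482,
    5674946126610183924550990543318285157597806462,
    1019801498654407552091649731594972610891412245092026865517, 21475311684621599,
    155442397367003814861351051722759874030259649943837837360542508251937709419,
    24438254581318996417688940799811357363774919465193021953710669164,
    67852353677494075209764546435518229486851549437904801058898,
    354509763191494169544018655010041285378484, 21509753608197562, 2532612823893735351031693,
    205875923204271646446182880798570874793725011705, 138494716922074848740655440,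
    51207166119336974389283422547679, 441914479701267,
    1474119266384539316752958550648248099860607975518606909964,
    236454657657879273479416557145701935746228011735800984089214635342,
    890301801873455747306029057181863851,
    68459466120143999762976216590939762268355904141498081503609, 411563106470633999908,
    131040190689877, 127477196427291921114027759044515979572744466865206875928394759,
    819857080930543053848353782960255506795857727412998906759175517272336318,
    982777536281959015998542444033275779366918825694714222706116,
    525070697954063506136191252825788458625507234661939, 505699918727940665319592445429449,
    11930036252449984963026408032211905787087432600,
    300125540421383103941796179789147055404972212855, 1985315159637443687456290290899347,
    37069715562565802852395641742241215113967710435918974033,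
    49463558128017732580757123575668446183,
    68724505320347009998642668596936245580032785319672027591351,
    19973526183627997567580634444063043216760699982039740, 3297091490649183065306555663,
    825294223595591020487416084700058272182074838791067585652154160740363231,
    53162563613605625533251516551129491919,
    239070195203319247642774723765320425355379098791015126267963504651,
    128179140357679654000023904564343900274514905155969784454780913,
    1537576848490069977760063173680968021029632613613563109936315723436667504065,
    305863772206552836374718076327412737222639476551936353,
    128882409070532355162665396864095992312799799938616754028696337,
    69366734236092629115421407104955272574603236641524769464246,
    9904977146976331254786465536129285017153956978573337071771277654108433358982096805266,
    446131503782848943692316354005697673934574710247658923816938086852494,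
    1536739387284759517067113560188916886804876077199890408767621555641176685732, 23751385473430,
    35700926900125, 9887356678914503152563488450504345271558874,
    1460756623564058815777528266124861052722177905796, 908489405372937086294964173763344524,
    40763638266535000961, 6517929435, 7298322183, 15839534841130366078884088600855207443343417,
    3474824, 12880087250, 23892669212024, 23924784715989, 154034223286540821334578,
    82903062632963864207, 44416503341778703]

theorem certCubic_refutes : certCubic.Refutes 6 6 6 6 sideCubic := by
  unfold Cert.Refutes; decide +kernel

/-- A refutation of `sideEight 0 0 0`. -/
def certEight000 : Cert where
  C := [
    3046720, 3864770, 14606236, 4775616, 11694043, 9891587, 16204187, 4050752, 9665347, 13912987,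
    3339969, 4765953, 3635392, 6081920, 12479811, 4779265, 5894784, 3014402, 15883251, 12189523,
    3664130, 12574108, 3013889, 5175040, 3570432, 4734729, 8079683, 14544724, 4777792, 2718912,
    12176707, 11925908, 5143361, 5176641, 4778688, 9928451, 5976201, 6140168, 5258057, 10447619,
    16640363, 12053979, 14540715, 3899137, 16702884, 3339328, 16415556, 8027907, 4476232, 2455744,
    3668737, 11955971, 3363969, 3832578, 14141915, 5943433, 6213898, 3407169, 10443675, 8052483,
    3388480, 6144641, 12543828, 4774593, 3308352, 4745673, 11698075, 11763611, 5983050, 4483016,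
    12543844, 12569923, 4480264, 11757539, 3832640, 3355777, 3537665, 3275585, 5615752, 12479747,
    14669716, 10210115, 12446979, 15854067, 12180964, 3373248, 12569955, 16185756, 3897024,
    2456320, 3102977, 5471040, 5995201, 3604225, 5194121, 14319427, 3635969, 5176577, 5226633,
    4766529, 4765440, 8059203, 12222299, 16153395, 12307931, 5110592, 12042651, 5881602, 5429442,
    4781824, 6076736, 6019841, 16472555, 15859051, 12189027, 14570924, 3630784, 5297858, 3373888,
    5437770, 4732680, 4475592, 16185252, 4515584, 5766336, 11959555, 16472363, 5503810, 8092427,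
    5460104, 3832641, 11824419, 16219036, 10182620, 4777664, 5165632, 14577516, 4471048, 16641388,
    15752667, 9960860, 12320099, 14318403, 4738505, 16218028, 6152329, 12024067, 11959692,
    5111105, 5106944, 16149980, 14544643, 15853891, 5994689, 16481124, 14319467, 4779776,
    15952195, 14577411, 5209856, 8285443, 10408203, 8350531, 16383340, 12023715, 6275648,
    10214364, 6242440, 8091971, 16152491, 5469890, 12082459, 10411932, 3078402, 2710785, 16674140,
    8093443, 10411267, 2455808, 4746441, 12189459, 2440448, 15923523, 12177379, 5470402, 5165193,
    12578115, 3406529, 3897538, 11959700, 3077888, 12578147, 11925763, 12021732, 15923611,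
    10189571, 12540163, 15752091, 3799809, 3667008, 14318427, 16213988, 5373634, 5176649, 5110601,
    5161032, 16186788, 9698115, 3307202, 14056348, 12021731, 14606228, 14150107, 3864256, 5980297,
    3046145, 16205699, 8117507, 13883883, 10341699, 12019491, 6077184, 12438851, 15752683,
    5980800, 5437634, 12052955, 12444516, 16219035, 3898048, 6148233, 3046656, 4750025, 3632896,
    4519616, 2451136, 3663552, 3372736, 11947395, 3368641, 15854955, 15952707, 4737480, 4734216,
    5143369, 4766976, 15946139, 16701332, 11787739, 3603649, 13822275, 5994178, 12445955,
    13888323, 3784449, 6076288, 3079424, 12287844, 5728002, 8027395, 16153899, 12025764, 12447075,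
    5467842, 3930945, 12058020, 12479836, 16672580, 6082368, 5503170, 12578148, 14408667, 3303106,
    14211564, 8085251, 14401899, 12480347, 12534115, 12053988, 12187971, 6078208, 3831616,
    16670108, 4512512, 11958019, 15886315, 16480108, 4517184, 3406656, 8318219, 16218020, 5930242,
    10444700, 14666587, 11660771, 12319052, 11960067, 6275713, 5304002, 4476616, 14600011,
    5995337, 10091267, 12312027, 16641380, 12025603, 3373762, 14285123, 3799873, 16383339,
    3896384, 6085824, 16383331, 4504896, 14178603, 16641379, 5727938, 5681418, 14149891, 12025627,
    11790659, 12020187, 5502658, 12544259, 3884096, 11786715, 3897090, 14573355, 16641387,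
    12311003, 5914761, 2445120, 4766593, 15752155, 12568387, 13819867, 5176648, 16480604, 4517120,
    11816931, 16670123, 3898178, 12475804, 6078336, 12013539, 10409731, 11814883, 14403947,
    8284995, 12543747, 4738888, 16181219, 14274859, 4476744, 5306562, 12439371, 12539683,
    11794843, 12189028, 16448867, 5175554, 11556771, 11558299, 7534915, 12023555, 16382788,
    14674755, 16218027, 11816355, 3106561, 10181596, 10476956, 3405506, 5404554, 14544748,
    5484616, 15854563, 3405504, 15882227, 3833602, 16375268, 12447060, 16468331, 8093451, 5730050,
    5466306, 5504320, 16702883, 15851883, 3308225, 5994754, 5266120, 16186780, 14416707, 10476443,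
    16734620, 8116995, 12541723, 5896450, 12540316, 2710912, 12478211, 11787747, 3079553,
    16214492, 10411420, 11757891, 16734116, 8060675, 16472556, 9895171, 13884379, 5729986,
    11926787, 3108609, 9567555, 15891355, 10448716, 12306907, 5465794, 5897474, 9893635, 12019683,
    3800834, 5404354, 12545859, 10442499, 16702876, 9895324, 12541860, 8084227, 16640299, 3635904,
    8285451, 12538147, 8318211, 10472347, 12214235, 15752163, 8125268, 15951723, 16670124,
    16141723, 3831489, 16480619, 5498562, 6027522, 14179107, 16185267, 8285507]
  D := [
    702044376, 984979760, 631721624, 1069951704, 985241904, 570189080, 1060657816, 1024632416,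
    893216352, 980972401, 1058413736, 590589016, 760323744, 854635873, 887732832, 751286424,
    569996056, 652704408, 747609240, 1060485728, 702172824, 703915288, 1034300824, 968383640,
    734762784, 851429464, 834237208, 837925536, 598417176, 984473889, 833861784, 912053920,
    963529392, 701219744, 1062640792, 1045895832, 999660208, 1060723352, 1021224544, 632233624,
    570221848, 833506968, 758660769, 855464544, 854779992, 1008056928, 1008641632, 599203480,
    909924000, 831519384, 721245080, 876521056, 968506520, 893216416, 570210968, 1019587296,
    1004447328, 773157664, 833744544, 834031256, 703874720, 854964832, 1046928544, 1054186144,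
    567987864, 567721624, 900462680, 569457304, 854432040, 602372760, 846864360, 1070995112,
    582505689, 891078304, 846223464, 859414176, 887535768, 570221912, 854726376, 719738072,
    926440088, 714392792, 833474976, 720574176, 984815328, 1069967016, 1017587424, 934387360,
    970221720, 887986848, 893150880, 1053924000, 697008024, 695004832, 717743320, 598171288,
    874423904, 1060199064, 712572512, 829157736, 856860256, 1051053216, 857317024, 867278496,
    567014680, 847703768, 1058186848, 891080280, 997595824, 717636824, 982891120, 892880984,
    1042196064, 1043708512, 854648041, 911317664, 911055520, 912763872, 1036397272, 567205528,
    881310360, 981842736, 866883992, 570112664, 966228632, 739876512, 567270040, 768067232,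
    866787096, 983939376, 932552360, 837466520, 982577512, 759146209, 1053218464, 599235736,
    854649049, 1018009776, 757012632, 701741208, 887789280, 893364312, 767970968, 854759136,
    916868760, 1041593122, 567001816, 568242072, 854647137, 1046924448, 991077984, 967424368,
    601332376, 909395616, 924425888, 861840992, 1060656809, 891111512, 837466392, 874094240,
    1001592984, 622424856, 980850992, 968244376, 923934376, 744070816, 703281056, 967682352,
    837874024, 801517272, 862613096, 982358832, 598433368, 854652137, 833475488, 963332832,
    770402392, 924403880, 640920664, 1064967336, 890849368, 881241944, 895240280, 570178200,
    837466016, 908958368, 916848288, 888051864, 982348568, 1051924128, 570223768, 997857968,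
    981957336, 756862104, 720918744, 713516248, 1044141664, 969861272, 993961568, 1060652713,
    905029736, 569653912, 829447840, 833508248, 1034365336, 703280928, 570243736, 847708056,
    928620192, 1019930712, 850534104, 1012835936, 968304856, 855230568, 967683424, 923969120,
    847770520, 1052089504, 1051827360, 1070769760, 881254040, 982628976, 997476528, 854648025,
    1046273176, 564917016, 775040985, 721248985, 847626024, 926435496, 722575008, 1041701016,
    881825448, 1051597976, 904833112, 980998248, 569404568, 881192616, 1049303768, 855042136,
    718530648, 569391768, 831966872, 909989536, 914235048, 723099296, 909483680, 569207960,
    704329880, 718792792, 1036429720, 758750880, 720925912, 854652129, 720724697, 853953240,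
    907375393, 849720224, 565657240, 569948824, 802920600, 831442584, 854651297, 1067031720,
    714110168, 570254104, 987347552, 1053214368, 881176488, 900091544, 968308384, 999835312,
    850913368, 702006944, 703882912, 891267160, 1002379416, 860987040, 909220512, 602364568,
    1015913136, 987085408, 1071229032, 1032500848, 1047173424, 846780520, 569666712, 924407976,
    984836184, 1010658530, 756653728, 878618208, 701910680, 891077856, 751410912, 980441192,
    741973664, 854647009, 893218464, 849058520, 1025418848, 883277472, 570191000, 985098328,
    777400281, 714106072, 901752920, 970254488, 997738672, 1036397464, 567818904, 802823832,
    569437336, 966319256, 846747752, 703281432, 790208160, 565177496, 564948120, 718828760,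
    565661336, 633786008, 878288544, 970255000, 564980888, 986900568, 565923480, 833595296,
    1047960736, 876191392, 968242864, 632265880, 569699480, 603396760, 966442136, 1041409632,
    999922352, 720946392, 854648033, 725196448, 1013586800, 720595032, 567725720, 1048452264,
    997333680, 893143128, 758922913, 1010154080, 986571041, 846782056, 569686680, 889103968,
    714372312]
  B := 1535
  S := [
    1286646, 1288181, 1289709, 1291242, 1292777, 1294312, 1295845, 1297380, 1298915, 1300444,
    1301977, 1303512, 1305046, 1306580, 1308115, 1309644, 2011171104, 1312714, 1312714, 1315784,
    1317319, 1318854, 1318853, 2027675422, 1321922, 1324992, 1326525, 2037106459, 1329594,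
    1331129, 1331129, 2046537499, 1334198, 1335733, 1337267, 1340337, 1340337, 2060684057,
    1344942, 1344942, 1346477, 1349547, 2072472855, 2074830615, 2077188375, 1355685, 2081903894,
    1357219, 2086619414, 1361824, 1363359, 1364893, 2096050452, 2098408212, 2100765972,
    2103123732, 1371027, 1375631, 3239155720081, 1375631, 2114914060, 3250020279695, 1387909,
    2133766929, 1390979, 1387909, 2140840209, 3271728188294, 2138487054, 1390979, 1392514,
    3286211909509, 2147918094, 2145569544, 2147921164, 1400189, 1409399, 3307926889853, 1407863,
    3315165214588, 1410932, 2164427017, 1410932, 1420142, 2171500297, 2173858057, 1418607,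
    1421677, 2180931337, 2204499726, 2185645321, 1438561, 2202141966, 3398372971866,
    8015858919865764186, 3405611298136, 3409242236256, 2202149641, 1457402, 3387541408612,
    1460473, 2211582218, 5266501251560728, 1456983, 2239866127, 5233219408503047, 2244581647,
    1463122, 2249291027, 3456291357012, 1461587, 1469262, 2249297167, 2244586252, 3441835925847,
    3478006335822, 1485034, 1486568, 1466194, 2287030958, 1491173, 3499709535046, 2282301206,
    2277590291, 5388742091494166, 5394275806077211, 2284660501, 1501921, 5410931201900832,
    5416497467730717, 5405386643976477, 1511132, 3539513260858, 3510600025418, 3535901171003,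
    1517275, 5438729986875164, 3557616149814, 1518812, 1523417, 2317664541, 2320022301, 1524951,
    5477607044355362, 5499828698938657, 3554011133242, 1531090, 2320031513, 1537231, 2345953058,
    8493435739610163508, 1519928, 2336538903, 2334190353, 2336541973, 1544904, 1533744, 1551042,
    3633611506980, 2348330775, 3640849833250, 5594270760971045, 3604698276145, 5605403292626210,
    3622794081075, 1563318, 5622036980550441, 5627603253449001, 5633176743464736, 2404918959,
    5644291200527137, 3680667696412, 2393117472, 2414349999, 3658985712428, 1562913, 2402548513,
    5683179108418853, 1583267, 2416693539, 1583267, 5705397143843620, 1586332, 5716479042588971,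
    2421404456, 2430838566, 1595543, 2426124582, 2449716388, 2423776033, 8834504935223443213,
    1585943, 8825994027970926358, 5772065755045158, 8868648496641444108, 3767539378968,
    3771146774793, 2449702183, 3734985782043, 2463847208, 5810953662932268, 8902725447376055048,
    2478009505, 3785623427334, 1620101, 2456793885, 5844264454591790, 5833153623759665,
    3782018404620, 1630846, 9005056188437687041, 3839934447741, 2487430952, 3821826830602,
    3836291711227, 3839903805687, 3832679607557, 5888718628321067, 5910951119181602,
    9005089520937242882, 1641597, 9073276700578517753, 3821855128328, 3836305856253, 1653879,
    9056254907750758649, 5905413830215979, 2536956580, 9158585627085626100, 2513373990,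
    2546386085, 5983138989518136, 1660016, 2536934706, 1663082, 5988716112837427, 2551085872,
    2546371887, 3912291774702, 3883373837557, 2553439027, 1676895, 1675358, 2558159154,
    2562876209, 2588818083, 9312048433339922660, 6055370247386425, 1693779, 3952112000231,
    9346192005608335076, 1689175, 6099802713207102, 2593539742, 1678058, 2598255263, 2614759583,
    1701451, 2605328541, 1707591, 2607670588, 4006392378588, 6155356846147893, 3981072377063,
    6166467698172228, 9474105445536105188, 6177607442245933, 2626548382, 14582021284908018999114,
    14595034395526105628499, 9440022986449329384, 2635988634, 6210929084298555, 4038962493650,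
    14660560137029453913925, 14673649945712742927685, 2657197731, 4064294270161,
    14712919371762609964361, 9593491311927403746, 9576419520367994081, 9610496449380571351,
    2661914783, 14778368415179055037767, 9636079169890973897, 14804548032545633060682, 2680775330,
    14791432657840616992078, 14804496900502164813643, 9653167584309102298,
    14752188831134126149963, 2683134625, 14896176659996177825609, 14909266501990244343119,
    2690207907, 14935446102712284039495, 14948459229974909000025, 9721371462759661765, 2701995173,
    2701996708, 9695822096407216842, 4151161244872, 6355373516000582, 6366469891386192,
    2732642980, 14948535978060550949703, 6399824070559048, 15092523823567140947283,
    15027049247461440100173, 15000895212793692858183, 4183731372213, 6405383119277898,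
    6416472249282378, 6416472235135818, 2746792609, 2739720863, 2742078623,
    15144883074966550321491, 15236511719072469691731, 9908994496671122616, 6477592659818826,
    1714599220262838001302179005119457531896590632023565531087,
    474871996175253529382843112139553726660943547004, 54823807789348935848608584040706,
    129399603293584042379042054985341413575,
    182361644197194491907665554740064576080738639971105450305839030689365609330757805369090138259746884403690752344320537719044455900181131726743770,
    54823807950301095477111062154075,
    1637229986946443926451519622663320300396316877272112491111269444699665668400633579061296762596191908845774300,
    131630558800470759505705985996942801727,
    13976006398411598428723887365918390533920990856249375920149865768255782883883105304892430146849248111339410350173716213019655,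
    56007174111769484862948237960010, 306473332168518186223060849658490924470165228,
    1072016948093704471470283101135422710634609383259454614518915042530044693479856784236351483593469031139722,
    23408295414348218820162419,
    1564625147854152851927665340981157811511474264447160376000093296984497264531372908501072334765834293872859273382300343459328153242306089787033926580266009182214,
    281348472716345328398532950793920549915352012258503578984112753196983640981898374283820050212530639083270319941649451273952310964231093076721544838,
    50805121493468648475945987137667408433898837954479253852857448988107488652701966536075852686379216563152850567756450799228376605329053,
    471645371194035892254531575802066155346262635866,
    125899857952627700204669962947970153760777889887249338339752483467367903400365308546514064,
    36517159027493229292171023480,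
    194232641816967759651778884842314522313399852370832752015636660476740219628624365120848129492,
    36425053334940374518755464723,
    434419360059877397662761481238521039625217065470624006729348727424660908482691696058660439914295379912761388856422008854471620561284617931108420902993,
    1078340054120364822188592686553099765591731531697677395583762424128623337510243866745984541144922555664979,
    736359036019493520871416639338265895575145007364282,
    480118022509983835837365580558970461405938155644,
    312778077021409020023821532514577760737970010, 10198959231514715114,
    82572041265524492353462770728592202049673501701275982632624686957742751215857644246917,
    311990754289285551618396819364010431382665847,
    35307823536138947787958259547692852961662017745067941156555116701777726072091605,
    22963662089645229692693195467912053946988888913929040820583064905913374418406,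
    9656892296168991532589158317307650810779967709230355648706340985949273,
    706032207412701410280015791208382257475816119760100162435808924401552016470950752203006302244055425464,
    14200466970701691631417661365047254345153813053352113354682007858869623546795084728823089666348748823501419991664741595584857,
    6026859178785536327983541176958598469975422294793768442995637522954910567212839337396705067273461726933672086467231158,
    4098472756071563214934889100697811251245806843055537129362009200,
    15022234737229890746000315500912632407053138030711333233195320967024954807,
    15071896169457810471867818553033334279663108073775502525420232039858224281,
    132771363546068874618871549703491835274,
    15059452518557585166159679320343038754408721933974271375659692223542784840,
    440974356848709693970416156454580561857598679873075370749715669163651395851123407527272419689286215628495961213831411149723851327934250352039480328629,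
    302391754770588376943805112138361053198645457740078264578056078258985017726762181083850516730645,
    14354150576667266374229085085915255317959010458045596754141044764960523675246143099878269799861208096944174702741578116422377,
    22088013222322578384356589060125750474046569555010844965212398344562294062787731134261516721164072905821553546286146489739559360,
    24051057226425337871657409,
    6046925003458569476444708209442963565868251500821731914436576461038210303398219803629271899870502436803997526000706072,
    716622294707932010382769461395825651795138270691740997794665773710003239155673164641849107055994021218,
    9875587265050302102223106107486879611515773145546956903042308943436890,
    4194713459255157846380820749259185099559057900982245818761844436,
    35776679603494782129385319760762971031349239090341404517473255457534925305248633,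
    84366856961981733358022141258175531373250642691693826540926604180254020743170294606398,
    127914100250028277208228826308463238523520888651520156894186562753298480749956080239132275,
    2741642881088154425521764487028180796115470518741201239137643,
    305887937991244419343288888288823067026207665992757443697794827370270978081924229255861260496805,
    710154554854732846623153706335279285475156806252207804710091580376335881176672199407232392524988030177,
    57332909573005045069937223405189,
    35981462883415439872795349056358931632439782926838223377351643132535851060103495,
    121823366113084104743201770250486422745921853317576648269197586680294366563050572123014358580335763747652708987179826586380840667299852511431,
    9980894709617977318042139420477748650075179298879701449012061315396263,
    3975287274822148044627233213955648783500562216536518554137104204486458958048258999623813557645016102065927145653740,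
    24814690229564174712399931,
    9835122653243427065464885191177403052764491266628195398949735768926290,
    1118076094569533058121355894269672680529557985064559378154312028226345763817855958466561009830937899037439,
    6496940662056382260712597005646608903207335300775224817118415477309,
    491013807479653690046138632827028497961126702895,
    35981672958174254823576001772510986660552019611672505217342106209130877454597251,
    1060484702284354262187548013150955608026364661444757155819572680087094091767337677774294145199931350314256285015341995331854633727757743974629008693502428734,
    6212347917005029480973603309335295206375947793942165822440527541565099713196194570182457627870110729057858278024180939,
    130668313954298242900086713467354501061721701181179201158513814068380161971544495019916977,
    9908045600056908673959700288549543714578866685745023686153594182384400,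
    6460034041857675998048867958756767296170908876963260935345143328128,
    15358004479686723904896292127589996150329448979286030210299842479630184017,
    766083135879911640604557864176380199159649406677534,
    9451287620139124917601059132727757031261417502310835270642555055801394047155124043555917808591990605623063579768347893830,
    2759597307013634145708660931545626319628209868355504122764204,
    23631715977898340138561898500266103434569225555084107951510141814854197964426,
    212498361926910347707749823856726859073523,
    23631852656293877335351582296869221091184241643611001206400550724836829907222,
    4235984107655923471651579736566850453570037437732516222429806189,
    15457416559492084544332934338520813875351263825549132947160735301812189291,
    1815285533290691663992267864285924115593639176883029832204,
    200739913774795049494768118295773125828830440022237771400701949446615708087828118658867585192,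
    6618312219822018833030283116690280257588881804094117256159559867515,
    329338728036970757569627754590837866137916795, 10548617170715995692,
    85540941856605863153206468860784827938729813448983511018481169484713960587585743922545,
    326448168412733449970561455324584055044342920,
    36860782603496231151822559979767635316187204437049807416414126312123106257279571,
    4534785469964, 2829020452292653906590356335678561296274875242588722150993025,
    780953050511991864316882063251619768265203717465724, 38399015739403513172714237034,
    56536031093888721692968483372279542123443093196547033461980317938530965887260376252,
    133317517701115442536627148271546955467165523829470269612374720039389185857673865989813954,
    90622111890130130027690058349703608,
    24051716494802022713618698684702743848254235060592188857376312020509697183189,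
    4118972893614318498679702087652622364844094595003677804795143581363364574006969076613688033718100883431848465355190,
    126757015027804199472443791624683380957581427953428582390088534703799795270039226302815108766378360955274335633838026780941528566535447425629,
    35074533276506203526771302957202438556243667268611914270343697048869668930986201694361883940979935888181005679640309009780986222976,
    15718588833060886775953578163317701617081255156861916193750122008142566352,
    24070854862471364343366224990106994406667811475586776927809851183642580660330,
    2694019568891534577563835536952131326930305699267098235527239505500236148538060758032347002298527382243363031565,
    206431800959399350080888110637293037070080753243321174592821244913577676732452954772470739328,
    25417502516758660225916210,
    6302629422607070084514277912070541473751789925383173633181989426921191353186590275834109099276533604195592979036959399,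
    335646895065565701924787360240024382292097181,
    14956640035220015102275287465312574949516475953574907650279957221188667084500398309896744594391859262536969275329647588859702,
    2711051738487463898570852837444054238050726795014096903775825209749842754840468144183049829115719319556235502132,
    25799161957635859857909790, 4352883649891463023640363957210991986368880362559894063255355584,
    6402860486424974780984915456497646060856245666658277098671431718317797953381376742313055147917701574802214492506955792,
    10353500141724250133852109320256437883338659675977033640576780128073643,
    39663479254999424469958637439,
    9759212640493321966501413065278930382728813734218417593062443064112782748204168218818365999345379336108798653711518993083,
    37183133099583334517362561703236679834481039888075124531396175753508767288493978,
    4164718119566854576152231641672190379564065104107326968874429128223063747600210139227408750983960525610180816331275,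
    1762005788859567737427914143518589099823539970019565679080166646642314738188531842379474096139931628503640468,
    220374786227756051991919409129602399982798,
    2713183879334453717047321125337672139458690414187892165494137643040294677037870479302751267906266821341394251526,
    522076800240168165127303870530027454280194907595,
    2713175569615647021392500670393827372666184485036040121756659845447576755956009369725164027627021215293446170180,
    35547485708920765810831228189793873362511819640186641551196185955126892721080133432911388048829482830437164540793667901720268302929,
    210987727576821301862081000871166225238030917926670731472777672505295965854785212135136766494,
    6781933463553640701514925430020555412767983342916901071065495499170,
    335647580326234894653117252568580697236260720,
    6468029490116047577613351620602369401424752217621874908494220666117916470602925701813095101354505410356654038994024409,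
    1894086171087932021003655802835584235980363685615973507853,
    6876929899307729119935281260506770257765228394180552538793704819628,
    6760856731979327880082719493467059141928082931966714616727689457847,
    138299099608614484008753602818133480209936652298096379714591059023283816136733558147257498,
    491770911991793172699665368537419924853500315504703226301064903305383575501739763162169688494339154,
    322119532959526667900288563332122157532359811756335526911112719987868355066032532733076485562542,
    24758096941737448172833059374107655061143366696251503701220577004119055078415, 46367769106,
    16079286616281215257384571471405092436569712148907531704901715707157724255,
    803247433829411670715636371999152633907434229179306,
    523691690371566553320024004837449109826125682079, 17003687017731587772280,
    94037788201145311934149815638886653,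
    24719944368236363995449090178868544225827322732837943982226423846407697216829, 1984267,
    24948735023805155994431362375224057430587272655006721852078600189027047574558,
    89407093256259951829246401684944137448849017906254095959466549064077985671418370318062,
    1234887954509325962393049671769934425367112768334844484,
    38091524894684286134450456268072734210638567031381835567784693142598408411567348,
    16141480925341902487098021495956685007254466001897329418133294703541503901,
    4246419843571323580112764613984863375565473798574856371467490530058533915767524161065046317021217008025843010869112,
    24815387761429466962435194036854582665234786449676626770262268585187295085599,
    4528227378016400594869200797453752942276832540989311763857458019,
    2916389276638107918796526617020055436501966157580148413407317,
    95926887910328768465960969586910983, 61735928128326104936557645020073,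
    535044294188168833857998475107521576640854558057,
    526920946496067692117465717241770340141817422954,
    1811913760422183540498130258409474757491600408228591973048636736313991966291789334401502977286248640813502418,
    817489164350610933948002602837026981866619891922651,
    4541953654790331312652629697124818981349124092496823336808234366,
    6977200700013293932952839066326426445017383009302136983157880447301,
    6966672655789134671698425750112968688258678367236372288539032924683,
    16464661186748855057395167941695444805116368568642219184476887753121266047,
    16477096804842385852941206194205811124578095099994355844355117542096625558,
    16489605356486389811457625569773949302864612721140953030510288077437575694,
    4347650067363920529111581455238879946963230436666115195198558501096713815872397834798958589231446029468510920794279,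
    4350916523768175134229738581396854625668430409385221007103293067989929867081302954180624964219093426144830836816915,
    7014148568480082419164517182555043041068647422465900007812075456977,
    38970405488324260779656014588959010619990485935635586495905932622822063588823783,
    91685323629080231215031714571192423459910772650955537992042409662106300786227637278488,
    16576597952340023713812551858412981009863953236347735561526542077990215361,
    4562621456459079914735438865634380427125436738291757366279640064,
    216681099466515538173851127681821918831797349449285432769424722275078810944685140407978324337,
    91754453601406687484933935435804846551959936878670752924107276133358570569392404430694,
    2965680797154884655281735086185022672976750901893156643340335,
    10807256546369504842598454510939986235500512790047399726291822984846492,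
    10742477174110555251966843145278573710689543398005311556041548401820561,
    140948924805517860617742866928411601085523749212744672687786540143895546392897922337712643,
    16626372772212525471767892615297709453462419097844828171875907236783922811,
    4610719412449804976911108303101914841683509170296895035970327535,
    10871999043022267169775840514056933571916161547743106369541143776517422,
    826163551947469501238867864511753813730912685248392,
    92168379278642292138479860450276290579867179139890487396038553457675426161332957225561,
    2838745904908584072302418397163105068444353320954766122457621494431962436181203549783617047352940599080461265271,
    88480667106836657811068840675164349898500401878717157997773163399273297417906194485444770057962506809496651134060497939229409068632308153,
    1852118474804710235768381366049471165779531870697099145387351589832725248525776787210605351859160085284634359,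
    10398006806945666192457749817331235003199423315270990762446330627768000728851711456292188090424413374712306660523385942735,
    10904478365360500795591888287249253306035340672328913099849214928710040,
    7088064836862707125579385041366139775252293466745469822493580928301,
    3001515260289907221197083506888019707623222781893418883336272,
    92858689181082555061029688025887270684311031232683217226176048937150067043869394707570,
    515918313800236310986470778413898677553207523852845199363217259403712968994584598397090854556546304,
    792518757706290778665568506097693501403630175830447894061701692831154660966583345214691964071386713724,
    1286220154997930779804630055791157914729362601479196915,
    1218323145203039153469080593209380536607435627658781054105372779414497058884436308023013113281432987221397,
    546688639426330652257080654762803435909510810935,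
    25884166990894042737719418393198575510419034191193625479523331278621888133421,
    27245952383107636570201570,
    221235224554339876789766591309288059659956876028193318524960442409335865758369960238673210560,
    2913211407240778651785758620220124994768924334080845645231718721316942023593097646877174400729429053846241950025,
    19229486997272401734862281532099683117563157617823295731847634457458657393293281461312166518035572631091540,
    4478310282472441047044671003139927776026026117268430091818165943623367151773940563631324238533418356299524310736740,
    94308979153347691533708488814072427297345734204717518000743750770272470712841464824034,
    235614275402764884523261948577760214372267, 41760972553339356714709708409,
    26285067928516610880458702325605586308170778342257902971643203600645196484476,
    340597164142758446831837409245547809162123315104836325324084392566918684802001157062280614688368,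
    7588708303222602, 439608100670472263248007,
    11009843831074267277094961062315863496220783483306408805074679910161104,
    3086617888576087930678866615644752677726394621130674404537340,
    59051864201810212508800132932671092606032934309846128476729024047111626666315897794778159503975625411611462813690716939512800150617207,
    2906829020184662203319585244673726338545654805697699050293591637197246357920030331328809566933872782730571464418,
    1900622982955830663837357618106648258715989059828457462725166653874589944287539325860425268402046090166871273,
    850311080530697583068182842628376543030891733100253,
    236470766739389280004217339609491244938157,
    61753592718103208605564594321228216315803331164070138969190118604651076960091230595,
    526649107540721614169206859014360507071783725173905513049305598037182390047968179319744426815939721,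
    1311878832182879600807901383100110109675625392401915906,
    237840396681874241469173977199094081861996,
    1249930996022186554106544823992275491103875027284635878936573120584867360411148981809875203971971076697003,
    40259845476319257921728975424886384587895344296572993996568556048448894818266334,
    147413072821583591274256509936348635475099182317646920027315448532217181050066082779284591,
    59350775150681506135131834753074209437945530329477158833917056001219085994701417762894013711099318950040673488471390996642994428613105,
    80615160333659312064719798909393213723426550723351264152235586043256363587442783324779637958137134989734411883,
    4741412417597011783893963186407998788009254300890670810294523508,
    7262255381756073700936054971651094075538044620690151590293666948264,
    27668032991240506503036483, 151566259486,
    7024610094401048088521660495965951224366646121951099618580668162691563129636247260080636426691687999476446173683204097,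
    96794060009670288327184182552809500058527367236482127578985082033523042199968950092722,
    7716490073182622, 68192134692655441, 1318538282193221215153972965818825285497745815546145163,
    25152832933218663405939266002629188441242217707825354271215804220228772768031477588514579180508893660769705120482187417906236720,
    1336599860986253746650528081258510680011747917462927772,
    952033727800474016841369405059608165778162879341199915015819062084740717713,
    155837513260801320174128340550294146746, 564844333126502763761971488698592383208726147727,
    59992161004427582916608695406852963386097992074350110988165499417607974886795514376773766920467711699990153763165651971271264271855734,
    11350027886312450814773797950584701191782618263852243371712779978016263,
    824881211585820016433848426544556510860347030947479269387408262721400106456810340597847023261788478228,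
    96173059549170069577905767418015760393334218184521104749585065672820546471607897322793,
    3151564104112253229751411017679472267992743617257721045445313,
    141153145334070524487527452616430720049620723808669802195073822792929257921868458326535410985219993008249987835956890925926555731042041173373,
    784216461469060987577467734240266487688803975870284537608213237880024038992184645693075129036451715437507345710027668830219210446032696252577316895930662,
    1938063220634191782089397886934912715497078171780323343553892559976769504532694599953975562497612954179065940,
    7489141140445970167391331731265415583707993268470699484678854962317,
    1946374751002187860369928201030895106888768727147540036429040461370000943591620615410072752631474635095367178,
    4615471493479327129123900988096160574372611320547719464991487917466318515928969825032349980908841894882680393648428,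
    39082823075934642769394300658808488375726555846417742255079972907493403456194486828364587331027683047686836323325068096634585520393,
    7069788761201569350807873567109762645379544313524034949275848301705163685865083422807035241219545681146508658042050186,
    1279845476430654902437545991575459243991170993813119162408262621740713750328511528860606544128952872349999,
    1968558371790344836725244878372709552171954072160750357414579885185964667618948143860227667300855596072417349,
    837234849535607266817151294380305471372658754451357823646248497506379317585171565593941014304321400745,
    25551890393951958856153842021918216289390067866253545644206124962184527018020005385227140179105770197536356444046925878670752295,
    229045474410186575380845849321411676525853057904183111021702632046141932821896840001120571313,
    10990566853692548815145899062409665036870587827140246675348143412037482944255341023789131754992227557761130419334341746346,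
    2880827617267889870832191666734504754923149081203699777417463175023009826188827752055907466252721484059436634862643906211863263647287963077451213834118059004409713,
    98105685681827041354391328076460854995012706069394945026429712869661663653582161859329,
    7089844407989401609876501462685030739290468181425335968180123195693453395089129538769152385783116050048836586204031087,
    231484415980883572742885762577570440829587315452349135769047702965846789080956968856263783490,
    25751137031443292372542949896532128395694365065922898463996428523441668988449493372415308429352037619294703750525659513413574712,
    10967447277130909367329494510814889386952581051677908481483763508806618772849847661818131111086694211804411172542632412164,
    98174546084093627285329338316096143419216129082774695185657562400914499465392146881978,
    7134976959551559557111026133909026652726293776997017886039995280816798388636441809555852083933002577554903547125016490,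
    2925, 2927,
    144977871892596204564077184041080438742718376371078786795680270357780467251852624065223299429248693653752724673922812566572006597152307019043,
    4920192196584365707729456308627697239188333024600234405527989288,
    11617358262005475151332254598143298038182184890189119830314532895628967,
    41666375240012005574662839485423818325575468011193847968351952417439197357901260,
    1840168539706866096040167739200861275079339115165224598297633207662515585516073575,
    576545720710334712270835018806639884472730881217,
    1226932018130674782733843750054726759634205958420357562937056231777732060669004148280500910887239093964494787080786649486211587595505662571016327347701580516,
    375725744068025962122983580131, 244176755481909565393792468189408740915536,
    11706520280747497971757823750255890731518571012592064205381213100602657,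
    576143051763448650600264004303268861040832777008,
    40140364967172312788122577417431122100433321694896482228130267417367192736857551449506781759446878814637536236261241188777968490604,
    9948390510206396691645668085803597010711741115175563822302213180499687325454932536880684,
    64856902990517903158725567443058582388286007898565168563316908121469044634455659445,
    7250589561884955915726900427200812260408061879132206786238351144273657731547239626674942926807164923401168067306131575,
    361572011246269278887451078692538154281203716885002138335395726640858998398094660605794144225172,
    29094403536756467712893272, 18967107210476056566720, 8060911389248881,
    18993261211843905004990, 12356383452896160065, 133329741228906, 18914824673829839094694,
    29234937469813987125236018, 93871894856, 8094193672921386, 12433164816757273400,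
    18980299333266721649047, 70786349, 19124184898009304717234, 8127576374213961, 123044529920,
    194432383623009, 19019543193313405144336, 12501385318038258451, 5327408291083,
    8166464279750957, 8166464289183531, 12509945489820357801, 3470627101, 8183134152228634,
    12569627860154793666, 12535539288617429648, 12475885270469837467, 12484412833129965199,
    19333638876117127747977, 272215112426222, 8216423198245434, 12620726079254458983,
    5316574205053, 12671985872162217861, 195432449700, 300115401367735, 311099408232663,
    311103022680275, 206056529357, 516165055888017, 5341908652424, 343504707397, 223933148,
    8294242460651935, 5356380293185, 5410651255839, 5407025295721, 8316460729395845, 346285756,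
    5417854510420, 3520143840, 3546079200, 247512224, 8349793221878353, 264196550699,
    5407050937825, 179189342, 278753313329, 3555513259, 5435994816459, 3572009888, 289530747162,
    455540524874828, 444440469124082, 191034860, 5667986100469044685784733973742699,
    75095161785650168255696373515691734142617485460868237,
    21025683197909883608158905183829388138652611, 21288523500064811245980149582132956330736640,
    143736172945552653812072886922845, 2830895500211548549036605236207389711985912447603795,
    49467189179648315254611410670658891547999326563804811337513916052262431,
    17115327161661030986691593126530262338838410756560513812940297,
    13390020927776914348410850661204967534796196525370194789441, 1623, 4714064]

theorem certEight000_refutes : certEight000.Refutes 8 8 8 5 (sideEight 0 0 0) := by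
  unfold Cert.Refutes; decide +kernel

/-- A refutation of `sideEight 1 1 1`. -/
def certEight111 : Cert where
  C := [
    10222940, 8340608, 8008840, 8373312, 3308864, 16185251, 8270400, 7517312, 16149491, 3308354,
    5386376, 12471707, 7484488, 8368200, 5128328, 7086672, 12570019, 12189028, 10411291, 7348816,
    4774592, 5914761, 7238792, 8302672, 8025160, 16702884, 16636836, 8012936, 16702755, 14154660,
    9895324, 7816256, 8026896, 7938624, 8381056, 5405376, 3635906, 13892451, 8045640, 14273003,
    16674124, 14604700, 3078400, 16734124, 16218540, 13953516, 16738668, 8200768, 7148160,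
    8376392, 15924579, 7831232, 7337032, 8114752, 8307264, 8274512, 5700801, 16152491, 16219044,
    8008336, 12544259, 7815744, 16214508, 14670251, 5685889, 3341504, 12540187, 12189540,
    14352163, 5471938, 16637348, 7492160, 14670235, 7581840, 12479771, 16154012, 16120756,
    5652616, 7815872, 12543779, 15891779, 16148467, 8339592, 16701747, 6176904, 3668224, 7582792,
    12058020, 5668032, 16730971, 8275072, 5484680, 7524928, 7606928, 15916515, 8274056, 14056195,
    12479747, 4779840, 12056484, 5685384, 10415387, 8311360, 7830208, 7829776, 8016960, 7848512,
    2719425, 7906368, 5405890, 8369224, 16153499, 14670236, 11786651, 16669595, 16734467,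
    16116531, 3602689, 8048336, 12471643, 7639184, 12222300, 16120244, 3635458, 8269904, 3931330,
    3602690, 7291472, 7610960, 7782536, 7671944, 7830288, 11697475, 5919296, 7582784, 6214208,
    16739163, 8275080, 9662299, 14150124, 12479835, 8011912, 14307307, 14019052, 15923107,
    5685824, 14670755, 15956899, 14019556, 16735011, 4472776, 8335952, 5427776, 8283208, 15891267,
    3636930, 16734116, 3866306, 13791067, 10157916, 12574116, 14674179, 14606243, 7843912,
    3341506, 7858440, 8307344, 9927580, 14306267, 16120236, 13794115, 8335440, 8012992, 7592640,
    5226633, 9895836, 14408676, 5406402, 15916451, 12535651, 14543716, 7118928, 8306824, 16674116,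
    16116011, 10157404]
  D := [
    848385640, 1012455081, 829183264, 970478880, 904832608, 993025193, 985190625, 997252256,
    1060715184, 848404200, 982835505, 963848928, 937806496, 728968800, 967431600, 837477216,
    893206938, 804891744, 985191729, 921287264, 938649184, 848412264, 1029207721, 1064446576,
    909984089, 846290921, 982855977, 963983536, 768059104, 833482400, 850743001, 1029195945,
    997485728, 846782056, 703917216, 966110192, 1028762728, 1025068258, 1026635433, 744026457,
    1029206824, 1008048304, 861285992, 718380768, 717606880, 1068123760, 770550880, 982807464,
    911060969, 895458016, 892960480, 966126760, 787687008, 845574120, 702002848, 582280473,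
    859660584, 983949808, 982541800, 848533224, 837440744, 968210608, 892171937, 987068192,
    967600304, 999660208, 967862448, 997403232, 701361824, 985186649, 846287785, 1025420384,
    909236897, 719798624, 854759136, 963930288, 862641760, 829402080, 1064884897, 983101745,
    965594280, 982856625, 1062050464, 850154784, 964442288, 980247400, 985190617, 983070064,
    1062519202, 986105760, 963963056, 996842848, 1029206827, 986469664, 1042197600, 982839720,
    964180144, 720401817, 891086058, 1062519194, 1003132768, 1029206761, 963438768, 985190641,
    719798688, 964487344, 969524576, 1010149480, 846186600, 965852328, 963918000, 968308384,
    997805216, 981092976, 965864112, 965400496, 967850160, 997661344, 850739929, 1008052328,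
    997923488, 703907488, 848320104, 1060456113, 837415328, 1000729760, 983947568, 968157360,
    1026647721, 1001494704, 847043360, 1060654233, 853924640, 1027163817, 1068604576, 1029207776,
    703354144, 996591792, 760327264, 1043678897, 804105312, 993347249, 846191200, 582272409,
    985190705, 600490841, 1008300784, 1064740976, 968124592, 965342576, 855399200, 1025078000,
    847630056, 1060462882, 997518496, 968112304, 967690416, 963816672, 854702184, 1062519217,
    907073001, 963950768, 740159136, 985190689, 1030364456, 909984090, 582272217, 900183712,
    965342064, 834006688, 993545369, 711982176, 703915680, 970372768, 997739680, 966059696,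
    831291048, 831276520, 995642521, 829684384, 963406000, 965399472, 850739673, 967698608,
    1062516848, 983950320, 720401305, 847630632, 1068346464, 1070916826, 985187673, 963586848]
  B := 772
  S := [
    329244, 315927, 327699, 328471, 332329, 330013, 330785, 319016, 332327, 322102, 333872,
    334644, 335416, 339276, 324420, 326736, 325964, 339276, 327509, 329823, 330593, 345452,
    332138, 331366, 266156633, 345453, 335226, 335998, 335226, 348543, 338313, 261974516, 338312,
    340626, 272124189, 353169, 357029, 265555048, 358571, 359343, 267345318, 345257, 347573,
    362433, 269732341, 349889, 350661, 351433, 352205, 351433, 352205, 354520, 366299, 354520,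
    281063756, 357608, 372477, 285849583, 366874, 284047538, 366874, 284049082, 363014, 285242594,
    221589605098, 372278, 282867922, 218836750370, 366102, 170714281918106, 289419886, 296587338,
    225275169383, 222975274847, 226196571455, 226657258594, 294193934, 223441926458, 225278756866,
    374594, 387925, 297772154, 297774470, 227582238885, 378453, 299563193, 228964328097, 393331,
    232646321110, 176765526218622, 230811883902, 297787594, 231728506522, 181381248274382, 398740,
    401827, 236331890028, 180672697196540, 181028353633864, 402598, 313893270, 140577592066103862,
    236335470566, 241867403528, 185293480355379, 407232, 408002, 408773, 318667316, 402395,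
    184234336336491, 414948, 320459128, 188494398977325, 244630385149, 242328691081, 247856456779,
    319257698, 322251716, 190629726807551, 190984002347631, 188144266126663, 189564136027415,
    423447, 323437308, 147167216535820564, 193119330182488, 325225260, 193830640065636, 330603986,
    327017845, 194896236218893, 431940, 328209042, 425562, 258450087825, 194543342772659,
    152110139758977975, 432713, 252927093088, 337765062, 153208410503931145, 196321633280669,
    436576, 154030340338602630, 438121, 258910780171, 341346374, 198455575450412, 260291079116,
    334777996, 119124213761531839792, 154580539923357624, 264902224515, 445075,
    119972078775257179902, 344928460, 451252, 204500368805448, 208059250925156, 349701736,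
    208770566174476, 341939075, 204149779435675, 345514979, 206988591886075, 158424487530693719,
    455116, 352084901, 159248190589408597, 161168030445540729, 211972405592468, 356861260,
    161170167148306043, 348503395, 276414864426, 214105430544374, 359243654, 454146, 358651530,
    125271236185245226999, 212681878047487, 360441799, 213034773883064, 126754175194409554256,
    359837132, 281486095369, 215527137855889, 166111314392195297, 364619091, 471323,
    217662925800619, 127814830164967781172, 167484154201890804, 218012602117316,
    129722524316385989604, 286549588559, 168583489157339061, 368802560, 130568740862545804610,
    219436612320462, 129722526448951436306, 130570390398459131834, 219439375305374,
    221569178363918, 131841365283648767486, 130782358783420244102, 374173372,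
    131206290225381386043, 290700029637, 376554991, 224060158459581, 132054154174894447745,
    221928980468265, 132478088816386749293, 225484169254849, 132903666597492444689,
    135446711087101524286, 134596102881061436010, 380124530, 228332653944448, 227615354404923,
    135443968960372194715, 22516246520316531620054137054607773044851,
    17329160761944874786162333445580561613548607, 22031365391688622469724652509680146933866,
    3674151750256812623620162389704907392421172023435385999076306,
    271585232721414804664845339986005597009821888270040009658185670221155256458810261327518367,
    7242334452233330381778053811159190797132105458106940004922538349906505579043626092223710507585657953313206031109575142972592768843,
    62416131034263144081841453335,
    9587188890007710040852138229224872676901518285791931430147697804552973818172437680638517112993865371495213476310763664581804977,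
    126521074121484411702918776710101176090711529791704224069770588647430314718034908063204832221758015,
    27156714429252247624144900846745840088999756462459825607590948562377125555553968286424019258663722886329148888710610,
    3725036706749203060105676303286620310445393117478078679809722,
    99337858921215446584350997709051828806326823091903158190587021037155381196724609804059853229154289359,
    5775181339510790938279266452494479202412235555032209931044351876464404252116571769387716604800850682174693687698182442511771816639752,
    10503305352434908572170646221011990467470636727506,
    472119773310808237593253330809507124810649238542570481353703272420849842576847700594,
    27239958185230728640868041608109885674449343034354662428287880892702452291103796064572250177704411733937681532566156,
    7480892918417218951124903789842775356327804731101546035717498451430824021729852420231906020665316286599848287053113013163045807141,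
    3447200776954717216768454781554230014358380493058554196850345026209036492011696712428921450820671492350336703948201538570776736700908207214,
    9866806329407847220344539107829636473314649952353775557248935363807016297194878169979446781815596139772495818690800145387132328,
    12780812632443331691872894444208783877018827815689592260134085153429385194390311288824690958625310932820587378678849904478568,
    2902018895969846928727488083009067336797740109858842751983371541,
    63781616887962542273080904621,
    21317234354378700795161161816920192628043439964918632366478550148040522163680559338561039118564046503521331802003003902,
    619874815784537752268695004606654442684405686964566227337445676742621085158350316,
    12780936214058043015480790796757991628719049285053376776686914620869810523344832179667907086493192006720161591222715593573426,
    1041636699921728495869051007758525056119591770200101295320091457329103062534,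
    1044743449557707689331401653077679396645769952317290844655771759291402680518,
    21700953591205450130211806852003046372485944129810229279412414841957963900613110118075254697370903532535877042252776178,
    21732712561884267014714381414490607114115801243974311564854342821510558356402653714508288022185766166537397137586867007,
    61006723827812745301155922273117937013830436800854438368143981791153351167595605524587741054191612158262939,
    3776016757431019152194974520988330930814488681715708046134569,
    12990871711738444223679049082810539566070444666418934693888769373702306593247606398677280851186118894208452319195604813315676,
    28027605132118430103289972319950947830715980031794830406364773397872304096540399704244945808091883763482823645143765,
    237937712080745, 50143859126833868399772743842545,
    4627763970115540487981477933013049237327755568016080138916102949968236069068630244357329455745397436669774442409587747418168410758576912,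
    8391566769961836382018829721469174270106135218521957,
    47305984124808926274263540504971192004755658248910739423886563184402601734767565228647355619116426634558872109,
    47304633367595528912642018199022981581898725146716325017149862876741368417475826588027277793985142148946143010,
    16975845947576446007475714892010494139129213907606136397113724323028602485704428933489551262262550291363443915224134105286,
    492831034994000950314575621442546016471038818839267025069728350933869265872165309160,
    378811366211821885325330082366638430373359437966961760835189657821401895219018429329946,
    22149269124701077953865371129574210176388270656001897109641984952699677807829521125701458838900877851800612902750240202,
    230118409154555,
    491403469793478093835508306708853371150952236902583225486736852174876306222316357582,
    18586240009193838802569583980575158328903782, 113237035751238747895660,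
    498539446684938638787006310670406582385003685874510502262329904967431629357242998964,
    3866610732570935933779942817306159919193870521086421307107301,
    630986661798800954939851421712789377655007409594107550186954866062228447806872816,
    23902102194714092702567567404736482787474,
    1786850506334765114293201742601185873558073483089417622753664666703599,
    834088760755574508172479621540420750415928610901775556592239098750753242886431,
    18799870408108494341160447980396171484393024, 24144677779058866638464350902022654171606,
    654098398345803802999260821453223695330117557742502551170781296252118684051042164,
    3085498599467076499678792993717437026761376018516395241145290322,
    6525907009282982977980138723124283886612334505850332939,
    28856767277319566035906323983925157145284149694348667181385097368374572855193628242158886617396186022119408695471453,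
    10176373439347336444456123603993645636913184067009945524343573549964810984275398048478010104347960130947677639032825052537777834,
    135531909095743366485760940470372444335757491790326040387985696105366020318320814630731520771916611,
    297974553061106440515554833154611827222571689293112341467258995979084254350543179726101911,
    230363276214388780450617656644422748280627052728759780734262707927392193417602059762818575177,
    14596241810276938297257700236874142164559136359,
    2388809665311547544914555312102606958532599833777855914975236528434,
    506407228192701786508485500117091523760865701143546573466000283693275829888230726403,
    83575674060707629234891700034407093117011955386646469618656191240970670550581383078433173582988303719192,
    393149117903478758284432757717173128939208004979728180033929164641907415291960583534093,
    77872278653045317916875002845514326381850, 80762653992733980936455506143864416713609146,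
    53155255584486366420581635196019,
    50018825164470026264608710847525086338005676658955772827315276866556496660134185232031101324361225390772532009,
    11443661820547141841020992624759050656092413286322,
    49810304974682431913584818575491810260080088052125761912279086067427123658121660230222551747772325989788444319,
    19254807495672186930568105174997946559972808, 14905975637606644998662502204397062466831135406,
    258560361172807, 42023207438390026402699296006077161, 69242924421422190172081162459,
    6372034480800310432217036077485464836723235423475503223235696494884940005765300312636199128951971841634461776911915527254461419857681,
    6275476221635746465693016827909311395308478129344107587160029993786073741226821348184527567669367041265709906494706232138389786641216,
    83694515519024994093359110085444867484212098765674979628504725162942215197197362730388180851911865482066,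
    399766609881075629433605477464468173665749834359699597773346537803795828691235040139634, 1477,
    1472, 1467, 4070802830083888086126623714424600113019904696503143410924969,
    8265240721656271431254906142995474572901436419161594781049515778036347446819794256510235041472535664405811539201718779563568459354,
    436872511720186459632847761584286569960008457125916115959370872755381785380604746480044703148170158601700440598114279012120,
    101982274137880894463782820533098138670117393363590272456324110392674425065631275340844531577185112889826922477848833298011772,
    714365393937442244977217849570525267499335678672125061935461635487043867132698059938753152945809212867393,
    1467, 1147209960635611270820713115958029424567763844185026834124504971275538046288,
    85683995261918094318959653391153542366697547564305276461009889010149570270893297000486948193519892292283,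
    3787202265487247255151464787575424362239766635971261067924252864992501859668868142765915138803237910791999003984757654370521974529690727244,
    680995955531382039264658725021497419875018072466727247927504843415745240627978458,
    67313218486509626858653213641611420141764381133008154969556119466096977048764872920217619463130815102486573,
    607628, 929151513, 498289620297122499964323, 624771377321599290069756,
    112340253041344214035626189884917100357348379835318852476987843961857162561522045663069976589994608687,
    787701622463180376533707060593191312128607651030981702302697591999075616283355073872767021121378888910446438759508,
    31023174088128545090626210325195448529385771992026309625404598809305038318,
    73728216360444696939380181280,
    11580720887680180994104724864927798876897666124088809276048299130619923675206258281830,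
    615238, 216621468845459999, 1548, 927980465, 278477141615393, 923785394, 1384487990,
    636447172483825292, 627393819672075386893779, 1384477191, 1389843360, 330879042248182098408,
    97774656128952806395771468]

theorem certEight111_refutes : certEight111.Refutes 8 8 8 5 (sideEight 1 1 1) := by
  unfold Cert.Refutes; decide +kernel

/-- A refutation of `sideEight 1 2 2`. -/
def certEight122 : Cert where
  C := [
    4757696, 7301192, 8340608, 10400905, 8341584, 8303688, 10466441, 4608136, 8369280, 7475840,
    8261768, 7382080, 10433673, 12574107, 10174601, 4774593, 7213192, 8336456, 7272528, 12545892,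
    10190593, 4766529, 4068480, 7738000, 7676480, 7119936, 4608640, 3806336, 7083144, 4757952,
    10298177, 8000640, 7606928, 2709568, 10189521, 4757824, 5765184, 12545827, 7345288, 10298049,
    14606236, 2693504, 7627408, 7639184, 4725064]
  D := [
    983062120, 1060462882, 837406944, 837406952, 1027421864, 837407968, 870765984, 1008522457,
    1029196009, 963326432, 982873704, 879213216, 719114656, 1062781273, 963968168, 655680794,
    870699304, 981232744, 837407200, 875393440, 837433192, 837398880, 837407456, 970046112,
    1042076889, 1058126496, 982869608, 837925536, 969958368, 838678184, 711975200, 983103080,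
    830192288, 963338720, 837409000, 837447912, 711957792, 837440232, 963334624, 605639642,
    837449448, 980741224, 837399008, 829930144, 983070312, 983119464, 1029195929]
  B := 255
  S := [
    34514, 34767, 35022, 35276, 35531, 35786, 36041, 36295, 36550, 36805, 32942, 34726, 34980,
    35744, 2347111334, 34214, 9792342, 9398324, 34979, 39104, 35490, 2580296385, 2596943040,
    2613589695, 40635, 40635, 2663529660, 683445305175, 10575705, 691851868245, 9858354,
    178608347610796, 9988914, 180773113093817, 683328906820, 10379830, 42424, 47201241571859539,
    40602, 2813938100, 734383942999, 2913228724, 717337635645, 11097150, 185073459274125,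
    188325000457860, 2912645250, 188333341538715, 189415790150295, 198092294065075, 781077617500,
    200274236746405, 49410515158819398, 49681148584773198, 50503860466975068, 204565994754208,
    12206659, 50785246367562319, 51058048936222549, 51887179252933204, 52163241802436689,
    51886147692367189, 52162172138064469, 827555927119, 3697318188272133891225,
    3890233205138412239326383084928353, 3580752655627465779553926018879005,
    283556753659952458125264815391097954303563028649585, 1036267790586992076081717239346458058,
    965646713906682607027621, 4235951231387055835846112881484310297852386117,
    1021386990606453746665402099010042073,
    18643979480546539986787240437046420493737525570901749715829343557865,
    245100104407612386447445463,
    6588408319012655613663867937584174574441706004837527488117535484277732444966277087544801354941690633703645257464273152,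
    1658824958438653927321241984019533826510044755550665719847287021969653476129894329981040468802971493304173155,
    12617588, 5571343436819288161872557154680995619151255587483688623221137917613101650060445730,
    14707689837265285468, 4792013768594108382516848512062920870293950441271495278599,
    24678296674747170489443941416468388559085336764461846660249523869299549660393847029682987365049441959425,
    7081543503162422933183985178772778919327831604222396340965435837078657496870351505864922645829930119310409957841169103,
    6810191739255399963935991908957111732829688343700089648594498957037364046231636529912223332374350525413394,
    1697621725987465824117023438695339602440210708455785816625771222550365294426277975341201786448244961725890841,
    946153336715,
    94116843431435527945877218191541911108010340105749708181155137245398126433956793352590875,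
    78871110298216222158736948315348045230429099736511562, 516302760821348, 792327173876319,
    64043567, 1052500272862754143964996,
    1361743200627987911768688292209360193167575972907633152251740646851320489,
    18895325440367579411340735334339786256218684, 29615815772,
    18814462432545583570339735325285157916445496,
    179878141240300355803428081031768357538427194524925831094,
    1159310466671238135244959257555263658,
    1371053450749588014283742530369355906038303196984612071437332, 459, 17234723, 789113788658801,
    48634437, 17173410841039940888, 1100655672899001079991802025225871221, 50491,
    19132632339365406783, 126790, 192067, 1049351584517086095230298074103482902518258595853314966,
    540116634567775, 12568356189, 1175859748222382949407406]

theorem certEight122_refutes : certEight122.Refutes 8 8 8 5 (sideEight 1 2 2) := by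
  unfold Cert.Refutes; decide +kernel

/-- A refutation of `sideEight 1 2 3`. -/
def certEight123 : Cert where
  C := [
    7118928, 10432649, 7999632, 4724936, 4751048, 7869576, 5153344, 8106624, 4911176, 4467400,
    4467464, 7087176, 7476352, 2521728, 8299088, 4896840, 4105280, 5227136, 3282048, 4604040,
    10440529, 7338624, 4899392, 7251016, 8110656, 4749384, 4737096, 7600200, 3111553, 7344784,
    4734920, 4745288, 7512144, 4738760, 7148160, 4898888, 4894792, 4733000]
  D := [
    854734440, 963562656, 982573544, 980964585, 980973801, 829141984, 1025414880, 694997472,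
    997253616, 1008637664, 829481448, 725186713, 855545568, 849131112, 866625440, 866625312,
    981231849, 1042192096, 829143336, 829143840]
  B := 187
  S := [
    18942, 19129, 19314, 19500, 19687, 631067803, 3762680, 20249, 3832992, 21557, 21744, 20996,
    3973615, 4008771, 18920, 3763427, 20248, 3795574, 19109, 19296, 3940145, 723143622, 4325178,
    21916, 4395491, 782243104, 24741, 4185304, 21919, 4323480, 4606429, 4641585, 808575700,
    822112086, 4360509, 894253695, 29880702795284, 907297694, 855123946, 29884391221621,
    5759655708754532, 5802646783424768, 162249014963, 31044969533885, 4850827, 6191167226337555,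
    5889327208584659, 6060601810880522, 63451920196783857785727836711027306166261,
    428815209781880758063951981201690362142100903951, 64299364836844916579481675706482921339356,
    420539316595594321548645648574924203404926565512, 288561646903791910605620355006,
    79157602883323723992990851791915572957336034843285,
    2732689139395692790568384701949487795103991097985796716, 52609810242488696251742045512498,
    2366473004739774108643739294118825459300251956, 6447040804999723,
    34180570890012959156127849229789685195892625774743031816444234718591162313443759146774226,
    434270193283723326003893904517675862256876779100,
    453540644539672187661206354285842184364176602316, 54676094643452496710499094908606,
    1238356996124044476, 58437425108678724865748665565585, 47495563354176665508761,
    759368141373486875021988515136288679198817036876188014090318937137962588012,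
    8882232634110141972157552, 202729151113177308343405, 2007308837531967414615889190736309540,
    4489278831319067390200996094132140619596249394712240109321180730656100523, 431567392610, 335,
    70510, 518, 23130812388383637, 891338862701, 71893050937957091178060310516691732405590, 35915,
    6609729]

theorem certEight123_refutes : certEight123.Refutes 8 8 8 5 (sideEight 1 2 3) := by
  unfold Cert.Refutes; decide +kernel

/-- A refutation of `sideEight 2 2 2`. -/
def certEight222 : Cert where
  C := [
    5000649, 7414336, 7934592, 9883544, 10477704, 9662424, 10207304, 7745672, 6013000, 9367320,
    9657240, 9216080, 10470016, 10404936, 9737344, 10157400, 9396184, 10208384, 9895168, 10207808,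
    10437760, 9506952, 10157832, 4508864, 8115328, 8090752, 8315520, 8316032, 10203712, 8093384,
    16215004, 7083144, 8372296, 9891608, 10447704, 10480984, 9698200, 9180296, 9511488, 10174608,
    8196736, 10470528, 10190680, 7119936, 3603713, 5983938, 5471042, 12057859, 7640192, 8164480,
    9371544, 9474192, 10228872, 10480472, 16702723, 10157272, 9923352, 9960728, 10415448,
    15952707, 8381056, 10157848, 10207872, 9911064, 7382080, 7377040, 9666392, 10415960, 9895704,
    9970760, 10469512, 9679504, 7151688, 9960344, 7607432, 14408668, 10149656, 10407832, 10177496,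
    2706817, 5700866, 8381568, 10171008, 10190616, 9625560, 9479232, 7644224, 9694168, 7672448,
    9399064, 9694040, 13887963, 10157912, 9392088, 14342116, 9928472, 9629528, 9442440, 16435171,
    10407768, 8310928, 9891096, 7345288, 14408676, 10210139, 9895192, 9693912]
  D := [
    963272944, 895021354, 963265768, 998615920, 756895385, 999398064, 655672729, 887764584,
    874035353, 1046240553, 1008253104, 963273448, 1025088680, 1058366241, 1043689713, 626814617,
    982371432, 874308842, 846077800, 207613251, 1024517594, 846246376, 837404136, 1027491440,
    1024517602, 712036833, 980505009, 854881065, 881571432, 847042793, 1042109217, 894989097,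
    1053145256, 980513193, 1058592937, 849138073, 874308968, 848590248, 963264744, 963265960,
    829778088, 1058335344, 904283816, 1045721882, 1025337512, 894460642, 854611560, 865107625,
    581747033, 713875737, 1041560858, 963264936, 854734440, 1029239090, 853964200, 848328104,
    980513713, 1060656426, 829712552, 986732136, 986477928, 1062529648, 878465961, 1060720930,
    968210608, 1008048304, 217935171, 963995816, 760242914, 621864410, 963272936, 660127962,
    963260840, 895021353, 1008003696, 660128089, 968214704, 829450408, 1024517601, 1029466280,
    1060720938, 838101160, 963264944, 1058588841, 1042109160, 964454568, 963278056, 996809712,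
    1042076954, 1041593114, 986506600, 904799848, 895247074, 967459312, 963930280, 721381657,
    1058682537, 963260848, 847630632]
  B := 434
  S := [
    105125, 105555, 105986, 106420, 46442861, 107284, 107716, 108150, 109017, 47386804, 109012,
    47764382, 109880, 47953606, 111616, 111616, 48708332, 48897122, 49085912, 116492, 116926,
    49652284, 117794, 118228, 118661, 51731677, 115962, 50786330, 51723336, 51162608, 118566,
    22368143518, 51536716, 119868, 51918202, 53044866, 22778765674, 22859755282, 118132, 53046602,
    53239298, 22861452222, 54940244, 55129034, 120738, 23514676474, 23597172930, 54556924,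
    54559094, 56262644, 132990, 130386, 24663468498, 55503048, 56066814, 24909274381, 56071589,
    130291, 56637524, 131158, 57768528, 24827148030, 58146108, 24991018618, 59093631, 57768529,
    136902, 137336, 138204, 58523692, 26137549503, 26219484797, 4753542672526029, 25808864715,
    134201, 25972358591, 61548772, 135070, 11378845465622, 11201294319640, 141241, 26382035497,
    142110, 61354244, 11592041480796, 2237122093782692940, 62490985, 5077245016606380,
    11521824060938, 12019415601591, 63246147, 63617124, 63805914, 11912081115876,
    2297403409069085242, 5201099800299135, 63997309, 5139367783163689, 2277201925170970999,
    12303239835325, 12125442510655, 5201312669328291, 65511635, 65700425, 5339890896091367,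
    1258720839715941771719765449827323571886568, 566888130502480506441410237225976034024157903,
    721525193586136317619440315444502715960375116777860196158665048551,
    2908747828992969542685225369465514223188, 570078645741126633289023941005722760602658462,
    693570612804102231263425930270854071527225544982707414788127729377,
    93180255062439733263640940084048833807106470432240404509807022585429799193235452027200121277984794058005235282279454,
    4861900500135922646120125448576325730822233722012305807902731934371022698056245659,
    6837760243726403816727953965044044188,
    636550335919242636794794563471080340673733118968767941010462401821241618090817651282305020692466068429412873655882036913351909590497,
    14293637826346094830754085929078760966614796449227290248354264783697182657407297313632214048730709023,
    930816615165555530757394939799176771479216525933233336361649647671182733788425561879784,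
    7913700534404872649263026491166328551506814141747052324313940904287421279188114267865183134103350134580807782530504862929860,
    1680848033892542851546583651262717855771467058703489416713208447,
    11417536886319606461603540767086010323746633303510634403155953774643108630745419,
    584395695501407722443005561840963582472855900,
    8826991476013270311908256748512155105018046236374770822068,
    928381826149653000023126955667193881648842227938487657614465598272703788777043914462843,
    2202665779685970103740550073328343028683903260418150279086319432023994609750670147562,
    1320846023753190087331473352778374572737665,
    3508100420890350695261921778716391029484934994242814248244897608201305986648047406528748294294056096187480987369355597815718011,
    40892963532504288350741740429038573217023532086105589285415337245294869970256251463548758689246830498323105949011707860,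
    7284854202719749925287519463733726534,
    94741147760916562121375464279711518785885305613148922998404552219606363308494056949765713534209515407668973129658745,
    137803299598589131791225135294774456566373896011274948858497451899616517,
    113062676436521402993525670220574771877666563621223,
    1763839865984852175786113617011695828561946307204720050178318237,
    42692792081212642722827570081799360290871913339258855590121159203760432446353903160206314734089211712392722476411117566,
    11449021906460361743750935301046508532296687682917201604889842371561052644837334,
    176751917004926840066802345484144887746038863434006250234318660494696901020909054377126129460,
    6438957341313475818806481006038356462207010094738744112285892151113385582647528816410490672393224690059,
    791, 786, 873, 205325736896722642564676089,
    100958463935278017738723990070074111418152202546847981423589244203166119183787395662744207237894327699064709726914345,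
    116465727204637765499581791320302790311718616311695171248227030943236038776169306632193242503434019,
    3498962079056994857653409862118697536641384688653970683820493276005630957427037782621615846897615086173786591920350625611023515,
    43475842768127991372000197143921513874935237142067471986583185538121390287521765798058115797407238698974643723241592565,
    1263437916571306505823414981921077079179005206117736550180051948628349854203954790670705217458334615431252282,
    522287207809905688380047161808573813686518043950941554388138018172553104620734919675046634248752666304625321123,
    11889521668039182271107285255276331734858428339144871265389528118584436142548320938258467,
    198388958496192, 25982894186291454677158475262301401906492687038296298032385388659, 437,
    194911, 12901956302692621, 45125699661076, 384896, 8853608217750992655, 249008739, 574117,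
    11768205921736915257, 249385882, 3854527908945625744460, 11440069630974072374,
    33088467432398725, 1127711312001459170736623, 17894625613755857157382257984534264962243439345,
    6929098785768346, 5580356207786356342, 3685961429780332546993, 3871615161398705507145,
    2222937453080125166414521, 6383456377100995996893, 2987412325974656974, 5860898816911511075,
    5686276868605382224758183383422856242388138736484, 5733438344800754424, 8633639438001027807,
    238228077634260519114115322]

theorem certEight222_refutes : certEight222.Refutes 8 8 8 5 (sideEight 2 2 2) := by
  unfold Cert.Refutes; decide +kernel

/-- A refutation of `sideEight 2 3 3`. -/
def certEight233 : Cert where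
  C := [
    4758464, 9217088, 9646224, 9606280, 9245312, 8032912, 9343632, 7640192, 9179792, 2693824,
    9446472, 10392192, 7410304, 7771264, 9658264, 7086672, 2694016, 9507456, 7378048, 7348816,
    9475200]
  D := [
    982283176, 862442408, 969531880, 850714913, 855195880, 982275696, 986040552, 969531688,
    894497194, 985198896, 969568552, 846520609, 864399272, 1027162344]
  B := 126
  S := [
    8579, 9731, 9100, 1246530, 9352, 1278535, 10361, 1232939, 1137543, 9717, 10867, 1263418,
    163231630, 23377819029, 1376441, 2690529146819, 187412939, 1536479, 1391563, 3073665339774,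
    387281832915258, 24902296812, 25607853622430721441918999058640,
    54341155703759548171737289358454299975, 54817507486081488397561080795597862782,
    426832990974133989141518895006787780999887456531681319017,
    1479443644199437079972618449804882846774194211876560845126481124461184,
    57878805345742760828550709423718882730131692197396177008541919334840901059743601,
    106763105849529213048909, 1759399407527168084021115157,
    935510385638467840680989764968410826034880, 907381583737046, 7491073928970, 220, 215, 210,
    1411826451578457, 7651388063124, 16465, 506190899]

theorem certEight233_refutes : certEight233.Refutes 8 8 8 5 (sideEight 2 3 3) := by
  unfold Cert.Refutes; decide +kernel

/-- A refutation of `sideEight 2 3 4`. -/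
def certEight234 : Cert where
  C := [
    9183824, 8070208, 10166864, 7118928, 9904200, 7508608, 5500032, 2839616, 4648072, 9694352,
    11791497, 7808064, 7245968, 9212048, 7087176, 4758272, 4725512, 7344784, 4934216, 4758208,
    10335296, 8332352, 9605776, 7377040, 2705984, 9868416]
  D := [
    984643184, 1045754154, 984725616, 829146024, 1043445872, 970737896, 984642416, 761064738,
    984643696, 966373680, 875838105, 626847001, 984642480, 642544473, 513078531]
  B := 151
  S := [
    12269, 12419, 11340, 12870, 1973755, 11792, 2019660, 13474, 2065564, 12399, 1904127,
    322350760, 2156468, 329283472, 2202372, 336214372, 305228869, 51815082880, 343147989,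
    52861786492, 14068, 48141497488, 54404365801, 15578, 1927742,
    29111906391684618677801179497911894034356147, 237, 232, 227,
    419574996459929695828428130522896297193460371923855866737885812745,
    8011381728244320123563844764553312145,
    607229231119803164938058134067456169801146108380121504902187391571903015,
    7428459233028441067260176085315817493, 1332592680231312420375460335687049759479,
    31135722722721568913335938855045913788876806, 24404, 47275, 68562, 91513, 70300,
    6707102805721720, 8509054892450022, 10310923277893424, 235076162447879301634,
    12111777838857088, 1830672264146010742, 24284740, 236978917034832293611, 3060439493,
    377381538129, 10535923561923895, 12208344594858146, 12220278108317605, 92858347895276,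
    14413204, 4084346, 1065166182652459969153272767125339247467748386, 3460631475753045,
    1538907483, 6280480853467425255521]

theorem certEight234_refutes : certEight234.Refutes 8 8 8 5 (sideEight 2 3 4) := by
  unfold Cert.Refutes; decide +kernel

/-- A refutation of `sideEight 2 4 4`. -/
def certEight244 : Cert where
  C := [
    7083144, 8328320, 2718784, 7246480, 2705984, 2693824, 7119936, 4669576, 7148160, 7803520,
    7348816, 2710592, 2694592, 9900672, 9605256, 7508112, 8295552, 2702400, 7770752, 11580545,
    9867400, 9867904, 4674176, 4670080, 7508104, 9180296, 8274560, 4682368, 3576960, 7934592,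
    8278656, 7640192, 2714688, 2701888, 2718272, 8372864]
  D := [
    984487728, 853920104, 981230369, 964221616, 607744345, 984455536, 616541529, 847638824,
    984471856, 582769881, 582767321, 845662568, 846524712, 984381281, 984455664, 895279336,
    582767833, 582967513, 582771929, 928559386, 848621864, 963277160, 846033192, 496071555]
  B := 189
  S := [
    3197526, 17631, 3303178, 3589135, 3339844, 3876257, 19493, 3951102, 3983988, 125786697337,
    141084858754, 4091720, 760055024, 3662471, 793706128, 4129113, 4165023, 4199610, 787490866,
    4096261, 20822, 4166759, 4271433, 143745575622, 4452305, 4594469, 875260013, 23126, 888833804,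
    4631859, 902408163, 909090069, 4739591, 23285, 23474, 176949037260, 33217457092731,
    33944858783019, 5063004, 182080145340, 916629093, 31531860901529, 5061653, 35399521280918,
    997645268, 192423162404, 6827234466566945, 6827721901473386, 6873543979440716, 194988788264,
    62727759303336475129027592525854, 2860337761657892573971505770435835466922850070, 321, 316,
    311, 1031575599938413362926359554789455734500239013241567422378918191123666030480,
    196603553237329751212175883964282311106382478652507950460107228330495966384238,
    32827523365934878056367032716468150214042458213448049128639579895926507,
    135014571944768241262980457092894284644224133185377521611804901032053456478345850,
    4779508857727317100757165969365219968170901957401863405763536128,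
    77068919517947336306154339362769477001709,
    4891866317621047156058869791337837985732038864979402259451610181,
    2580694290824008657735297099235262528158228333619591314425830704039053227512019457566596,
    37935, 2422988349, 3698942650, 26358150, 146053, 4922249310, 320, 461813338651, 3733560459,
    948087669976, 16266120728461451, 24790259902907955, 711961428332, 13754313, 91406882979598]

theorem certEight244_refutes : certEight244.Refutes 8 8 8 5 (sideEight 2 4 4) := by
  unfold Cert.Refutes; decide +kernel

/-- A refutation of `sideEight 2 4 5`. -/
def certEight245 : Cert where
  C := [
    5673600, 8327312, 4966984, 4758720, 5525129, 9248840, 4513408, 9458824, 4644488, 7344784,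
    4971584, 9441936, 4476552, 8101960, 2455232, 9936976, 4737608, 7873608, 4480648, 5533320,
    4741704, 8065168, 7901328, 4505216, 7316032, 4758208, 2436800, 6004808, 2442944, 2584192,
    9605776, 10199112, 7873104, 3576960, 12072073, 4770368, 9704584, 8135248, 7938120]
  D := [
    849207656, 1016506096, 849195880, 603541977, 924555432, 1004073256, 1004067112, 1016506288,
    1016509936, 601387801, 924293288, 924117160, 1016522416, 995945832, 1029306544, 991781744,
    584831449, 849211240, 1004107560, 1025112240]
  B := 166
  S := [
    17485, 17651, 17817, 17485, 17651, 2966807, 2994528, 18148, 18812, 18978, 19143, 19309, 18977,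
    19143, 19807, 19972, 2885962, 483600548, 552022262, 2969128, 2996850, 18459, 19621, 21302,
    3107740, 529396777, 588838409, 19458, 3218630, 3298789, 3326510, 20122, 102371968489, 3768757,
    103135627917, 616586123, 579991921, 17500953982641, 17627812961497, 2968318177155301,
    99297984787, 2989496751429976, 286147286562902399104018406955945676,
    8105132073814486444574348980982018645221, 7276011895893895157044312982972576883514,
    1638813408832556742817485389094257, 7777660523923147823449388599987086564278,
    2823780081181656774717787877889843142061684392155725805560018447283915018754,
    9490266188299628697936142179181911584982283267666989606335578480986357699290884211472354906,
    572856871121680619068886459408240053112303279438526687500800081247419,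
    93766580307954721795844303926753968183266673646340174304159213613208193,
    175361004160888297030185360340554451521904159300406374,
    6447855953060794727545683898612269037391825746235,
    9361283410319273366138521419527268327043693121150700473860568506488115311479503372206281252,
    281, 55283]

theorem certEight245_refutes : certEight245.Refutes 8 8 8 5 (sideEight 2 4 5) := by
  unfold Cert.Refutes; decide +kernel

/-- A refutation of `sideEight 3 3 3`. -/
def certEight333 : Cert where
  C := [
    9446472, 9617304, 10437184, 9657240, 10445960, 12571720, 8381512, 9475200, 12318496, 10443672,
    12189472, 7151688, 11342464, 10478160, 10474568, 8380560, 10441296, 10476952, 12189024,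
    8372864, 11604608, 7087176, 11310208, 7934088, 8184960, 8381008, 12025752, 9737344, 9661144,
    10470016, 10437960, 9506952, 12574104, 11281480, 9629400, 7115904, 12286232, 12209624,
    8377480, 10445392, 9769096, 12011992, 12274136, 11834496, 10440600, 9698712, 9666456, 7378048,
    16213988, 9658264, 7349320]
  D := [
    1032492848, 584344345, 874337193, 1027360944, 1008554905, 980449392, 980973680, 1008554922,
    584336793, 1000765104, 1008554930, 984434800, 907074209, 1029458096, 1025067184, 773643417,
    993358129, 1008557209, 965796208, 1058620274, 875916969, 720982305, 758150562, 1060656433,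
    1058359472, 874337177, 984643696, 985450608, 1027369584, 1060391088, 980994160, 982642025,
    967460784, 980252784, 1008295065, 720982497, 982628976, 980351088, 984381552, 582271385]
  B := 222
  S := [
    31158, 27112, 27334, 31825, 32047, 27999, 31380, 31602, 29110, 32045, 33376, 30444, 29999,
    6781685, 30443, 7427531, 1538529516, 35154, 7575828, 35597, 1582491735, 36263, 356193143896,
    7823356, 7971208, 1758588616, 1648436173, 1659425617, 1692250093, 36043, 83408145925586,
    36488, 380592027261, 1812847821, 91003520462782, 8169238, 8218744, 1824281934,
    19478593947137088, 88283105510166, 8416771, 20923731583459699, 89908081048694, 1923198254,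
    8614796, 21525511751028914, 245995222526251460691082, 565775054686944869429111653782357, 382,
    377, 372, 761797536312490175111955782916523554983083337702231538362716572467320163682602,
    2423901487287924895141944557855045894854396475444960460418653194155903826730160737083,
    388269871286330751986941067978671126299564299215812717283584256998,
    12126841342834701552443252250, 5578975895056891037662499197349788433784492765291876623,
    1443970421996439854182683122478867692812555,
    51580950970363756029853904036556774261967710223247702061846445318139235743194657,
    3449536024953018803095626089747410426385993837053551,
    8839407202189913893858719166972519068190606914034530004835701,
    564391752347816782234539736293122884394208116507732640613837139721233111053253922636425,
    4917618357226882173128126678732715796856279819276175279975400703115992004,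
    70821640397155702186755814334257540741670418525000989223601293622236404927206634755706257727388075684,
    54574416991383339234770041571021392804103980805679712994845379423289689082283056,
    302814071738392334713638095452321662884728599725083665957177471830088229295551582789376265551623231,
    177006407503330118170109326581461748854451340955874052778841364081387727050951582984190260711726301961261537740,
    176185244445749860237508885133919764126497847378568850684044851124688280471445960769293408690059098451063112156,
    56844247598714738768261436596429, 384,
    30301568516069325329460244199441257450183084145170414784827865404577177087664109659723410074,
    360146261251053632909174704309481879348646357, 16931064796277876539, 55016, 254, 11188392,
    51827513934709672, 78402905550325993, 473414431068670, 4890699264]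

theorem certEight333_refutes : certEight333.Refutes 8 8 8 5 (sideEight 3 3 3) := by
  unfold Cert.Refutes; decide +kernel

/-- A refutation of `sideEight 3 4 4`. -/
def certEight344 : Cert where
  C := [
    7540872, 8065160, 8106120, 4685568, 4758976, 4734793, 12521608, 7873608, 3085440, 8327312,
    4734024, 10425480, 7902336, 11834496, 9184328, 7348816, 14672009, 11866752, 11997840,
    14673033, 11915168, 8125504, 9441936, 5766208, 11801232, 2710592, 4742857, 12576544, 7382080,
    2694400, 11543624, 6230656, 7804032, 7087176, 7611464, 7934088, 14672529, 7640192, 5968008,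
    7279744, 7414336]
  D := [
    1015740336, 1015738800, 981853552, 884336099, 981848816, 718896857, 1045484018, 981852400,
    755826329, 996583728, 985096921, 1025078960, 979816688, 987517729, 981853040, 720919777,
    981848560, 756788449, 981852656, 1010072737, 968193712, 924108194, 600562457, 980448688,
    790154465, 981852528, 1058368681, 1041594032]
  B := 194
  S := [
    22955, 23149, 23343, 4314040, 843860486, 22566, 22760, 865878128, 20593, 23340, 23534, 22952,
    4652373, 4199938, 4727451, 22731, 22149, 4843659, 25087, 859103039, 4691564, 25670, 5032810,
    932346408, 4731916, 5143002, 5184130, 5221960, 4728599, 183656929813, 1042320160, 983415726,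
    187928352944, 1056882578, 1027375157, 37286756951639, 1041828351, 37839150197061,
    212162066088, 8091809721849608, 5484233, 213548873513, 202166392411, 42540439211521,
    8252587424313831, 5711797, 7823081546098713, 213527309833, 210709239255,
    177938633970635564550952880945655293399184861816774,
    71819539781183732866819466068938422225487224234484105862000130705013013,
    121736720123186374875654815865058669309844, 3398769194486141784512648825254532818,
    95316756018814657851458249937574, 175726455788417982611661854008811730639691438471898,
    130307351257064156276986386984254649945284,
    186800046430081026704511198910745108595719973842742,
    253692479529695735325082626277069117285279172783938009885726,
    2882934937942103971584796611201237536447286705063750619203639197338689088802, 336, 331,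
    4289273246905707824449647030702261033788257520294266032750243950196,
    5263040047682526333374197997626759927708507562653501373105518845105972775818574714654075026557,
    5525339703805713872285024048219684077488707763676293125580269101445977042269674400925612091508,
    9409723936573094438837620128025924732042317667870975525425,
    56214269247681313894754648380595154529590802490475296052774555,
    317992211720240376213184497698707238221902973028244331008177,
    44971516751270528018061036745070954450255750838, 103307223239093, 391, 77551, 156894979328581,
    1087701550531, 226957908687714306954893]

theorem certEight344_refutes : certEight344.Refutes 8 8 8 5 (sideEight 3 4 4) := by
  unfold Cert.Refutes; decide +kernel

/-- A refutation of `sideEight 3 4 5`. -/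
def certEight345 : Cert where
  C := [
    9179792, 8101960, 8364624, 12296272, 9901192, 7934088, 4501440, 4685440, 11276944, 4517504,
    12558416, 7348816, 9478224, 11608640, 4678272, 4521600, 4681344, 8327312, 11838528, 4501248,
    7381072, 10461776, 4513408, 4674176]
  D := [
    1025451809, 1041332889, 1060657321, 1060658345, 1041406448, 582701529, 1041668592, 1054111521,
    1013364912, 1047173616, 584896921]
  B := 128
  S := [
    9758, 8842, 10010, 9099, 8587, 9355, 10781, 8972, 179676958, 11166, 9230, 162703374, 9760,
    9888, 1502496, 194472608, 169324576, 200830624, 22214652320, 376676065700757, 22759961505,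
    3425449948449, 26236906391, 9255953269274486796331921353324524116236, 207, 202,
    642824576125687590944124192456462209264832033667959294597,
    41858117409756852615812512412884402355856423483179558564649669533646361281, 455,
    4334020297932546822514218925231420, 91009, 17358, 3930764, 47116, 50647, 8381051812125,
    786299283, 4388869757615423, 39232896662941, 28813911939730293298, 297730397677224606,
    8862893538843]

theorem certEight345_refutes : certEight345.Refutes 8 8 8 5 (sideEight 3 4 5) := by
  unfold Cert.Refutes; decide +kernel

/-- A refutation of `sideEight 3 5 5`. -/
def certEight355 : Cert where
  C := [
    8360072, 4758720, 11277448, 9900176, 9409168, 8328320, 7279744, 11473552, 9773760, 7869072,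
    10162816, 4767296, 12292232, 9376400, 11341960, 5738632, 4783680, 11997328, 4726088, 7803536,
    8168512, 7606928, 6230152, 7082640, 9217088, 2710592, 11309200, 5181576, 4734536, 11801232,
    9248840, 8200896, 4759424, 10415184, 9704584, 10003520, 11539592, 4775488, 9442440, 7352976,
    4702344]
  D := [
    1013332656, 917747554, 982692784, 858878306, 791630242, 761244897, 723508377, 981840816,
    984412528, 761114337, 582794585, 599224089, 761113825, 730587481, 722828441, 1047939826,
    653218266, 1062265200, 984445296, 582792537, 775189721, 639609561, 712793313, 980250992,
    735344289, 584577241, 1041595618, 1043288538, 981906352, 985198960, 635415257]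
  B := 221
  S := [
    22610, 5203513, 5252575, 23936, 23681, 24377, 23935, 5352245, 25040, 6231825, 5499431, 25040,
    25455, 26146, 1419837994, 26119, 26810, 29904, 26784, 1474052610, 6771729, 328172820758,
    27229, 27450, 6915823, 337886612770, 1549806549, 6719333, 1550585354, 1561480212, 1572274515,
    349867946551, 6724438, 31657, 78909726075564, 32100, 7161560, 7356482, 7406207, 6966196,
    31215, 82616780834926, 79453672641187, 1561624952, 1702190897, 34974, 380976780149,
    85794084129394, 84212697044324, 7800032, 1789132545, 7457262, 35861, 1799776544, 34093, 34314,
    1702778318, 1713425877, 20364934338313434, 412128500805,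
    659554051551831326639143052197245563020513186809916601, 363,
    24883018203644131417893547785672243031, 262272209299156900907970034380712388475640248,
    2056912850450092354042923776833233547960950109719710085039609290235611702836810965002,
    14585102614518930920548562976648432798454921233934,
    74215681668670088991426970945796924519925477947187934212581631090050,
    301715799269407698261692669516668498363337183,
    201137610984875666098479351403615577426748135011320508022322658634725519909576,
    910082100934061433462490039637157194397284802317746396117685943450397771032,
    62508934430269439371931628262318055089499932911,
    150108090467822825800272158219327157345555185423376647346,
    2205263649174892156870910041134348607098109350109058523567434523346777060747292518540, 86855,
    5314768230151531491900746171079437234142291181628561437343220847681899879369153566997648671188,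
    31594697343026901674093311079718701322006212759718882758874037547, 443, 48446993084613178,
    336278085635518, 9260102501, 569824921246853, 63586622,
    17382958223941038016419583861179328835012725286077675580528749,
    8099370098642387102009442465708118951442047124252387738787976,
    13282642688634509166683996501271572295158577670187300900983870904987011961488903060894407,
    399, 406, 471, 75255334741261027, 101120517340033680, 577590400327, 226132757889748, 144585,
    16631659857674901799, 1028017818993, 7027245335, 281580173589319246723000]

theorem certEight355_refutes : certEight355.Refutes 8 8 8 5 (sideEight 3 5 5) := by
  unfold Cert.Refutes; decide +kernel

/-- A refutation of `sideEight 4 4 4`. -/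
def certEight444 : Cert where
  C := [
    6246472, 12075600, 11341960, 7147656, 13439112, 9244808, 7671944, 11866248, 9769096, 13963400,
    12128392, 7934088, 10031240, 7414336, 7410304, 13722240, 13701824, 9515584, 9507016, 13653128,
    13669504, 11572352, 9475200, 7378048, 11543624, 13640776, 9446472, 7349320, 13672528,
    11543120, 7348816, 11604608, 3130497, 11495896, 12472400, 8376400, 14667856, 12308560,
    10211408, 7861384, 7843976, 7607432, 8106120, 8007816, 8196232, 8315016, 8372360, 8373384,
    8368264, 8380552, 8278152, 8131720, 12214232, 12279768, 12096640, 12300928, 12202624,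
    12464768, 12530304, 7336576, 7115904, 8270464, 8164480, 8381056, 8368768, 8073856, 8106624,
    14672512, 14660224, 14455936, 14416088, 14416072, 9400280, 12576480, 13533080, 14339928,
    14669736, 13827928, 10178520, 12189472, 10472344, 14319384, 10415896, 14285096, 14317352,
    14415656, 11759448, 11790808, 11661280, 11660768, 11790304, 14576408, 10439576, 13626144,
    9629528, 13823968, 10480408, 14338016, 10447640, 10436504, 13629720, 13625624, 13625312,
    14318360, 12577048, 14608664, 12544280, 14416152, 14350616, 10415384, 10480920, 12578072,
    14596000, 14399456, 12302304, 10415832, 10468248, 14415712, 12277728, 14024616, 14084064,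
    14055336, 14285160, 12019680, 14051304, 14543208, 14342616, 11956184, 9891288, 9924568,
    10222424, 9895832, 14020584, 12576608, 14053352, 12543840, 14277096, 14019048, 12319064,
    14416232, 11959704, 14057368, 14086112, 10480984, 9928600, 10157400, 14572440, 12013536,
    13819872, 13818328, 14076376, 9657304, 14670624, 11947992, 9895128, 12056792, 11427800,
    10439384, 13810136, 13760744, 11910624, 13531928, 9403160, 13530920, 13753312, 13374096,
    11277448, 7083144, 9179792, 9741376, 13935680, 11838528, 9740368, 9942144, 14398592, 8107136,
    8285904, 14407648, 10350288, 14149600, 14408152, 14407456, 14407960]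
  D := [
    1051864281, 1051807961, 1051949209, 668131546, 718372769, 878698714, 584155033, 904574753,
    900704033, 896252705, 855029537, 854965025, 854448929, 854453025, 846126881, 1014414497,
    1018902177, 1018123937, 1018027169, 651410073, 898874009, 748141721, 748137689, 748109465,
    980375849, 986569001, 870963497, 1036888361, 1004120361, 1030695209, 986835681, 980904673,
    980642529, 599477913, 888515297, 1037150945, 905030369, 1020898017, 1010590962, 861434666,
    1010590937, 742155481, 876373209, 742155490, 1010590946, 876373218, 995652394, 980635873,
    980636897, 980627809, 980477281, 980477297, 980476273, 980476257, 980476129, 980480225,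
    980480353, 980480369, 980481377, 980481393, 980481249, 980481265, 1003083049, 991483177,
    997483817, 991749417, 997516585, 1003808041, 991229225, 1003812137, 991491369, 999585065,
    712494305, 864673577, 1024506033, 713867609, 590378330, 911524322, 911492066, 911491810,
    911504098, 911536354, 911539938, 911507170, 911506146, 911538914, 760948953, 911505122,
    983319257, 1043364009, 846811425, 925914522, 858805658, 1060132250, 993023386, 724587930,
    907326954, 985477985, 793563426, 793563554, 1041544681, 793563553, 925658785, 927755937,
    795635361, 586710233, 735866529, 761032353, 586708185, 861695649, 727477921, 859598497,
    586707673, 758935201, 863792801, 586709721, 586699993, 726953633, 870969641, 870969633,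
    870959593, 871035169, 987613921, 987613417, 739225049, 739126745, 722709977, 797988057,
    983327985, 983327961, 995653809, 655938778, 726983138, 846393569, 991872689, 846361833,
    846231785, 846230753, 995903153, 846232289, 846222305, 846222313, 985480481, 924202665,
    775706842, 876370138, 878467290, 876179811, 865368729, 865366953, 865367465, 865367721,
    639581018, 980859377, 874150746, 1000265393, 981357993, 874174938, 734646753, 734647777,
    734777825, 737460705, 638645595, 874133161, 760244442, 925919450, 1028679898, 1026582746,
    1027360170, 1025295786, 1004291498, 1004324266, 878358241, 997508522, 985219553]
  B := 921
  S := [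
    287388276246865, 339653923, 288828868543522, 340511374, 288115602192481, 342204172,
    291717076555738, 297481002253739, 296762260510727, 251114941609305523556,
    251725925252852896328, 252336908896387545485, 252947892539934918257, 253558876183479746306,
    254169859827016940186, 254780843470561768235, 255391827114098962115, 256002810757643790164,
    256613794401191162936, 257224778044730901539, 256613794401979181588, 257225441435535529394,
    305405798144618, 298212245388266, 309007275052598, 309008057130800, 307566683612471,
    261502326940318788140, 257839742757263794949, 260281687156698262838, 262723631556132730727,
    263946261514490465246, 264557245158030203849, 265168228801577576621, 265779212445122404670,
    267000516341402344388, 267611499984165942476, 268222483627713315248, 263950241863969976810,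
    316931310067616, 368542199, 320532772556420, 321253072519070, 321973359758105,
    322693657176032, 323413954593959, 321972588710720, 323413177607966, 274332322221675380834,
    324853767354374, 325574062227578, 276776254638086512694, 327014651973986, 327734946847190,
    327734947696352, 329175536593598, 329895831466802, 330616126340006, 280442157219635085854,
    327729476526107, 328449776488757, 329170071361961, 329890358600996, 330610653474200,
    331330948347404, 332051243220608, 332771545730744, 333489494369342, 334209791792795,
    334930086665999, 335650378988954, 338536245861536, 339251853354974, 339974491915298,
    340694779151570, 341415081658943, 337813612387895, 338533899626930, 339256545824186,
    339974497015796, 340694791889000, 341415084211955, 344293912375193, 345014214882566,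
    345734509755770, 348620374080866, 347177443197587, 347895394380908, 348618032943995,
    349335984127316, 411000330, 411849492, 301216263770569749084, 356546736686856,
    357267031560060, 357987326433264, 358707621306468, 359427921269118, 304882165631828538486,
    360868511015526, 306104132918913105138, 363027832326054, 363029395635138, 363749690508342,
    364469985381546, 365909004184701, 365910567493785, 310381018423701454251, 423740523,
    424597053, 430528293, 428829969, 427137171, 427986333, 428829969, 437310537, 435623265,
    433924941, 437321589, 433081305, 439019913, 434774103, 435623265, 439014387, 439871838,
    440721000, 441567399, 442416561, 443265723, 441572925, 447511533, 443268486, 449209857,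
    444966810, 450908181, 446665134, 452606505, 453455667, 449215383, 450064545, 450910944,
    451762869, 455156754, 453461193, 456855078, 455159517, 456008679, 461947287, 462796449,
    466184808, 459402564, 460251726, 463645611, 467042259, 467891421, 463648374, 467042259,
    465343935, 466195860, 467042259, 467891421, 471288069, 469589745, 470438907, 471293595,
    474687480, 478081365, 478930527, 479779689, 480628851, 476383041, 479779689, 478081365,
    481478013, 479779689, 480628851, 484028262, 482327175, 485726586, 484031025, 484877424,
    490818795, 491667957, 492517119, 488276835, 487416547, 490813195, 497598202, 498452890,
    499299289, 496757329, 497600965, 498452890, 496754566, 424966945808305, 425687240681509,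
    426407535554713, 427127830427917, 421374853844275, 422095148717479, 429288715047529,
    430009009920733, 430729304793937, 431449599667141, 425696623083499, 432890189413549,
    427137212829907, 434330779159957, 430733997268675, 433612830526885, 512039482, 512888644,
    513737806, 514586968, 515436130, 516285292, 517134454, 517983616, 518832778, 442979005023697,
    441538417827538, 440097828078367, 447298425480829, 527327161, 520542154, 521391316, 522240478,
    523089640, 523938802, 524787964, 525637126, 526486288, 527335450, 455221663999390, 529033774,
    456657571447189, 453060789561433, 455941969048723, 540059065, 540908227, 541754626, 542603788,
    543458476, 539215429, 460981684379059, 543461239, 544310401, 543458476, 546857887,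
    464585504979685, 465305799852889, 466028438415976, 468909615361306, 467469028162384,
    468189323035588, 471070499980918, 469627569092113, 470350207655200, 471068158838521,
    473951679473734, 472511092274812, 473229043458133, 476112564093346, 476832858966550,
    475392271767628, 559600997, 557905436, 566383241, 559606523, 565545131, 566386004, 564698732,
    568092617, 566397056, 567246218, 570640103, 574025699, 567243455, 570640103, 576573185,
    574885913, 570640103, 571492028, 417913477736153993306, 418524460660186028195,
    419135444303733400967, 419746428666785932730, 420357411590815423817, 420968395234352617697,
    421579378877897445746, 422801345444689682075, 492679353816759, 495558187072206,
    494119943563167, 496998771729168, 497716720367766, 496278476858727, 501320535876183,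
    502040835841596, 502761125622591, 593559060, 497721417931950, 504917327951883,
    499162007681121, 596109309, 594410985, 505642315299825, 502043189718660, 504924366663990,
    505644661537194, 508523494792641, 504924369211476, 509964084539049, 510684379412253,
    509246135903214, 512122620376569, 510686725652385, 607145652, 607992051, 608841213,
    517884981909686, 606299252, 607148414, 515728789764812, 613092548, 515008497433568, 614785346,
    516449087182739, 519327920435423, 617332832, 522931735946603, 523652030819807,
    524372318056079, 619036682, 523652033370055, 622430566, 623276965, 624123364, 624972526,
    620732242, 621581404, 622430566, 623279728, 532293220516162, 624978052, 533731466572687,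
    538061829358245, 538782119142003, 539502421649376, 636029316, 629235099, 635182917, 630933423,
    631785348, 637715667, 641109552, 474325699082735908, 266993720073073406814253478673660871625,
    403467937243844876663596, 71771000520838872930559151904433370564234293247866667020965,
    404593369115249697941764, 457866200535208765157645151949360786672385199710336782586539,
    293666541, 234839896791550443, 109887111338520172002343251722312262307788227, 276041622485,
    409108858131941226458966, 165227532429793623197019087994485155646643452754568791280,
    116426022534593673415095935066736011901728, 233343470,
    111785485639697374296029522147473273969485865,
    1175292864315219075921127232979260589484644608956, 156240840300466916475327541306623,
    379367890854670943591320588, 640143009290273083748625355987864246272816499654,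
    488269164824714356, 386595298912552154889757333094094952367005779126837385138624,
    1811842336283258499893901052, 228262322, 253866009608084,
    154899442058937696817501344337639159533380677272662032522954, 233514859453971707,
    1384738983959532475749533977588795628937429,
    797005691727003618193782357793166621952566841425171017042,
    295676337428095779558275382988612331979115072594056625557712604643, 223000037730952734471,
    455794161450723769410, 278553158457173640958698927928652679818,
    1342623805545421900898855707496683227266125072356,
    122485843082196371827383289174713171350783884550570828514573397149994,
    13397619327857060014206379803964254643074472705053241088332876715071740665351,
    133347822867265740674965583560833653955950594616290594591872126931,
    186794118183706830984066353, 89315459487339962904360111278756065914691293302557306,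
    82487411507341981229418813824301093000639770878316921753, 188359685565339790582660785,
    259295256522122891534684484954474629445858, 435543092449335159962014,
    495556867916624816391548862439394373068774508943002,
    1630631533329752554626719382836421326068184608749370553239944269749399, 273433170,
    221692779296827333081617496356043658407230664068,
    415634568724421929242329625461808689235689383837016692,
    284146592358190740867441240796919948722, 550014117200408, 178995041658321870688323711166,
    258330155264094746, 467716284229935398666, 601046066484, 366581301688175592633436851806,
    922226608967745645656894289557350787853488864791930710969682702942331186345563,
    98843060572875665537444631480092657608647840405481233,
    43513784441903696709748926913358809365936384664104406475859236453468967167489934130,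
    452184024655350032080960319583377771393782417207921707993660202175843,
    80372410424114181803624370322937093781270050101983956386875,
    640722726612590479287040227568596473569583901791008294437963533217635573280,
    1068292091231650114993688313298831104453461563334446232283591009,
    55764618484463672196819205824527934808855539440376245106076906105583730343693276941345121532474721,
    16979578451880099890466216605722071929057944761316639196484489806337244000410,
    45927322487975644951114856586192033531098, 575272562124868775263126246911035783584992950730,
    64785778285518176014817894037, 480583698569335489200,
    545892685903225724529057689402769238609787585739323117503687166316302520370608528233430472,
    70406967967941421997679688632891271972047928327655490212096590974,
    46421858827836607248967903340524249389902020216576575484472837083943872808999830,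
    1421029682496340444246942772711013659370543919683476697220296466578732,
    2796353680508080981535723604586850710157846497025, 353850220, 572733112226646,
    213521072844786320222546, 5540043529781937632979188786684246290,
    183204868162939000365622465770236242840458712431155798340, 4324903389465,
    385192868976730776609896219962, 255572417861980993996810309610902289086923990,
    5784907362604665704206105007802832507351557635,
    154066294100478772249223951315143843371001930191381460147458782171994,
    417284916168285570750624536351043157475558933847947841474055620047282287,
    210371964134589588390007229678427776249053077448300358449,
    1976150520839822329884120498833893041792178950614875, 2344930472,
    1025527278343863630645456065733478271084250764900933091355,
    3386161048895735608769442525970492, 241242774872515007552144721627215731579605520338,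
    3786290690992745610986609609132282479979979014, 8898883406146077048559177369204194259,
    10300868948231298505775915758279308023904, 149062320832356723546219162103611976232,
    107520550175015787751898305935671719394038714827807,
    44731348315843488551039534452043292411771984401035, 61901090387948783427060253633469700709,
    1587221098454356948020293667402922672409575913,
    1468198736930332709583757738805842721128295773273459373,
    1082437778845390231966699636346784343005215616340835476012291466077840,
    3150382192995875347997231888063563136, 104952975126323949652222909636731265136546046291483092,
    30261489249968677880384956638900349634961452153479362111365566803,
    1955027569660524830656061597473042330001827734733836749730704172,
    3181303676493848056093542996906827380054005008189368,
    2445045296046626033202318690426670555306884770032903,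
    2479472510203401498964730002091022942532027522173789450,
    3465123518833710218874540654470863642016906980,
    909673145060237808954754653883445393710310153298,
    3354462981712676612458284854124848217498032251767464224786340,
    6030574303063185624348199549899809, 93806599593616699418877798, 1564070754,
    4800934648839787459652079887295009777689760334834,
    5006119964099665329981158605569532708184281128307185579,
    3219107250254890234883697794084945519611854600577424976575289221583471740,
    4298258682020669423741770280859885928713446574705134121753729166,
    5239455914614678494006525237353813099757833055976774359061,
    4256970829113339175776503731886108735555768184913742341705793978694, 255210247018529246333652,
    4973387125250156858634456048063061415943499095621745090587725504,
    2897936961038018108162938005742802011488727583632141749924309909132514805604353442800,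
    5191762303451664555037803803187168974691408795728894005418552,
    373914787673896145278734915395464,
    5578047041410252796232985066602182464230110223431645270157092,
    79760221926528156237868063807282943, 1787, 1782, 1777, 1772,
    1119091281917728611909789369760607847, 1864882421703246595831411193399763951,
    805783297713693197477591224808130294456849172398,
    3198084575204552374716903877723591092438375762196479952844417210922580617052960238867881702209,
    3862300270212428493401752912029283742781445999608262103316180934503349456704572319416295,
    3111818512399876014817195,
    1278854464490804391429924832437690800288530070156226876503939058689235543400,
    3163410241013005320024426915801732241896931,
    2470805524324232117860148683901448553779258157198097,
    5096223217423143321491926442859960590942335035668581325458946869399224059006494634,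
    8527877311331210400424215864097441984726163655809087534657706493,
    3459779924376822956442943712122896466792535362148462,
    1564368508853894556434868838593406681475474648476537559183147661099882366349686124219348,
    2895505076103909706977464972390138249853452881467754110409650,
    7084612810386254699021878385990907562, 1408, 2329, 3250, 4171,
    418991126469240124458685015697469968481570796302194944640, 10979354615485609749660391915,
    872149, 1584522437, 1721307, 2331, 611651372530457701]

theorem certEight444_refutes : certEight444.Refutes 8 8 8 5 (sideEight 4 4 4) := by
  unfold Cert.Refutes; decide +kernel

/-- A refutation of `sideEight 4 5 5`. -/
def certEight455 : Cert where
  C := [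
    14652048, 14306264, 13775488, 9510984, 11838528, 13790168, 12292232, 14088472, 9244808,
    12067912, 2694912, 14317416, 8200768, 12018240, 4715136, 4759232, 9475200, 10457728, 14127240,
    12128896, 14389384, 3380352, 3642496, 8097928, 13865104, 11805768, 7675976, 6263424, 7905360,
    12554880, 9741376, 9933456, 7573648, 14192784, 9708616, 7151688, 12100672, 8360576, 9458760,
    11870280, 12030088, 7934088, 7835792, 11310208, 12030592, 9970760, 13439112, 9773128, 9670800,
    2707008, 9445968, 14342112, 7087176, 11543120, 13902920, 13640776, 13967432, 13701256,
    11281480, 9184328, 13653064, 7349320]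
  D := [
    848225625, 599097114, 792284833, 761260185, 907894425, 929967913, 785530521, 874339993,
    781143705, 912946537, 779181217, 775835289, 895477929, 773738137, 792281441, 589131417,
    912945513, 896421545, 786321049, 781667993, 931783017, 617279897, 714863961, 605908633,
    1042237162, 883781273, 874344089, 777473689, 912946025, 890874345, 740126361, 1062587618,
    773213849, 848159593, 654135578, 1009611106, 605904537]
  B := 251
  S := [
    33978, 34227, 34477, 34727, 34973, 35219, 35673, 35719, 37727, 37978, 9297324, 38481, 37433,
    9298580, 37182, 39488, 39739, 9549331, 9612583, 10185412, 10245150, 42752, 2476861764,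
    2619183828, 10060665, 43757, 42251, 10372367, 10751167, 10940421, 2603872288, 2746762863,
    2794454871, 697407381549, 2794391870, 2730882057, 2826334382, 45517, 10814637, 2699508565,
    2889651392, 11134698, 733271459072, 737256461576, 2778891084, 2842207340, 188052314896033,
    709378202534, 725223143288, 2905713353, 11762669, 194049743666063, 2953342863, 733288215300,
    196054168488580, 12270193, 12142183, 199054875563850, 3222112197, 200051142570863, 3127794644,
    784223470888600989456766318234175426041461635707, 421,
    831381226141647552657835487327351715310028732942,
    13106850614445145000728583244876766726273340600306013883099537293921839821700469,
    51621357298909274534794159719982500234639624942698542,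
    50650057995817925924886031468455152652468523648098157,
    12402612059896139618230764256255347790410144112446399158,
    3396120532838896538762776282745676746657684874752925900677698296593933,
    200905992158544517628127202630195455957018055364567789051783525133454669372293597785077991353350017,
    52074216517708047131107651714569704636089852085797373275542314590430169567247903615359699563062698590,
    49652185552616598722256328183045368380015726220555858,
    215894928155822490699458496975820144603812062103797343588788944440149386159,
    55315979975466314173690585760593141240195,
    212644695682281593302124089523118113716271400477487, 3513335333781367017699831428536659,
    248612642294312460657906810216144148841322172,
    202680541201535229481715297721192912132933196722729670564084238139820402202805506935798498517956136,
    870201996847169040730465390871656759,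
    52870096842188087235423928868808721528055066731218365415172780898876151465394412030950365694592119293765481850956,
    222932367836028390884406853424833023949330985928822825399458234801357019022903030187574, 458,
    181767764178992023, 3889394386959, 77738004, 1478328445613448, 436265, 434082202647523057,
    31483169251, 563028, 626278, 59786392638272685603932791264067082417195, 64768365278199887,
    444, 446, 448, 3600847174682159056963742270118733371378965704223008683880616701963682,
    244184750110755706911649597538493030980,
    186780704693699236655112872484393435751406814367537706157283471304487, 63139115898586662154]

theorem certEight455_refutes : certEight455.Refutes 8 8 8 5 (sideEight 4 5 5) := by
  unfold Cert.Refutes; decide +kernel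

/-- A refutation of `sideEight 5 5 5`. -/
def certEight555 : Cert where
  C := [
    12287832, 7148160, 14229576, 11341960, 16641256, 11790176, 12568416, 16641320, 9773632,
    13443648, 7119936, 11922912, 15848584, 14416728, 11281480, 13640776, 13931648, 14045160,
    13902920, 9183824, 11543624, 16730968, 16584840, 11779552, 8131720, 12277728, 12545888,
    12303832, 14317416, 7382080, 11495768, 11310208, 15540800, 16738144, 15766656, 15682528,
    13378632, 9479232, 15882160, 14674720, 9708112, 13407360, 16120240, 15690088, 15508544,
    12287840, 13673536, 15737928, 14309096, 9740368, 9446472, 16698776, 7087176, 16738648,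
    7349320, 15951712, 13617640, 14277096, 7640192, 13891424, 15770688, 15475784, 14674264,
    12545880, 9216080, 14403552]
  D := [
    850423641, 995911329, 982835505, 1029326513, 980562289, 888690402, 851013913, 1043676321,
    1010121377, 866766817, 909519577, 983093553, 859657897, 1008528537, 1001415514, 730591641,
    1058325937, 991781666, 583885145, 995910490, 866771809, 651406041, 855402217, 758922913,
    618375897, 891121385, 848328105, 983217969, 1057801569, 1057801577, 1060387098, 866906969,
    1008560793, 873773729, 714035033, 910142169, 1010119065, 790052505, 739589281, 1060776665,
    718860569, 1058325922, 730916185, 624521497, 1010119153, 622570201, 1008558946, 756890785,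
    1008300891, 1010131177, 1058326761, 866906465, 863534753, 585921369, 848617769, 583889817,
    1010131425, 1058745049, 987296089, 1010132649, 1016441585, 770914457, 752238233]
  B := 316
  S := [
    50303, 50617, 50933, 52829, 53145, 51881, 17129153, 52513, 54724, 53144, 58264, 55354, 55670,
    56302, 56618, 59846, 56935, 57567, 60795, 58200, 56620, 56936, 18730324, 59147, 18333111,
    59779, 63326, 19232764, 60728, 59464, 61676, 65541, 62309, 19234661, 20837171, 66806,
    20134315, 63890, 21432831, 6742645391, 64279, 63260, 64912, 21738088, 65790, 22134037, 66177,
    6995882736, 68005, 21437505, 21535148, 2250710470974, 22840614, 68390, 2280719102242,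
    22036012, 69588, 23341476, 71169, 73133, 23138538, 22639574, 7533412963, 22342287, 23539228,
    7502558408, 71173, 71873, 73137, 73453, 7627574580, 2440796164878, 2430319066629, 23642631,
    2390498393622, 234770176592418976, 2380590482223, 2480523672175, 793408101432170, 24244614,
    2510532295545, 24744527, 255708035343065455, 24644355,
    774191183211287331904205264817752608458515916, 7689520926253883468641175957290914842765,
    2529149178377060849889957480401630119278810,
    7813078622781583739294992025552932049393297757628396013, 1497, 201524, 200255,
    826397054327239889617289863805848282689658700636363613432309495760008775623,
    825925475154941749748787755362995344896949531209082410778426357797419254742234359479971299,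
    2595393330240971636798770056221014771224926451743659762382420135341752386,
    2574809161027022720900368320714347308461025540477258633314898092448075656745515101805821,
    8285286888378559321021943858043779018479,
    2406888000071850500666137175395658337895891098999261751613978155930200614847965502901976248036437499841834515,
    26028994790142447223637360693003976722531513955530558242282224735477214533025025257818744572717459816224095520269752051174641246,
    429453337336875645531462115213186339137497160492148147963618078527502783209659181590229018929997214901121247632393,
    26840976433292367291983193620148087619622685108329281292976732495795343242083092336881990193500860,
    2701634123291921386105630399793239136148839239545901586151219384374224676926701498116280,
    27155185313174398900553762873926140750364005850507792810992130913464269779994379702,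
    86244355235559588863377625121312556346500526030902373649517294259569912821441987,
    19241244659958011674208644930812646845082579837500366395694502827170017556508691051219183865372000112410956,
    2701917509360324085180172873038597470840120241407835377151035206011412231828071762383785,
    5616, 86668653117952211393472744903788880568184727118766,
    281958112489742186936335703948740421031839774207727653911861934,
    2786673127387947631077699153281270832771118,
    83409049323834001588330606886915422925171665010271114241948227533873207960594220256958596668059,
    5997309622523368678665814244553779710208413040,
    28154595154795981395830135568128991339423378313752112441185335710009,
    27197929385443533186109606834817554095662085249012058,
    85636674834192282759462436815686933861368325052237531053505801906452540169214123,
    2671164348024745092053015588196922534919665817543116941639068290887865508542570815283854535605436201098,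
    915543565732312477630614696814335624687251516503877766553438878472385467397466159418783093,
    85380264907424865822362956405160728974717980478204868572410215382794947892077361,
    283736594718378614214347106689274758570972854388029576937335195968196957395025,
    2884885520171935236106130389775867950161628730074054521870,
    27889477084425409893768440198453359663099042722361104,
    29506683075551778044340364872235142028358778855985645945457422718701744686796887496,
    3520852271221, 609303088982782353, 9070437259746600048042401589548333464944,
    605487163713988288, 6131887545443, 29405891683, 63509011, 123779122605533642404693,
    1567543656000423781475403608092012897485863811563, 386785, 2816, 602267, 200031]

theorem certEight555_refutes : certEight555.Refutes 8 8 8 5 (sideEight 5 5 5) := by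
  unfold Cert.Refutes; decide +kernel

/-- A refutation of `sideNine 0 0 0`. -/
def certNine000 : Cert where
  C := [
    5483295, 5481108, 5481837, 5491314, 5489856, 5490585, 5487669, 5488398, 8761608, 8834508,
    8820657, 8823573, 8821386, 8827947, 8970831, 13141602, 13141611, 13140792, 13137957, 13137966,
    13162257, 13132134, 13203497, 13144448, 8202870, 8380017, 8373456, 8439066, 8852409, 9029556,
    8970507, 8898336, 8911458, 8734311, 9311679, 9488826, 9436338, 9377289, 9252630, 13680576,
    27039856, 36653043, 36357798, 41376963, 41304927, 41304945, 41364003, 36997212, 40604394,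
    37062732, 37062723, 31679220, 40844874, 36120954, 31870065, 35829354, 40610874, 36537843,
    40840563, 40840554, 40840572, 40847052, 41307114, 32332314, 41320092, 31798776, 12957084,
    8938755, 41139561, 37704315, 37710795, 12962279, 42675402, 14312216, 14325338, 14318777,
    14325347, 40851678, 40851516, 40840734, 40840653, 40859616, 40858806, 40857420, 40857429,
    40857348, 40858077, 40845846, 40844379, 40844307, 40845027, 40845036, 40845117, 40782414,
    40782333, 40800576, 36133509, 36133428, 36134157, 36134238, 36135696, 36134886, 36121116,
    36121197, 36121926, 36126867, 41677645, 37895988, 31338138, 42859183, 10677430, 10139508,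
    8363007, 10207377, 10207215, 10200735, 10200816, 41273454, 41274174, 41271987, 41305125,
    41307285, 41321892, 41331045, 41315331, 41365605, 42848814, 42958245, 42959685, 42966165,
    42559491, 42565971, 40799685, 31801044, 41307204, 40852893, 40780866, 31354167, 14279410,
    14279409, 37774481, 37892568, 37833519, 31797408, 42957669, 36639426, 42192075, 35894964,
    41364075, 36128244, 40851435, 36127515, 42198555, 6019920, 14263452, 6022836, 42959676,
    42966156, 42963996, 10738089, 36898797, 38079777, 36659019, 41390958, 38076195, 37839999,
    31885527, 31859283, 42622997, 38235774, 42737359, 13207214, 42796407, 13508290, 5474709,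
    5475357, 5474628, 41307276, 35960574, 38060094, 14276907, 37377750, 37941996, 36665436,
    42729996, 23200941, 31273158, 35996358, 40779408, 35996439, 41265561, 40839906, 40779417,
    35996448, 35996367]
  D := [
    246074057361, 132013979361, 156632004801, 260292784401, 259651848321, 132014018241,
    152342270721, 183723329601, 180921371121, 165514568481, 183933806481, 242630441361,
    244057065201, 280225458801, 281756008881, 261093582801, 260804543121, 225382297041,
    250994521521, 255806341281, 250719795441, 281988160641, 255806342721, 247233011121,
    278544422961, 247550783841, 278536924881, 213223587444, 213223193784, 226566155880,
    230007540501, 259325756289, 259406181027, 259406062929, 193116552210, 193116547908,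
    193116548070, 193116523131, 193116565323, 193116561039, 260100251794, 219017722689,
    219017728521, 219017781738, 219017786841, 169099788618, 219545864820, 250926924429,
    195138374013, 194975753067, 219383243874, 228408108931, 171387431451, 228561163939,
    166666472811, 228795529420, 230010403546, 224860534407, 277884439596, 224860332744,
    229806283626, 229806283212, 229806283275, 246683925631, 246684457072, 274629238956,
    246683374507, 274629239118, 259264952478, 259264951596, 259264951758, 242274006045,
    242273889405, 242274024594, 242274162375, 242274007827, 242274042090, 242274009285,
    260702726211, 260702823492, 260702671050, 260702821953]
  B := 830
  S := [
    218112946376, 218685423106, 219257899836, 218685420604, 219257897334, 219830374064,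
    218685420592, 219257897322, 219830374052, 196239873854596, 196715029541326, 197190185228056,
    197665340226716, 198140496601516, 198615652288246, 199093092367376, 199565963661706,
    293824436, 294514166, 295203896, 245307312026, 296583356, 296585016, 297962816, 8081362946576,
    8556518632476, 10455423950036, 15165806766, 15738282666, 204792676218226, 250743778826,
    247031632876, 247606176306, 206218716444046, 206693872130776, 207169027817506,
    207644183504236, 208119339190966, 208594494877696, 209069650564426, 209544806251156,
    210019961937886, 210495117624616, 210970273311346, 211445428998076, 211920584684806,
    212395740371536, 212870896058266, 213820634266096, 38466, 17354112288673626, 22808615160356,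
    18142870726580386, 22335751441436, 22810907128166, 19326006671179576, 19721807927502006,
    27079866119546, 24711525744176, 25186681430906, 41382426, 24053808044059956,
    24448187266113386, 32635310616, 22876843402756846, 24452933098213386, 29936520868016,
    25241691540939956, 25636070760926686, 26030449980913416, 33256892800146, 25637497945414576,
    31359704918586, 31838863109336, 33737768431046, 40357541806, 276794222736, 40644471146,
    37058140363176, 34689799298906, 331761246, 44649739066, 276507299206, 44361430266,
    277652253496, 45506382896, 158749475972914842068, 159411628695854550898,
    159738963923026747628, 159730298508767834358, 160384573160143299988, 160720967706211875618,
    161048295338337366288, 161375236186862053848, 161702578058198490888, 162029912810787487578,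
    162357247563377164038, 156792171421533171938, 157119506174122158668, 163003645085492661948,
    163330980796968447678, 163658315549545720618, 164312589716616908348, 164641106181410506378,
    164314561146148307878, 158428847081097654608, 164969230639890541338, 165295383691722368068,
    165622718432875614798, 165951234897657501528, 166277387949489328258, 166605904414271214988,
    161701011480763301718, 115451852017274548076928528, 139372261261537000115258,
    115676804981380020078832988, 198772342134949568, 94518479194799807322578127048,
    137471102200218642924608, 94892585477933796547952476338, 137744106872791773383988,
    170209336428430947268, 170536671181019929018, 138559170406738351035568,
    142088812769544266219808, 167593429031368754188, 167593418588246853618,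
    118834094321062100358915348, 119060947465773100191085328, 119285095816238832907888808,
    119512220644076644189875788, 144265586106012011069818, 209015282436198018, 209409659940823748,
    144534003759593628468938, 120188724030340497000800738, 174792023431836373468,
    118387705961647215660192178, 121090732578283567516178908, 172175712169596165638,
    121541734400400672862365368, 119289709605881426924352098, 143722540511171673467128,
    64622888071873, 65098043758603, 56003270699904953, 56397649919891683, 66523510818793,
    68420700774523, 81293761873, 67948982007403, 68424133565713, 68899289252443, 69374444939173,
    84156145523, 70324760441053, 85301098983, 71275067686093, 71750223372823, 61524579781785873,
    61918959001772603, 73177405791523, 73650850250653, 74126003873173, 74601159559903,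
    75076315246633, 75551470933363, 76026626620093, 76501782306823, 76976937993553,
    77452093680283, 77927251431223, 113808283, 78879276101473, 95607751803, 115879963,
    274165976887573, 277489205001593, 102182268953, 277016339221783, 277491494908513,
    277966650595243, 278441806281973, 69806073961629583, 70200453181618803, 85055725485533,
    70991109954429773, 71385487463875313, 86481764330233, 72174245899028963, 87432075703693,
    72961580594192233, 74537199134412643, 91702754878373, 92177915382423, 91231608587153,
    91706759454073, 91706760143803, 76902050704700533, 77299748579193353, 76508622943109913,
    79266898842202213, 95977445515263, 112209576973, 419357843, 422116763, 168833, 168003, 168833,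
    97883786139653, 142081403, 97408630452923, 82426681866984753, 81639347180779673,
    98834096825043, 84788207924083133, 85182587142003163, 85576966364056593, 85972294753213943,
    294597102388883, 101210162184713, 295547413762343, 105482274610863, 104535967815593,
    105010546898003, 297448035820363, 104537682495163, 105012838181893, 127091901933,
    127664376173, 187093, 187923, 129383878043, 89526929865842173, 157261273, 111657583179843,
    110712987615493, 109762959717743, 111663298299223, 443498393, 306477704402783,
    306475993176013, 306951148862743, 93470725496426493, 93865103000368303, 94259480504994033,
    307901460237863, 114515951916493, 95442618164954223, 95835577066032953, 98592906086540493,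
    256735165202540646, 206547055238810844236, 250429383238733106, 143417769929270544079530416,
    122214958882406889928578936896, 122777577144151534493359683876, 253591054297998676,
    258311734060345406, 215050266075527972136, 215053408775264968646, 215704935580705945596,
    216359210706663916556, 216359605085883903286, 216686939838472890016, 177138836857480970411126,
    177683521092283054827856, 177682212546775823249486, 147701737328425253338726216,
    147927238235942474393844346, 148152739151339665915077076, 148378240058059579168243806,
    125585516109949553573753563966, 182569972318424776125986, 182842317972898771211716,
    183113348007732214478446, 129716932069287, 131615837383527, 132089277706767, 132566148756987,
    188984727, 132090993070257, 133989900453687, 134466771503907, 134941927190637,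
    8793644823313920337743392084343622031314, 185294736221089371272,
    28771458166233365570554212587035706590269290561916,
    41876043203492047146620771216933540512255508, 182663706, 249638915350538925,
    225452154413714662100324924073014130920735009, 225585134897421422,
    73881802765186085963739476586182959, 107433214956117577620539233895, 225717006598045518,
    35639728382581584625059072813355,
    50257302829597564379890745277146291378083585462986526820104748163,
    8406957577624714640603260694215190159106253, 993343019122,
    35387579376721539348896353914689755069489581825, 42709363169152985352075219184310618941056501,
    16852432279168049592120151849529036647618122600434566051732,
    48256863129915280141325869487782633950540337584999581814539,
    185433787630633335621161884412513015700877423990027169413243, 69685325,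
    203110363165592029308148810037423794425072354704017959560, 334682330761, 107570408712,
    7037591159756495355649496233226614598922398129,
    3568159010364188825963710438592755389708342063712728803003,
    337270171612202609815356123397313677745161471118328851897998,
    1105320710368380008557089095720220584137132, 233079325725512593, 338967615341,
    2040859288842186913769006413499438000423, 341502369696, 140680990,
    194863665682584247799136707470382330546665773287867606574, 173856972,
    114595514327847861849485113425582235877874418729200, 479445920501467460811955115408397,
    89865047078737209170483157229673345257, 233642057326559595555077, 141108,
    259862996423846024201690727299391041393484198059676282439054368, 400895721467233,
    323204495381359194942221602, 1924350677, 37099113054631722369205366232937280122589701244,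
    53941508096658823004388902255466048617724, 1827270431111609741016,
    35272439233535224955751342344519537333266031402519523,
    115254967739672493527190113448841113216660432203609,
    456782321164333210187689904797954049359492394420,
    13712953157212734428549698566838656839048890158489, 242177823027647827,
    42204144442569857642589087495686, 292379492941289,
    88400636504887585545717597117744385530119513694313677178369876764, 324529362095268,
    353983742849, 332614770696162049203044673781680216171,
    128915905263811869344807803916696700617273, 5101656737063,
    12483815680875877245078928259909717055618892909998968693903540604,
    8613882878646461364572217771045320265038475579159944193864210570198219,
    547425294370431154966144014264206504213180299409321,
    232291330831421948851191411498992655383786081865113171861910030625,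
    2370544501971600471793646344395, 1178429387451851439153411902207509485853081,
    715965802039280581913676258170369123480776177329523, 100252986941,
    800276197791978211360245752435790631750446762565942,
    1014625676330943025880052028336331105963989932739,
    505795114563129578863498277902079679244051010672866420988747,
    365047358197404480357040719895940175661625701893389103005019683735,
    2041574520298291779318873730021103088188, 1671202810693734153572860461121,
    4676157782819667179537541630, 1219273, 4309304050696802219329819026912,
    7808082690645424722283, 39346352590285730334685806949485563531050969913, 173119097,
    307874563055032658136672978441463332003989766,
    770566178661617782180706342266695433095069330949660898065290,
    430258312286091050301167278753124924406819368, 3191663135236333,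
    2139362355098915067077856709944113395629387398, 1069029482624957954628935467920690921,
    2217680420853747606, 1328478347558990013633871658104878221183769728122274383,
    1979059111486221837370718859417086457466785161602,
    1684886617831777282803915894816695226410751422672273, 584554636844654219,
    1218799822658344767024795557060682988455298217955356130548,
    749053501322027799207823511222770770484408504398122, 101940726051293096601282168521031,
    802266591603732478866857908013366887527575334264027, 336850774058319203618539640945978764991,
    23064996984984979590085974352518717544849946859268025642, 1490, 225989327244078783688217,
    1437525775273, 244696400503277729339684367298248941321200831,
    644541223075577444122608532906112, 917161602864021957,
    83059248108778452023398195010346677769196382516049648123636956263361, 1902403008891869779409,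
    1500, 1070063935993933629955918267843289263, 1869861698255247173236373208,
    2928894647911156112103009183329016549431, 1864362823849084225197734811835,
    2578432407926704164549499422087055402333534, 3155113577094601267475265,
    5741311025270658000120857656641, 3372274917326982512207109145465581590727,
    117386209951768457851055343336735299179840272544717452207,
    5857466180781544290737322115293039621948, 1184420421297587877731482540144231577, 2491,
    601428056, 2442898897077707682500, 3601826344660630171087531563586991234200878963803,
    813180459704516373071533820909823711880112462809, 7056688143728731396718,
    3552995882650946033024330936, 584881362, 695889, 591790784, 1437037983392,
    1312106023165503162, 1546179487295785088261213327392673, 406289565939871, 800668785926599,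
    1198370082872137, 1145648510, 1144266227]

theorem certNine000_refutes : certNine000.Refutes 9 9 9 6 (sideNine 0 0 0) := by
  unfold Cert.Refutes; decide +kernel

/-- A refutation of `sideNine 1 1 1`. -/
def certNine111 : Cert where
  C := [
    36639336, 31998177, 31282938, 31870350, 31631409, 31572927, 31939857, 36652620, 30804075,
    30745737, 31573080, 31171401, 40838394, 31293621, 31262940, 31053312, 31290237, 40726785,
    32963292, 30804804, 31054041, 36641523, 36658875, 30758058, 41726883, 31172139, 41746566,
    31113090, 32176035, 32235813, 32017770, 41779434, 41779452, 40839123, 30568509, 33021612,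
    32116185, 30759588, 31901130, 31338900, 31276083, 42310893, 31953690, 31341996, 31272399,
    32175234, 32543451, 31585887, 33074892, 32213496, 41213676, 36653772, 32490171, 31172931,
    31112361, 40622700, 42198555, 32432571]
  D := [
    248080686723, 278058903921, 256851538191, 162824535639, 256851670068, 272583834021,
    255820674537, 272583716652, 256851670059, 167269614354, 163830592908, 250212503601,
    135666280053, 250011425808, 256851538839, 260698520701, 167311692801, 260727749956,
    250203235761, 167269542183, 248468107212, 255816088470, 256983132906, 167268006909,
    144033571953, 167269607793]
  B := 300
  S := [
    60921, 61821, 61221, 61521, 18872121, 18962121, 62421, 62721, 18958521, 67565, 67865,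
    18423923, 68166, 1746999058224, 69064, 67264, 69364, 1804158239427, 70265, 70265, 70865,
    6039780630, 21041464, 21130864, 72064, 20768133, 21582365, 6393492965, 19504661, 63120,
    1942401763866, 1917937148438, 65238, 590034910214165, 175535381225949040, 6583125366,
    6691485066, 1974450487242, 1982522587542, 179928886402870542, 181401539924686567,
    54418255351158848443, 607077067116943, 6149588850, 20589012, 6257768853, 6176498838,
    6203589140, 20769319, 246463283446487417726912731274165132605281277817538333483378, 6739, 441,
    12532796030176566546486280910104563219,
    91123910556153192901051981671085467844226117116873599724503938127695963142881333709500306487644431422312,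
    314744674654074879510762982930219222230491147911721,
    2035268816270098669986087849574647331406853103943268844103236793637234,
    70963665989092863415827585128861216104035141310029740182712618392945222135538915667039028450926487170882164100577472935,
    11296702531347632463350828473671094106400438914538285949138326778366072515266935702058703821336,
    97345093335410496636653185058658466021631682845661141866381962994502494403023402799612111953626231876836,
    485198722489384450963903514326,
    423415926186012056393535027687970431314192149349408623907458683380955970793405783733834,
    13005677030954772115975192665786180319,
    331806425420179341105117597657992860722780441929152770208268140663564011667704076075747704429841846905,
    3930216620617618000553317162009501382337,
    10940102911315130726234347718102538541576182906166344175975068259608252728905659332580747,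
    5152806040666935120576474716984025440379590129199773203941002703470228503985088943,
    1401906286984548, 79186837,
    1567283245337883359513065225977675550662953289376207598299933922973122085535149617492, 457,
    18847035627783744348749337563381775086626141398969653569313,
    3147825153178969689024327603072088672362652967169,
    135013309121428204022032230423117823968138519778018490914153060437221032668784759990154640,
    4855464242329319520953659832990564855716122135776131848910956303391412187062834535,
    235685770866630398715506860651222040405174923494031730248239011284859103219989538744191566197759204890169382633020657,
    425701689155017351, 648890407757529746, 864562135409197942, 27181145, 54271447,
    441854474501708824, 462273731292339114, 5963220493572008651754074]

theorem certNine111_refutes : certNine111.Refutes 9 9 9 6 (sideNine 1 1 1) := by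
  unfold Cert.Refutes; decide +kernel

/-- A refutation of `sideNine 1 2 2`. -/
def certNine122 : Cert where
  C := [
    30712212, 30795957]
  D := []
  B := 143
  S := [
    18734, 15208, 297445446, 300390245, 2203235, 71052368574978272974377315, 36470, 41056]

theorem certNine122_refutes : certNine122.Refutes 9 9 9 6 (sideNine 1 2 2) := by
  unfold Cert.Refutes; decide +kernel

/-- A refutation of `sideNine 1 2 3`. -/
def certNine123 : Cert where
  C := [
    30778479, 31309191]
  D := []
  B := 143
  S := [
    18449, 18592, 14600, 320948539, 155, 25099713778858, 25290328739539, 2980268]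

theorem certNine123_refutes : certNine123.Refutes 9 9 9 6 (sideNine 1 2 3) := by
  unfold Cert.Refutes; decide +kernel

/-- A refutation of `sideNine 2 2 2`. -/
def certNine222 : Cert where
  C := [
    37469439, 32710746, 31277178, 36133911, 32176053, 30810627, 35309007, 36013419, 31041711,
    32235102, 36794979, 37551087, 37548702, 30793617, 30795075, 31952250, 6014170, 30574431,
    10213128, 35350317, 36962136, 30814758, 30796452, 31043673, 30817827, 30518775, 36491850,
    36367713, 30814767, 36878949, 31050216, 31113072, 36677619, 36640566, 35308278, 31900410,
    30581631, 37266660, 35291268, 31573080, 36114957, 36658875, 30578553, 10206648, 13634568,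
    32769066, 35478171, 31344609, 6020650, 30523311, 32957532, 35584326, 41264841, 36639351,
    31164921, 32017770, 31346190, 35310951, 31050225, 40610298, 35949258, 36371646, 36114471,
    37403910, 36129159, 37332900, 31165578, 41140767, 37740501, 31165560, 36114228, 37528488,
    32483691, 30817116, 36639108, 35954379, 37548783, 36128079, 36639837, 31113090, 30794337,
    32175324, 30814749, 31105881, 37332180, 35822628, 32234292, 30582360, 30758778, 31345470,
    30515391, 31050945, 35868717, 30576933, 31046832, 30811266, 30633480, 30818556, 40609569,
    31166289, 35960409, 36115200, 35881677, 32549931, 31171410, 41200545, 31168323, 36101430,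
    31164930, 30801645, 31050954, 36931518, 37549413, 30800898, 38014605, 31346220, 30811995,
    30634119, 5489208, 36101349, 37935351, 36962334, 30522582, 30805434, 41207106, 31332945,
    30640680, 35295885, 35829801, 30793455, 36347508, 35826273, 30578571, 41141496]
  D := [
    163206116199, 277893884737, 278352343116, 172143181621, 172143182188, 278352343836,
    280938718800, 256803709230, 256803715062, 280957847760, 280629043021, 280955748240,
    256983947919, 256330407519, 276905106801, 277292527281, 256803892776, 275015423855,
    172142866531, 171780173550, 256803920640, 256273182900, 227936733157, 278352343197,
    275015423954, 172143183079, 175072804119, 278352344646, 172143169795, 172143181459,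
    250992481204, 256803715629, 136361837908, 261041899869, 227936732896, 280938777120,
    172143182350, 276605140312, 256803891480, 172143169957, 276605258410, 50162648844,
    174634782526, 153409811760, 171780322995, 165294046800, 240812348401, 256803721461,
    165294092160, 217179698572, 216404857594, 259802299359, 227936732905]
  B := 547
  S := [
    165246, 93218146, 170711, 157582, 171257, 94409511, 51806105845, 94712549, 95311514,
    15649018444812413, 165353, 165900, 172899, 15845260148973482, 167543, 168089, 181763,
    53609743718, 168730, 49851081355, 183951, 101004803, 101304559, 178923, 173012, 173558,
    174105, 170885, 103103096, 175747, 176294, 176841, 55908881549, 183307, 184948, 192159,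
    179578, 179140, 180673, 98321772, 180126, 57717895982, 182861, 105511447, 31747964294958,
    104612179, 58537731379, 192068, 109098222, 101319335, 101619091, 59357568416, 110297246,
    102518359, 102831243, 107006406, 109998585, 55913074494, 102517677, 9901815830218859291,
    57120986068, 759585703, 193808, 57223919894, 1252193118, 112698034, 107121369, 113297546,
    33993319014057, 58700922271, 60011057752, 115992616, 62464572647, 64274182745, 64438149824,
    113596676, 3220003741, 116295109, 59525737477, 19082354642546603, 111524177, 60668527224,
    120187563, 118093647, 61818875257, 36234257788386, 60836875696, 114808835, 121686893,
    115109139, 36682707752189, 9892675, 66899452911, 62636132176, 6170499320, 62964066334,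
    36504647773394, 67711223338, 22060, 117218998, 3913403006012, 36952598670257, 64498319831,
    118418022, 11110076538258347646, 4361852969813, 20408955888453659, 20409043777209880,
    69513964677, 70169625133, 69350896319, 29721, 38655887592912, 70832865915,
    10976435311698342877, 130093741, 5348442890176, 3428282535811992691088958, 5527822875697,
    122316496, 71980635470, 39463097527754, 35193, 36287, 72636503786, 124100810,
    11673633831889933153, 37314644865784, 6425109287789, 11646258385197037004,
    11405812160893770394, 11779949837333749309, 6783482774341, 6297669699745806295224, 126798619,
    128009677, 69193807367, 342613, 128416239,
    8723083385537840583630629988052527375082577564974476, 129026145,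
    38496308673742713440545665184897153904915135270456646684795094217990629814859,
    283793542237287352120833796297656955934948320832783595373627918368236612977817,
    1358325985667527394555323570513291444818431504763593913262289,
    1107546528486235296444836590247,
    986463456062132402143930445347889688109213479770900959141463381188438978487901067780279029027,
    958572135468779501847549893921237127622439,
    8376335218133650579868641967577550022723511030914312, 182434470468295958067075647643716527098,
    986463675309766491622284820614433441168276398097931767831248122888434252004083974967328873701,
    1810943621239845127663277883713790434870113458565531917377512027555679180957286303256081636,
    4613804161738237417888253806235860896421583263189593677,
    37145444601510511372772655280420055741987661967019777032205765400161771820216,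
    10888832821390937148443702707700403, 317732236534501463899447239825850581,
    29990206992252014304410584594849383382110758028,
    14081811451211268893870092116701253658249011708612390219356503987350056163655717324101281712684326,
    95345708959312953074017617311224267238208505329277888166630101990563674655634378731859514146436331074687,
    35833630976905175808096542584448511668277297378820055315332294,
    56231895262711310149572758975005661918780784,
    234201712982549778199818682623604319378839009916751982708649444141150,
    709509220840778391473406130854959699092421040375, 343840600165667780481554662837575366,
    1460283817724304752132840489663632047343468122939175369181989920670381306871641007814,
    21589652511849782597179583518762449454243002706808292738165914733480469906649988645639499981266262171584,
    249650583216944839104611019720725954208204336540043988213119205454524,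
    3854263657022307859535252, 1124320298958747352734770385508,
    6701180177710638574584621452467648209349937631561509373556745436002114955250520182358,
    7134069513676726251127,
    604880222585195071701562231352854400288684303212910808378239776846559588256980878983200942554478,
    2128907513981302720560608896298652727568700030988777558197892653365152842620716124048712350746632907279852506,
    2014038298477362060633039728376653028254244613496775169845252664385849962985841034828826412,
    9792832669537076113648258998776840076307028203207240241823391262643998412058,
    9934253379307662121332071573195682579083408595173196532574306815693941005565,
    5066297223966884076553421219256199119515837599939787472, 12854527796625011063,
    38799513381296348001413368280387108992264836302434986271501649378, 598713618534682700805,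
    3642409009862610892030913306982605304374822205734517785087389024476920141429,
    1069627592127312322498596858390197681279620694940011523401502533345223799986139562735982007484,
    3756254462997570552636325395461344177485379648950483144622644338010433567197310747431953,
    12579070145052411047114501522666210088659775088060612089088503999686397572467818026,
    560029300134008981209016035686555563556865220070458526820127132975810980511324262123849082547494070495003378257807276508893210573657326333017008133829280950568,
    1575761994531558956619812264474305690689605240619808835770709,
    619717256721541332228555280899533753111642157370389847083784387178749200770976038531186538033870,
    185799826085959155250164322019914382311378147589356663949718393643451171449065237243570166884002738466,
    924, 66806991144230863495666377833180,
    295915278131466494907000986498814275381495049687502526570204524634640396498164573468798983475,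
    249649641682612566046962375113417729827949349868709078354863741517493,
    5342002158076250306391654510260745662798743185352548004, 297347169288999039,
    1553649219692715243116153484444683048394135847448458713390951, 3918395116255636942578567,
    369457155119451802892325268950729837,
    134647214428710831623291257087495820611531036416127789332383290078577551853463679559759421599026287493239132360881543936971252446054431,
    318412821678564852,
    6373062575520998170699951419445999096456106792184558139757013566705668023789529646768067069941914917580106318745629059103732437425860896915642607127,
    13007569801097555379817189365763118337157539839574434609373665392574498843661079108,
    270050608880803925968442673403259764170336184685374085822244943051332179184172686333099115634806654802218004144544,
    104061566576787692608560923967867127205385902811764055803318375246633878528767981818157933528935294030446,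
    9334344021136675581727152370228335005186494076649704821204118591741018602464802165382818543614460942536819081737699,
    31256093480486016875386112012671345907297974975646296786287034592991709719610146497088532418230470734941557487,
    57249466496229326252228354479540050183313162776094170936721552462127147176406672165882895905937193663222000,
    2165332949244334248204473885,
    3692122247741942220014235030321704158001690132394453205160441151129414613143395005644914480284729478114413684149397651172391393209368539796582670023150,
    260010105675148288487916111048333093832519759692029257562119166949595,
    16832064683939219153270809400424087342919722916118507496364264347052656790541305866767856200502055509455767847680,
    5238805128466320343581179171802604343232379658158055369, 653186782402433901592734263313062,
    13341437812256349794,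
    257802155317545455474105969938534570120968997185543471881215721198819277000113822680837491835765352933770586342693985121244459460299,
    1278021341439400507533460452705,
    32168493292546331114039894854889901418839159068246164413657674902210760687798780592258211988334147463479865960,
    1486300539112378269959791533485241104138574543153058169848581679955692811883837978594122622305834291862955986303518960989945,
    62708406362480056817030476758920576176635439, 104014059593384259023028792265548,
    13084860825801027072789049928145940419208972632064262829299690536846240331159732273,
    2092829497092405489629669706310478105478800106018559521157876355903991382229755561355879324,
    42885916224098586807372374928944116717608554853828718419475544233375822186065, 563,
    10128209307373087298162568659676791425914150139692857,
    480920964402875826461301599643217629576704087706410651291207095932, 193455122166, 600075,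
    1318868252352477184009871229830]

theorem certNine222_refutes : certNine222.Refutes 9 9 9 6 (sideNine 2 2 2) := by
  unfold Cert.Refutes; decide +kernel

/-- A refutation of `sideNine 2 3 3`. -/
def certNine233 : Cert where
  C := [
    31302702, 30772719]
  D := []
  B := 141
  S := [
    18050, 2543783, 2042120, 3016843900880956930763, 152, 795514160]

theorem certNine233_refutes : certNine233.Refutes 9 9 9 6 (sideNine 2 3 3) := by
  unfold Cert.Refutes; decide +kernel

/-- A refutation of `sideNine 3 3 3`. -/
def certNine333 : Cert where
  C := [
    42216926, 37266660, 40252545, 10730071, 38134161, 42792390, 37746261, 37274580, 12984309,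
    38012832, 36338112, 38008701, 42522750, 37417473, 42205032, 41196609, 31046832, 37948923,
    41142150, 35422929, 42795522, 37332900, 42732684, 42857262, 31290957, 37804581, 41736150,
    36371079, 42801588, 42213573, 31164921, 31643802, 37416951, 37208340, 42741810, 41577228,
    37433799, 37418292, 38133360, 41154048, 40247991, 10736631, 30629502, 41667030, 31101975,
    37956294, 42640110, 42201981, 36426762, 40767687, 30639969, 41151087, 28674840, 42115554,
    40254552, 30633408, 38132631, 36794259, 13633848, 36990648, 40779351, 42204294, 42581070,
    41666292, 40328091, 40256091, 38015262, 35468937, 36338841, 42794784, 41383791, 36364275,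
    38126142, 30629511, 37417563, 42332067, 35409888, 40242888, 41735331, 31817853, 13515750,
    40306950, 41213835, 13680495, 41141412, 40779432, 37548693, 30523401, 41991309, 31277097,
    42205113, 42731892, 41667111, 38127600, 10205028, 35470395, 35348130, 42200532, 40254390,
    5481108, 38019312, 30634119, 41772087, 37955484, 30745656, 42201162, 41210856, 41240646,
    36677619, 30629583, 40610709, 42800130, 42795603, 37740501, 42739893, 42272613, 40589973,
    37408203, 40767768, 36358443, 35412552, 40786803, 36485289, 40786398, 42204708, 35823231,
    42201900, 36007578, 36134073, 42839253, 37462959, 31040901, 38008044, 31575825, 38014533,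
    42264081, 42200442, 40197447, 42303528, 30575070, 42852456, 30627558, 30575889, 42793488,
    30522267, 41149431, 35836677, 41142231, 41383845, 6014736, 31053708, 40145679, 40785669,
    30629520, 41377608, 35350839, 35469576, 38126799, 42798942, 35302203, 42323130, 41384169,
    40783986, 42735087]
  D := [
    135930277440, 135168930009, 261025253380, 261025252660, 135168910326, 278433251335,
    163801186992, 180792231039, 238770047206, 180470945601, 281605358675, 278041573504,
    250140980053, 250227073495, 188191457361, 244981636058, 213049471151, 184322062161,
    281528357905, 177348493359, 171780319675, 171544804804, 184704699681, 177731130879,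
    188151028479, 261025252669, 135076699359, 143334853074, 132448470408, 248472855208,
    280331512940, 163829530017, 187462179846, 215671132117, 261025252588, 259517134567,
    280610027857, 153099736227, 163232862561, 135887230719, 280283742299, 278433251344,
    280222607368, 174715912692, 261025252570, 249999144337, 281761618528, 188237020824,
    135076699278, 280246482380, 280595678950, 171932225293, 261025252579, 187978880961,
    215671132127, 281603350135, 281757940417, 182859207921, 180878324481, 281370519928,
    278271156016, 281772289324, 216871129622, 250949301814, 250184026774, 148466388159,
    163009957041, 188172561681]
  B := 615
  S := [
    134485801, 216540, 211620, 130698630, 212850, 129184111, 131838226, 210391, 81544764556,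
    228970, 82008854012, 32252214808428077, 31194899255459942, 231432, 232044, 32604701167516939,
    142445875, 220235, 221465, 32957187527740475, 233890, 33133430707284906, 235118, 143963078,
    87829739228, 85505544143, 88758661058, 145478437, 240652, 89461401880, 33924949100299195,
    32868492564011410, 231925, 243730, 34279009051640906, 55881513237776, 148888002,
    54305591872917, 88065388167, 229589, 151538654, 33750423032392214, 249885, 152674560,
    34014787803978211, 233280, 153811695, 35423016118493358, 93420294033, 145853113, 94351485214,
    236973, 95980900773, 95292153663, 95525139033, 56882662723733, 157600099, 146610773,
    35248492392915355, 241896, 259731, 243126, 35600976419878093, 60037535046892, 98787338272,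
    60324109322572, 246202, 22760662628762894657, 160632053, 248048, 100186017398, 153447623,
    36304665604655736, 36569173428509841, 164419225, 97848949027, 252356, 155720666, 165934586,
    62186147302765, 166692267, 273882, 101805945132, 256663, 63046564941538, 157974539, 276959,
    61469944988235, 160627913, 100181091151, 260972, 23358915524919915332, 63758115461162, 262818,
    39654859606372818, 173885928, 106242550323, 265278, 265893, 266508, 267123, 164814063, 268353,
    39213963931533462, 269584, 270199, 270814, 108097372489, 177299179, 166310503, 67345177562000,
    273890, 40008343394709830, 275120, 24712731799055744886, 110669308026, 110194257426, 296031,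
    111590664741, 171235450, 279427, 41769343481428932, 112300217918, 25904927210698597153,
    172374264, 173885934, 113233300224, 281889, 113699274654, 175023858, 113232169240, 284350,
    304645, 285580, 177315175, 176541505, 287425, 70640794593820, 308335, 289270,
    26121796019514613424, 26175990797223391589, 179193387, 9941409759582018961859145, 311413,
    292963, 69350279919077, 117416861099, 72790088799929, 43268842919017714, 43356964502744479,
    27422468821819721674, 27422468966501373244, 27476664029627817499, 73506524866744,
    73650741302794, 185633674, 186008824, 185256679, 70217454551749, 186014359,
    1694851321047118641241827668483333834883441049609445723872819735179449871074,
    1688378741252354456374929955225671648375613818822619232512989059871073698880,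
    134408955606008258216695874993985468570193425842758,
    219386018579388455094094998533660679140886606028, 17531520352785321118429,
    135438358663417672331980700292465044950125849770656, 17629942931445645358672,
    135956405113822956329958687080813066743847268565143,
    21575873775445004848318535850680545196151882511263239826461392078765897480206245369294223582725410822,
    274112234852926988471260085360577811104178498987206558017747930563160194805594819487365321012209916236429401319192227522348724,
    1180639043216802325684759169433635342151956487220900078825935556812847572527937063158929078808642699127826909524374604,
    252273,
    5047244380247775434722526922714115505761857010029685355635494235381475164630017827230912915406317222696632573,
    104346, 37330934547015927800781, 224004350565230734902831638867095407387531267716,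
    207086048079876858, 366274313136308658186796084285833705383790406,
    115010926642590797369479131890814022484426953651530733359012474856029644684894894105128472665825133482906605441598078063870690734925449727400817542077272730123187868498679,
    5132852979482446800276282762712164445405160392581152545753959714680373109601988969468087813827620357549214953,
    10557177057732259846665983,
    92405434685801876167579383136207174887935953437103521721095856068347682209905839965474086812,
    232128136282858951930580089738475029299143007791115324014, 18164626052949528535763,
    165117316006423024963051180678490670251770005266163217673736408437276673304882808382474226220636362008454908319166538248875304191,
    1869605731070788933745202566166836625840873642583303485108987595734865731034520384784703843109798579394463639485886,
    939634408593647619175276593948431710324, 2489094512492030233245238001958440,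
    672960020883336693770080662645400426876891643166097465467380302206189719896834228,
    1795492522544581185177580185439176728455035338539404950123283342359420169217,
    7288621430335905695232016928572080413915953548508708922968036193003,
    25110919034237009255366674841163070645313562566138966783705394374340161831739722008417700529543483683102665910660868479091426634813385088133,
    5851534539685991132954303117151961297484896362471528423575057435738339051169434314998647433784160523421557760578268548886101605724387951611827221069,
    358773700974638984596505565775093443521732945,
    1104250613364470447634204711219242476374949145155899863620604534449727365456286,
    285436766816061973784155412973178385879541115063181646501938904852893108355231384313281576162798882394378339332800262203584559,
    54056134417611764968638000317123424132524125300146395579,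
    4542592921178863825420326809856597212971254255614233075707414826517265,
    1013472628712782524810465738370405438895, 84531190640278557049809285228129008,
    36683192911518415590297376499978258115986552274211091314169093213924402572791391,
    236583225629936563923109945973741345471527701732,
    22963306525846618035440248095508161189042494140475352807704507093285569062945653223309893301314667139,
    1844189698929810980957863698153496188466912143443982339401684792627860957561,
    2712925365223586853452177487546564,
    2982818232810639448790034994009370902795745312389387013837207315341692196,
    37209165145048676418759253180820327198902084817115819416992556162961188313781332294657427239937785,
    12936978254127876627440405014831440865629130913765282157861043011, 1941318934788408275,
    161678777455166215683101699388144674773275752955108313659064219064950279917369896679543562,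
    2038429321083621899782220291331942950775055513250958114110640700421654935926343303335155836920466917669931552705192,
    1136186491148885489955223062496538336040080599139753113728389880196809284453885,
    3332075537720516992755762688624137853686496666555556793494030485275879702634411977203646209064787790117697582272,
    1680159097749513943185934930919343335, 31214004109180817366,
    295204180317983082310567415122525994622895978016802592608878895915664101412558517498223483188008381501768274973837016988111266,
    657, 1318684237456775066147619034356355170096499, 4395832515750465419889276210672,
    21294138308147400406352077345056771206156517300176365394559058,
    1405095585377130129337357711220854834739612521335894501897709534479638497924408919293677,
    1851152447821820963119874143069231627115640849475702874226329208549516282434, 1568780065,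
    2705421967632019862, 1680620930040213637304667343859274139,
    1166041095903078293624791600167068738934080588569531789662841009435784698829703,
    36943292839828309635782993164573870616866219033204109096732815173635217740631209405638082062799410,
    13390875480065054123309880483345257421568367427808783779307145870,
    1892855721706186296735078545673682290061072222617685589222587067153902694249,
    13481512270036072786635770109629482473508092306569497825625449861, 727, 1333, 172655201069925,
    472063099, 239418206, 472405421,
    5107768839954692222850740037146271507923263635413741851046854818118658,
    195939891121587303996255858349021298, 51901767614321410,
    667655716057025613278692444676327780487773, 617, 92430490950091813361441574260, 379478,
    259229010502649, 132071541583952045378, 353193489668880, 271411199957404130, 3266,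
    33493604035087303928]

theorem certNine333_refutes : certNine333.Refutes 9 9 9 6 (sideNine 3 3 3) := by
  unfold Cert.Refutes; decide +kernel

/-- A refutation of `sidePair`. -/
def certPair : Cert where
  C := [
    7999632, 5041792, 4724936, 7873232, 5116544, 12267657, 5902976, 7114896, 10203777, 12300929,
    5935240, 2714816, 4758208, 8069824, 2878657, 5972040, 12202121, 8032896, 6005312, 7213696,
    8000128, 7117696, 7870664, 6009408, 4746440, 8102464, 4766272, 7115152, 2845248, 6862912,
    7879240, 5020544, 2517696, 5148808, 10171009, 6822600, 4745800, 7245960, 8073856, 2551424,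
    2518656, 4746952, 8106624, 9236097, 5976640, 4725640, 6853008, 6820560, 3140736, 2518144,
    7869072, 7070272, 4725128]
  D := []
  B := 545
  S := [
    42008, 42550, 43095, 46364, 44184, 47454, 47999, 48544, 13786465554, 46909, 51269, 26188924,
    48544, 26784064, 29158084, 27379204, 29162989, 55083, 14111713378, 14109630933,
    4287606649104268, 14597350888, 2362805978288495408, 8043294486898, 4480288026586498,
    8309424432068, 28277363, 8396838594178, 9633914449574, 15407635634, 4625240914535889, 57864,
    4865651231840860, 4865916098180640, 2625431091670451210, 8927479701540, 5058420865846465,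
    60594, 5106768021267866, 10164556750021, 5251102532631046, 2972831,
    344305600050015890793349980237050791263989542691180945288025,
    669274767215122158962700174510158206514233356630139988764, 475982887137450571883074181,
    350153931965804078114331276939986417426125958389839437773261,
    4035020106822712006760465378518616486609188698001,
    604147054802300791181413616782702192148891646719040840466,
    85990964981573479014364929444083354, 14809586327000348933612197066159466842889769,
    789683352294429615863022636893584382747634394,
    2109279901780931353294388802650536923785708699546530, 1091,
    399074736823850197811438320084766883959071514612738296378632,
    94916633520584367724140333729666583, 45368117441366921860401909696611879555, 892166,
    441335296047, 5500794510608644500525363136863306687856127600024078120399153101289026388805928,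
    6966327817456388516348558167, 1486216, 661,
    233373385273237351506426988976914823004178589700477394827290346,
    55482999634481178865800257404169719699, 89519480418, 177905507237, 162475975]

theorem certPair_refutes : certPair.Refutes 7 8 8 8 sidePair := by
  unfold Cert.Refutes; decide +kernel

end Refute

open Finset Function

theorem HasC.comap {α β α' β' : Type*} {k : ℕ} {h : α → β → Prop} {f : α' → α} {g : β' → β}
    (hf : f.Injective) (hg : g.Injective) (hc : HasC k fun i j => h (f i) (g j)) : HasC k h := by
  obtain ⟨r, c, hr, hc, H⟩ := hc
  exact ⟨f ∘ r, g ∘ c, hf.comp hr, hg.comp hc, H⟩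

theorem HasC.mono {α β : Type*} {k : ℕ} {h h' : α → β → Prop} (hh : ∀ a b, h a b → h' a b)
    (hc : HasC k h) : HasC k h' := by
  obtain ⟨r, c, hr, hc, H⟩ := hc
  exact ⟨r, c, hr, hc, fun i => ⟨hh _ _ (H i).1, hh _ _ (H i).2⟩⟩

theorem HasC.swap {α β : Type*} {k : ℕ} {h : α → β → Prop} (hc : HasC k h) :
    HasC k (flip h) := by
  obtain ⟨r, c, hr, hc, H⟩ := hc
  exact ⟨c, r ∘ finRotate k, hc, hr.comp (finRotate k).injective, fun i =>
    ⟨(H i).2, (H _).1⟩⟩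

theorem finRotate_val {m : ℕ} (i : Fin m) :
    (finRotate m i : ℕ) = if (i : ℕ) + 1 < m then (i : ℕ) + 1 else 0 := by
  cases m with
  | zero => exact i.elim0
  | succ n =>
    rw [finRotate_apply]
    split_ifs with hi
    · exact Fin.val_add_one_of_lt (by simpa [Fin.lt_def] using hi)
    · have : i = Fin.last _ := by
        ext; have := i.2; simp at hi this ⊢; omega
      subst this; simp

theorem HasC.of_nat {α β : Type*} {h : α → β → Prop} {m : ℕ} {r : ℕ → α} {c : ℕ → β}
    (hr : Set.InjOn r (Set.Iio m)) (hc : Set.InjOn c (Set.Iio m)) (h₁ : ∀ t < m, h (r t) (c t))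
    (h₂ : ∀ t, t + 1 < m → h (r (t + 1)) (c t)) (h₃ : h (r 0) (c (m - 1))) : HasC m h := by
  refine ⟨fun i => r i, fun i => c i, fun i j hij => Fin.ext (hr i.2 j.2 hij),
    fun i j hij => Fin.ext (hc i.2 j.2 hij), fun i => ⟨h₁ i i.2, ?_⟩⟩
  dsimp only
  rw [finRotate_val]
  split_ifs with hi
  · exact h₂ i hi
  · rw [show (i : ℕ) = m - 1 by omega]; exact h₃

open Classical in
theorem HasC.close_aux {α β : Type*} [Fintype α] [Fintype β] {m : ℕ} (hα : Fintype.card α = m)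
    (hβ : Fintype.card β = m) {E : α → β → Prop} {x : α} {y : β}
    {r : Fin m → α} {c : Fin m → β} (hr : r.Injective) (hc : c.Injective)
    (he : ∀ i, (E (r i) (c i) ∨ (r i = x ∧ c i = y)) ∧
      (E (r (finRotate m i)) (c i) ∨ (r (finRotate m i) = x ∧ c i = y)))
    {i : Fin m} (hx : r (finRotate m i) = x) (hy : c i = y)
    (hd : m < #{b | E x b} + #{a | E a y}) : HasC m E := by
  obtain ⟨n, rfl⟩ : ∃ n, m = n + 1 := ⟨m - 1, by have := i.2; omega⟩
  by_cases hE : E x y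
  · refine ⟨r, c, hr, hc, fun j => ⟨?_, ?_⟩⟩
    · obtain h | ⟨rfl, rfl⟩ := (he j).1
      exacts [h, hE]
    · obtain h | ⟨h1, h2⟩ := (he j).2
      exacts [h, h1 ▸ h2 ▸ hE]
  set R : ℕ → α := fun t => r (Fin.ofNat (n + 1) t + (i + 1)) with hR
  set C : ℕ → β := fun t => c (Fin.ofNat (n + 1) t + (i + 1)) with hC
  have inj : ∀ s < n + 1, ∀ t < n + 1, Fin.ofNat (n + 1) s + (i + 1) = Fin.ofNat (n + 1) t + (i + 1)
      → s = t := fun s hs t ht h => by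
    have := congrArg Fin.val (add_right_cancel h)
    simpa [Fin.ofNat, Nat.mod_eq_of_lt hs, Nat.mod_eq_of_lt ht] using this
  have injR : ∀ s < n + 1, ∀ t < n + 1, R s = R t → s = t := fun s hs t ht h =>
    inj s hs t ht (hr h)
  have injC : ∀ s < n + 1, ∀ t < n + 1, C s = C t → s = t := fun s hs t ht h =>
    inj s hs t ht (hc h)
  have hlast : Fin.ofNat (n + 1) n + (i + 1) = i := by
    have : Fin.ofNat (n + 1) n = Fin.last n := by ext; simp [Fin.ofNat]
    rw [this, add_comm i 1, ← add_assoc]; simp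
  have hx0 : R 0 = x := by simpa [hR, Fin.ofNat, finRotate_apply] using hx
  have hyn : C n = y := by simp only [hC, hlast, hy]
  have e₁ : ∀ t < n + 1, E (R t) (C t) := fun t ht => by
    obtain h | ⟨h1, h2⟩ := (he (Fin.ofNat (n + 1) t + (i + 1))).1
    · exact h
    · have a := injR t ht 0 (by omega) (h1.trans hx0.symm)
      have b := injC t ht n (by omega) (h2.trans hyn.symm)
      exfalso
      obtain rfl : n = 0 := by omega
      have hb : ∀ b, b = y := fun b => by
        have := (Fintype.card_le_one_iff_subsingleton (α := β)).1 (by omega)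
        exact Subsingleton.elim _ _
      have ha : ∀ b, b = x := fun b => by
        have := (Fintype.card_le_one_iff_subsingleton (α := α)).1 (by omega)
        exact Subsingleton.elim _ _
      have h1 : #{b | E x b} = 0 := by
        rw [card_eq_zero, filter_eq_empty_iff]; intro b _; rw [hb b]; exact hE
      have h2 : #{b | E b y} = 0 := by
        rw [card_eq_zero, filter_eq_empty_iff]; intro b _; rw [ha b]; exact hE
      omega
  have e₂ : ∀ t, t + 1 < n + 1 → E (R (t + 1)) (C t) := fun t ht => by
    have hrot : finRotate (n + 1) (Fin.ofNat (n + 1) t + (i + 1)) =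
        Fin.ofNat (n + 1) (t + 1) + (i + 1) := by
      rw [finRotate_apply, add_right_comm]
      congr 1
      ext; simp [Fin.ofNat, Fin.val_add]
    obtain h | ⟨h1, h2⟩ := (he (Fin.ofNat (n + 1) t + (i + 1))).2
    · rwa [hrot] at h
    · have := injC t (by omega) n (by omega) (h2.trans hyn.symm)
      omega
  have bR : ∀ a, ∃ t < n + 1, R t = a := fun a => by
    obtain ⟨j, rfl⟩ := ((Fintype.bijective_iff_injective_and_card r).2 ⟨hr, by simp [hα]⟩).2 a
    refine ⟨(j - (i + 1) : Fin (n + 1)), Fin.is_lt _, ?_⟩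
    simp [hR]
  have bC : ∀ a, ∃ t < n + 1, C t = a := fun a => by
    obtain ⟨j, rfl⟩ := ((Fintype.bijective_iff_injective_and_card c).2 ⟨hc, by simp [hβ]⟩).2 a
    refine ⟨(j - (i + 1) : Fin (n + 1)), Fin.is_lt _, ?_⟩
    simp [hC]
  clear_value R C
  obtain ⟨j, hj, hj1, hj2⟩ : ∃ j < n + 1, E x (C j) ∧ E (R j) y := by
    by_contra! hcon
    have h1 : #{b | E x b} ≤ #{j ∈ range (n + 1) | E x (C j)} := by
      refine card_le_card_of_surjOn C fun b hb => ?_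
      obtain ⟨t, ht, rfl⟩ := bC b
      refine ⟨t, ?_, rfl⟩
      simp only [coe_filter, mem_range, Set.mem_ofPred_eq, ht, true_and]
      simpa using hb
    have h2 : #{a | E a y} ≤ #{j ∈ range (n + 1) | ¬ E x (C j)} := by
      refine card_le_card_of_surjOn R fun b hb => ?_
      obtain ⟨t, ht, rfl⟩ := bR b
      refine ⟨t, ?_, rfl⟩
      simp only [coe_filter, mem_range, Set.mem_ofPred_eq, ht, true_and]
      exact fun h => hcon t ht h (by simpa using hb)
    have := card_filter_add_card_filter_not (s := range (n + 1)) (fun j => E x (C j))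
    simp only [card_range] at this
    omega
  refine HasC.of_nat (r := fun t => if t < n - j then R (j + 1 + t) else R (n - t))
    (c := fun t => if t < n - j then C (j + 1 + t) else if t < n then C (n - 1 - t) else C j)
    ?_ ?_ ?_ ?_ ?_
  · intro s hs t ht h
    simp only [Set.mem_Iio] at hs ht
    dsimp only at h
    split_ifs at h <;> have := injR _ (by omega) _ (by omega) h <;> omega
  · intro s hs t ht h
    simp only [Set.mem_Iio] at hs ht
    dsimp only at h
    split_ifs at h <;> have := injC _ (by omega) _ (by omega) h <;> omega
  · intro t ht
    split_ifs with h1 h2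
    · exact e₁ _ (by omega)
    · have := e₂ (n - 1 - t) (by omega)
      rwa [show n - 1 - t + 1 = n - t by omega] at this
    · rw [show n - t = 0 by omega, hx0]; exact hj1
  · intro t ht
    split_ifs with h1 h2 h3 h4
    · have := e₂ (j + 1 + t) (by omega)
      rwa [show j + 1 + t + 1 = j + 1 + (t + 1) by omega] at this
    · omega
    · omega
    · rw [show j + 1 + t = n by omega, hyn, show n - (t + 1) = j by omega]; exact hj2
    · have := e₁ (n - 1 - t) (by omega)
      rwa [show n - (t + 1) = n - 1 - t by omega]
    · omega
  · split_ifs with h1 h2 h3 h4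
    · omega
    · omega
    · exact e₂ _ (by omega)
    · omega
    · omega
    · have := e₁ j (by omega)
      rwa [show n - 0 = j by omega]

open Classical in
/-- Adding an edge between vertices with large degree sum does not create a Hamiltonian cycle. -/
theorem HasC.close {α β : Type*} [Fintype α] [Fintype β] {m : ℕ} (hα : Fintype.card α = m)
    (hβ : Fintype.card β = m) {E : α → β → Prop} {x : α} {y : β}
    (h : HasC m fun a b => E a b ∨ (a = x ∧ b = y)) (hd : m < #{b | E x b} + #{a | E a y}) :
    HasC m E := by
  obtain ⟨r, c, hr, hc, he⟩ := h
  by_cases h1 : ∃ i, r (finRotate m i) = x ∧ c i = y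
  · obtain ⟨i, hi, hi'⟩ := h1
    exact HasC.close_aux hα hβ hr hc he hi hi' hd
  by_cases h2 : ∃ i, r i = x ∧ c i = y
  · obtain ⟨i, hi, hi'⟩ := h2
    refine (HasC.close_aux hβ hα (E := flip E) (x := y) (y := x) (r := c) (c := r ∘ finRotate m)
      (i := (finRotate m).symm i) hc (hr.comp (finRotate m).injective) (fun j => ?_)
      ((congrArg c (Equiv.apply_symm_apply _ i)).trans hi')
      ((congrArg r (Equiv.apply_symm_apply _ i)).trans hi) (by rw [add_comm]; exact hd)).swap
    exact ⟨(he j).2.imp id And.symm, (he _).1.imp id And.symm⟩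
  · push Not at h1 h2
    exact ⟨r, c, hr, hc, fun i => ⟨(he i).1.resolve_right fun h => h2 i h.1 h.2,
      (he i).2.resolve_right fun h => h1 i h.1 h.2⟩⟩

open Classical in
theorem exists_core_fintype {α β : Type*} [Fintype α] [Fintype β] {m : ℕ}
    (hα : Fintype.card α = m) (hβ : Fintype.card β = m) {H : α → β → Prop}
    (hH : ¬ HasC m fun a b => ¬ H a b) : ∃ K : α → β → Prop, (∀ a b, K a b → H a b) ∧
      (∃ a b, K a b) ∧ ∀ a b, K a b → m ≤ #{b | K a b} + #{a | K a b} := by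
  obtain ⟨E, hE, hmax⟩ := Finite.exists_le_maximal (p := fun E : α → β → Prop => ¬ HasC m E) hH
  obtain ⟨K, hK⟩ : ∃ K : α → β → Prop, ∀ a b, K a b ↔ ¬ E a b := ⟨fun a b => ¬ E a b, by simp⟩
  refine ⟨K, fun a b h => ?_, ?_, fun x y hxy => ?_⟩
  · by_contra h'
    exact (hK a b).1 h (hE a b h')
  · by_contra! hcon
    refine hmax.1 ?_
    have e₁ := Fintype.equivFinOfCardEq hα
    have e₂ := Fintype.equivFinOfCardEq hβ
    exact ⟨e₁.symm, e₂.symm, e₁.symm.injective, e₂.symm.injective,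
      fun i => ⟨not_not.1 (mt (hK _ _).2 (hcon _ _)), not_not.1 (mt (hK _ _).2 (hcon _ _))⟩⟩
  · have h1 : HasC m fun a b => E a b ∨ (a = x ∧ b = y) := by
      by_contra hcon
      exact (hK x y).1 hxy (hmax.2 hcon (fun a b h => Or.inl h) x y (Or.inr ⟨rfl, rfl⟩))
    have h2 : ¬ (m < #{b | E x b} + #{a | E a y}) := fun hd => hmax.1 (h1.close hα hβ hd)
    have h3 := card_filter_add_card_filter_not (s := (univ : Finset β)) (fun b => K x b)
    have h4 := card_filter_add_card_filter_not (s := (univ : Finset α)) (fun a => K a y)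
    simp only [card_univ, hα, hβ, hK, not_not] at h3 h4 ⊢
    omega

open Classical in
/-- If the complement of `H` has no Hamiltonian cycle on `L` and `R`, then `H` contains a graph
in which the degree sums of edges are large. -/
theorem exists_core {α β : Type*} {m : ℕ} {L : Finset α} {R : Finset β}
    (hL : #L = m) (hR : #R = m) {H : α → β → Prop} (hH : ¬ HasC m fun a b => ¬ H a b) :
    ∃ K : α → β → Prop, (∀ a b, K a b → a ∈ L ∧ b ∈ R ∧ H a b) ∧ (∃ a b, K a b) ∧
      ∀ a b, K a b → m ≤ #{b ∈ R | K a b} + #{a ∈ L | K a b} := by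
  obtain ⟨K, hK, ⟨a, b, hab⟩, hd⟩ := exists_core_fintype (α := L) (β := R) (by simpa) (by simpa)
    (H := fun a b => H a b) fun h => hH (HasC.comap Subtype.val_injective Subtype.val_injective h)
  refine ⟨fun a b => ∃ (ha : a ∈ L) (hb : b ∈ R), K ⟨a, ha⟩ ⟨b, hb⟩, ?_, ⟨a, b, a.2, b.2, hab⟩, ?_⟩
  · rintro a b ⟨ha, hb, h⟩
    exact ⟨ha, hb, hK _ _ h⟩
  · rintro a b ⟨ha, hb, h⟩
    refine (hd _ _ h).trans (add_le_add ?_ ?_)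
    · refine card_le_card_of_injOn Subtype.val (fun y hy => ?_) Subtype.val_injective.injOn
      simp only [coe_filter, mem_univ, true_and, Set.mem_ofPred_eq] at hy
      simpa [ha] using hy
    · refine card_le_card_of_injOn Subtype.val (fun y hy => ?_) Subtype.val_injective.injOn
      simp only [coe_filter, mem_univ, true_and, Set.mem_ofPred_eq] at hy
      simpa [hb] using hy

/-- The members of `R` adjacent to `a`. -/
noncomputable def nb {α β : Type*} (H : α → β → Prop) (R : Finset β) (a : α) : Finset β :=
  open Classical in {b ∈ R | H a b}

section
variable {α β : Type*} {H : α → β → Prop}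

@[simp] theorem mem_nb {R : Finset β} {a : α} {b : β} : b ∈ nb H R a ↔ b ∈ R ∧ H a b := by
  simp [nb]

theorem nb_subset {R : Finset β} {a : α} : nb H R a ⊆ R := fun _ h => (mem_nb.1 h).1

theorem sum_card_nb (L : Finset α) (R : Finset β) :
    ∑ a ∈ L, #(nb H R a) = ∑ b ∈ R, #(nb (flip H) L b) := by
  classical
  convert sum_card_bipartiteAbove_eq_sum_card_bipartiteBelow (s := L) (t := R) H using 3 <;>
    ext <;> simp [bipartiteAbove, bipartiteBelow, flip]

theorem le_of_minimal_sum {m : ℕ} {f : α → ℕ} {s : Finset α} (hs : #s = m)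
    (h : ∀ t, #t = m → ∑ x ∈ s, f x ≤ ∑ x ∈ t, f x) : ∀ x ∈ s, ∀ a ∉ s, f x ≤ f a := by
  classical
  intro x hx a ha
  have h1 := h (insert a (s.erase x)) (by
    rw [card_insert_of_notMem (fun h => ha (mem_of_mem_erase h)), card_erase_add_one hx, hs])
  rw [sum_insert (fun h => ha (mem_of_mem_erase h)), ← add_sum_erase s f hx] at h1
  omega

open Classical in
/-- Subsets of the sides that span the least number of edges. -/
theorem exists_extremal [Fintype α] [Fintype β] (H : α → β → Prop) {m : ℕ}
    (hα : m ≤ Fintype.card α) (hβ : m ≤ Fintype.card β) : ∃ (L : Finset α) (R : Finset β),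
      #L = m ∧ #R = m ∧ (∀ x ∈ L, ∀ a ∉ L, #(nb H R x) ≤ #(nb H R a)) ∧
      ∀ y ∈ R, ∀ b ∉ R, #(nb (flip H) L y) ≤ #(nb (flip H) L b) := by
  obtain ⟨⟨L, R⟩, hLR, hmin⟩ := exists_min_image
    (powersetCard m (univ : Finset α) ×ˢ powersetCard m (univ : Finset β))
    (fun p => ∑ a ∈ p.1, #(nb H p.2 a)) ((powersetCard_nonempty.2 (by simpa using hα)).product
      (powersetCard_nonempty.2 (by simpa using hβ)))
  obtain ⟨hL, hR⟩ := mem_product.1 hLR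
  replace hL := (mem_powersetCard.1 hL).2
  replace hR := (mem_powersetCard.1 hR).2
  refine ⟨L, R, hL, hR, le_of_minimal_sum hL fun t ht => hmin (t, R) ?_,
    le_of_minimal_sum hR fun t ht => ?_⟩
  · simp_all [mem_powersetCard]
  · rw [← sum_card_nb, ← sum_card_nb]
    exact hmin (L, t) (by simp_all [mem_powersetCard])

open Classical in
/-- Enumeration of a finite set in the order of a function. -/
theorem exists_enum [Nonempty β] (U : Finset β) (key : β → ℕ) : ∃ f : ℕ → β,
    Set.InjOn f (Set.Iio #U) ∧ (∀ i < #U, f i ∈ U) ∧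
    ∀ k, ∀ i < #U, key (f i) ≤ k ↔ i < #{x ∈ U | key x ≤ k} := by
  set e := U.equivFin.symm
  set σ := Tuple.sort fun i => key (e i)
  have hm : Monotone ((fun i => key (e i)) ∘ σ) := Tuple.monotone_sort _
  set g : Fin #U → β := fun i => e (σ i) with hg
  have gi : g.Injective := Subtype.val_injective.comp (e.injective.comp σ.injective)
  have gU : ∀ i, g i ∈ U := fun i => (e (σ i)).2
  refine ⟨fun i => if h : i < #U then g ⟨i, h⟩ else Classical.arbitrary β, ?_, ?_, ?_⟩
  · intro i hi j hj h
    simp only [Set.mem_Iio] at hi hj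
    simpa [hi, hj, gi.eq_iff] using h
  · intro i hi
    simpa [hi] using gU _
  · intro k i hi
    simp only [hi, dif_pos]
    have hc : #{x ∈ U | key x ≤ k} = #({i | key (g i) ≤ k} : Finset (Fin #U)) := by
      rw [← card_image_of_injective _ gi]
      congr 1
      ext x
      simp only [mem_filter, mem_image, mem_univ, true_and]
      constructor
      · rintro ⟨hx, hk⟩
        refine ⟨σ.symm (e.symm ⟨x, hx⟩), ?_, ?_⟩ <;> simp [hg, hk]
      · rintro ⟨j, hj, rfl⟩
        exact ⟨gU j, hj⟩
    rw [hc]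
    constructor
    · intro h
      have : (univ : Finset (Fin (i + 1))).map (Fin.castLEEmb hi) ⊆
          ({i | key (g i) ≤ k} : Finset (Fin #U)) := by
        intro j hj
        simp only [mem_map, mem_univ, true_and] at hj
        obtain ⟨j, rfl⟩ := hj
        simp only [mem_filter, mem_univ, true_and]
        refine (hm ?_).trans h
        rw [Fin.le_def]; simp; omega
      simpa using card_le_card this
    · intro h
      by_contra hk
      have : ({i | key (g i) ≤ k} : Finset (Fin #U)) ⊆
          (univ : Finset (Fin i)).map (Fin.castLEEmb hi.le) := by
        intro j hj
        simp only [mem_filter, mem_univ, true_and] at hj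
        simp only [mem_map, mem_univ, true_and]
        have : (j : ℕ) < i := by
          by_contra hij
          exact hk ((hm (show (⟨i, hi⟩ : Fin #U) ≤ j by rw [Fin.le_def]; simp; omega)).trans hj)
        exact ⟨⟨j, this⟩, rfl⟩
      have := card_le_card this
      simp at this
      omega

namespace Refute

theorem holds_nil {h : ℕ → ℕ → Prop} : Holds h [] := by simp [Holds]

theorem holds_append {h : ℕ → ℕ → Prop} {s t : List Clause} :
    Holds h (s ++ t) ↔ Holds h s ∧ Holds h t := by
  simp only [Holds, List.mem_append, or_imp, forall_and]

theorem holds_flatMap {h : ℕ → ℕ → Prop} {ι : Type*} {l : List ι} {f : ι → List Clause} :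
    Holds h (l.flatMap f) ↔ ∀ i ∈ l, Holds h (f i) := by
  simp only [Holds, List.mem_flatMap]
  exact ⟨fun H i hi p hp => H p ⟨i, hi, hp⟩, fun H p ⟨i, hi, hp⟩ => H i hi p hp⟩

theorem holds_map {h : ℕ → ℕ → Prop} {ι : Type*} {l : List ι} {f : ι → Clause} :
    Holds h (l.map f) ↔ ∀ i ∈ l, (∃ e ∈ (f i).1, h e.1 e.2) ∨ ∃ e ∈ (f i).2, ¬ h e.1 e.2 := by
  simp [Holds]

theorem holds_ones {h : ℕ → ℕ → Prop} {l : List (ℕ × ℕ)} :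
    Holds h (ones l) ↔ ∀ e ∈ l, h e.1 e.2 := by simp [ones, holds_map]

theorem holds_zeros {h : ℕ → ℕ → Prop} {l : List (ℕ × ℕ)} :
    Holds h (zeros l) ↔ ∀ e ∈ l, ¬ h e.1 e.2 := by simp [zeros, holds_map]

theorem holds_imp {h : ℕ → ℕ → Prop} {A B : List (ℕ × ℕ)} :
    Holds h (imp A B) ↔ ∀ e ∈ B, h e.1 e.2 → ∃ e ∈ A, h e.1 e.2 := by
  simp only [imp, holds_map, List.mem_singleton, exists_eq_left]
  exact forall₂_congr fun e _ => by rw [or_comm, ← imp_iff_not_or]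

theorem mem_rect {R C : List ℕ} {e : ℕ × ℕ} : e ∈ rect R C ↔ e.1 ∈ R ∧ e.2 ∈ C := by
  obtain ⟨r, c⟩ := e
  simp only [rect, List.mem_flatMap, List.mem_map, Prod.mk.injEq]
  exact ⟨by rintro ⟨_, h1, _, h2, rfl, rfl⟩; exact ⟨h1, h2⟩,
    fun h => ⟨_, h.1, _, h.2, rfl, rfl⟩⟩

theorem holds_atLeast {h : ℕ → ℕ → Prop} {k : ℕ} {l : List (ℕ × ℕ)} (hl : l.Nodup)
    {T : Finset (ℕ × ℕ)} (hT : ∀ e ∈ T, e ∈ l ∧ h e.1 e.2) (hk : k ≤ #T) :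
    Holds h (atLeast k l) := by
  simp only [atLeast, holds_map, List.mem_sublistsLen]
  rintro t ⟨ht, hlen⟩
  left
  by_contra! hcon
  have h1 : Disjoint T t.toFinset := by
    rw [Finset.disjoint_left]
    intro e he he'
    exact hcon e (by simpa using he') (hT e he).2
  have h2 : #(T ∪ t.toFinset) ≤ #l.toFinset := card_le_card fun e he => by
    simp only [mem_union, List.mem_toFinset] at he ⊢
    exact he.elim (fun h => (hT e h).1) fun h => ht.subset h
  rw [card_union_of_disjoint h1, List.toFinset_card_of_nodup hl,
    List.toFinset_card_of_nodup (ht.nodup hl)] at h2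
  have : #T ≤ l.length := by omega
  omega

theorem Cert.Refutes.false {c : Cert} {m n b k : ℕ} {side : List Clause}
    (hc : c.Refutes m n b k side) {f : ℕ → α} {g : ℕ → β} (hf : Set.InjOn f (Set.Iio m))
    (hg : Set.InjOn g (Set.Iio n)) (h₄ : c.C ≠ [] → ¬ HasC 4 H)
    (hk : c.D ≠ [] → ¬ HasC k fun a b => ¬ H a b) (hs : Holds (fun i j => H (f i) (g j)) side) :
    False := by
  have hf' : Injective fun i : Fin m => f i := fun i j h => Fin.ext (hf i.2 j.2 h)
  have hg' : Injective fun i : Fin n => g i := fun i j h => Fin.ext (hg i.2 j.2 h)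
  exact check_sound hc (fun i j => H (f i) (g j))
    (fun h1 h2 => h₄ h1 (HasC.comap (h := H) hf' hg' h2))
    (fun h1 h2 => hk h1 (HasC.comap (h := fun a b => ¬ H a b) hf' hg' h2)) hs

end Refute
end

section
variable {α β : Type*} {H : α → β → Prop}

theorem HasC.of_four {a b c d : α} {w x y z : β} (ha : [a, b, c, d].Nodup)
    (hw : [w, x, y, z].Nodup) (h₁ : H a w) (h₂ : H b w) (h₃ : H b x) (h₄ : H c x) (h₅ : H c y)
    (h₆ : H d y) (h₇ : H d z) (h₈ : H a z) : HasC 4 H := by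
  refine ⟨![a, b, c, d], ![w, x, y, z], ?_, ?_, ?_⟩
  · simpa [← List.nodup_ofFn] using ha
  · simpa [← List.nodup_ofFn] using hw
  · intro i
    fin_cases i <;> simp [finRotate_apply] <;> constructor <;> assumption

theorem exists_transversal_or {I : Fin 4 → Finset β} (hI : ∀ i, 2 ≤ #(I i)) :
    (∃ w : Fin 4 → β, w.Injective ∧ ∀ i, w i ∈ I i) ∨
    (∃ T, #T = 2 ∧ ∃ i, ∀ j ≠ i, I j = T) ∨ ∃ U, #U ≤ 3 ∧ ∀ i, I i ⊆ U := by
  classical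
  by_contra! hcon
  obtain ⟨h1, h2, h3⟩ := hcon
  have h4 := mt (Finset.all_card_le_biUnion_card_iff_exists_injective I).1
    fun ⟨w, hw, h⟩ => (h1 w hw).elim fun i hi => hi (h i)
  push Not at h4
  obtain ⟨s, hs⟩ := h4
  have hsub : ∀ i ∈ s, I i ⊆ s.biUnion I := fun i hi => subset_biUnion_of_mem I hi
  have hne : s.Nonempty := card_pos.1 (by omega)
  have h5 : ∀ i ∈ s, 2 ≤ #(s.biUnion I) := fun i hi => (hI i).trans (card_le_card (hsub i hi))
  have h6 := h5 _ hne.choose_spec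
  have h7 : #s ≤ 4 := by simpa using card_le_univ s
  have h8 := card_compl s
  rw [Fintype.card_fin] at h8
  rcases (by omega : #s = 3 ∨ #s = 4) with h | h
  · obtain ⟨i, hi⟩ := card_eq_one.1 (show #sᶜ = 1 by omega)
    obtain ⟨j, hj, hj'⟩ := h2 (s.biUnion I) (by omega) i
    refine hj' (eq_of_subset_of_card_le (hsub j ?_) (by have := hI j; omega))
    by_contra hjs
    rw [← mem_compl, hi, mem_singleton] at hjs
    exact hj hjs
  · obtain ⟨i, hi⟩ := h3 (s.biUnion I) (by omega)
    refine hi (hsub i ?_)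
    have : s = univ := (card_eq_iff_eq_univ s).1 (by simpa using h)
    simp [this]

theorem exists_transversal_three_or {I J X : Finset β} (hI : 2 ≤ #I) (hJ : 2 ≤ #J)
    (hX : X.Nonempty) : (∃ x ∈ I, ∃ y ∈ X, ∃ z ∈ J, [x, y, z].Nodup) ∨
      #I = 2 ∧ J = I ∧ X ⊆ I := by
  classical
  by_contra! hcon
  obtain ⟨h1, h2⟩ := hcon
  have key : ∀ y ∈ X, y ∈ I ∧ #I = 2 ∧ J ⊆ I := by
    intro y hy
    obtain ⟨x, hx, hxy⟩ := exists_mem_ne (by omega : 1 < #I) y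
    obtain ⟨z, hz, hzy⟩ := exists_mem_ne (by omega : 1 < #J) y
    have e1 : ∀ x ∈ I, x ≠ y → x = z := fun x hx hxy => by
      by_contra h
      exact h1 x hx y hy z hz (by simp [hxy, h, hzy.symm])
    have e2 : ∀ z ∈ J, z ≠ y → z = x := fun z hz hzy => by
      by_contra h
      exact h1 x hx y hy z hz (by simp [hxy, Ne.symm h, Ne.symm hzy])
    have hI' : I ⊆ {y, z} := fun u hu => by
      by_cases h : u = y
      · simp [h]
      · simp [e1 u hu h]
    have h5 : I = {y, z} := eq_of_subset_of_card_le hI' (card_le_two.trans hI)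
    have h6 : J ⊆ {y, x} := fun u hu => by
      by_cases h : u = y
      · simp [h]
      · simp [e2 u hu h]
    rw [← e1 x hx hxy] at h5
    refine ⟨by simp [h5], by rw [h5, card_pair hxy.symm], h5 ▸ h6⟩
  obtain ⟨y, hy⟩ := hX
  obtain ⟨k1, k2, k3⟩ := key y hy
  exact h2 k2 (eq_of_subset_of_card_le k3 (by omega)) fun u hu => (key u hu).1

/-- Four rows whose sets meet cyclically in at least two elements: without a cycle of length 8,
the overlaps are concentrated. -/
theorem overlap [DecidableEq β] {Q : Finset α} {S : α → Finset β}
    (hS : ∀ a ∈ Q, ∀ b ∈ S a, H a b) (h₄ : ¬ HasC 4 H) {a b c d : α} (hn : [a, b, c, d].Nodup)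
    (ha : a ∈ Q) (hb : b ∈ Q) (hc : c ∈ Q) (hd : d ∈ Q) (hab : 2 ≤ #(S a ∩ S b))
    (hbc : 2 ≤ #(S b ∩ S c)) (hcd : 2 ≤ #(S c ∩ S d)) (hda : 2 ≤ #(S d ∩ S a)) :
    ∃ a ∈ Q, ∃ b ∈ Q, ∃ c ∈ Q, ∃ d ∈ Q, [a, b, c, d].Nodup ∧
      ((∃ T, #T = 2 ∧ S a ∩ S b = T ∧ S b ∩ S c = T ∧ S c ∩ S d = T ∧ S a ∩ S c = T) ∨
       ∃ U, #U ≤ 3 ∧ S a ∩ S b ⊆ U ∧ S a ∩ S c ⊆ U ∧ S a ∩ S d ⊆ U ∧ S b ∩ S c ⊆ U ∧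
        S b ∩ S d ⊆ U ∧ S c ∩ S d ⊆ U) := by
  have cyc : ∀ {a b c d : α} {w x y z : β}, a ∈ Q → b ∈ Q → c ∈ Q → d ∈ Q → [a, b, c, d].Nodup →
      [w, x, y, z].Nodup → w ∈ S a ∩ S b → x ∈ S b ∩ S c → y ∈ S c ∩ S d → z ∈ S d ∩ S a →
      False := fun ha hb hc hd h h' hw hx hy hz => by
    rw [mem_inter] at hw hx hy hz
    exact h₄ (HasC.of_four h h' (hS _ ha _ hw.1) (hS _ hb _ hw.2) (hS _ hb _ hx.1) (hS _ hc _ hx.2)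
      (hS _ hc _ hy.1) (hS _ hd _ hy.2) (hS _ hd _ hz.1) (hS _ ha _ hz.2))
  -- three equal overlaps
  have pair : ∀ {a b c d : α} {T : Finset β}, a ∈ Q → b ∈ Q → c ∈ Q → d ∈ Q →
      [a, b, c, d].Nodup → #T = 2 → S a ∩ S b = T → S b ∩ S c = T → S c ∩ S d = T →
      ∃ a ∈ Q, ∃ b ∈ Q, ∃ c ∈ Q, ∃ d ∈ Q, [a, b, c, d].Nodup ∧
      ∃ T, #T = 2 ∧ S a ∩ S b = T ∧ S b ∩ S c = T ∧ S c ∩ S d = T ∧ S a ∩ S c = T := by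
    intro a b c d T ha hb hc hd hn hT e1 e2 e3
    have ta : T ⊆ S a := e1 ▸ inter_subset_left
    have tb : T ⊆ S b := e1 ▸ inter_subset_right
    have tc : T ⊆ S c := e2 ▸ inter_subset_right
    have td : T ⊆ S d := e3 ▸ inter_subset_right
    by_cases h1 : S a ∩ S c = T
    · exact ⟨a, ha, b, hb, c, hc, d, hd, hn, T, hT, e1, e2, e3, h1⟩
    by_cases h2 : S b ∩ S d = T
    · refine ⟨d, hd, c, hc, b, hb, a, ha, ?_, T, hT, ?_, ?_, ?_, ?_⟩
      · simp only [List.nodup_cons, List.mem_cons] at hn ⊢; grind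
      all_goals rw [inter_comm]; assumption
    exfalso
    obtain ⟨w, hw, hwT⟩ := exists_of_ssubset
      ((subset_inter ta tc).ssubset_of_ne (Ne.symm h1))
    obtain ⟨y, hy, hyT⟩ := exists_of_ssubset
      ((subset_inter tb td).ssubset_of_ne (Ne.symm h2))
    obtain ⟨x, z, hxz, rfl⟩ := card_eq_two.1 hT
    have hwy : w ≠ y := by
      rintro rfl
      exact hwT (e1 ▸ mem_inter.2 ⟨(mem_inter.1 hw).1, (mem_inter.1 hy).1⟩)
    refine cyc (a := a) (b := c) (c := b) (d := d) (w := w) (x := x) (y := y) (z := z)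
      ha hc hb hd ?_ ?_ hw ?_ hy ?_
    · simp only [List.nodup_cons, List.mem_cons] at hn ⊢; grind
    · simp at hwT hyT ⊢; grind
    · exact mem_inter.2 ⟨tc (by simp), tb (by simp)⟩
    · exact mem_inter.2 ⟨td (by simp), ta (by simp)⟩
  -- a diagonal overlap outside `U`
  have diag : ∀ {a b c d : α} {U : Finset β} {w : β}, a ∈ Q → b ∈ Q → c ∈ Q → d ∈ Q →
      [a, b, c, d].Nodup → 2 ≤ #(S a ∩ S b) → 2 ≤ #(S b ∩ S c) → 2 ≤ #(S c ∩ S d) →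
      2 ≤ #(S d ∩ S a) → #U ≤ 3 → S a ∩ S b ⊆ U → S b ∩ S c ⊆ U → S c ∩ S d ⊆ U →
      S d ∩ S a ⊆ U → w ∈ S a ∩ S c → w ∉ U →
      ∃ a ∈ Q, ∃ b ∈ Q, ∃ c ∈ Q, ∃ d ∈ Q, [a, b, c, d].Nodup ∧
      ∃ T, #T = 2 ∧ S a ∩ S b = T ∧ S b ∩ S c = T ∧ S c ∩ S d = T ∧ S a ∩ S c = T := by
    intro a b c d U w ha hb hc hd hn hab hbc hcd hda hU ub uc ud ua hw hwU
    have hX : (S b ∩ S d).Nonempty := by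
      have h1 := card_union_add_card_inter (S a ∩ S b) (S d ∩ S a)
      have h2 := card_le_card (union_subset ub ua)
      have h3 : 0 < #((S a ∩ S b) ∩ (S d ∩ S a)) := by omega
      obtain ⟨x, hx⟩ := card_pos.1 h3
      simp only [mem_inter] at hx
      exact ⟨x, by simp [hx]⟩
    have hwb : w ∉ S b := fun h => hwU (ub (mem_inter.2 ⟨(mem_inter.1 hw).1, h⟩))
    have hwd : w ∉ S d := fun h => hwU (ua (mem_inter.2 ⟨h, (mem_inter.1 hw).1⟩))
    obtain ⟨x, hx, y, hy, z, hz, hxyz⟩ | ⟨h1, h2, h3⟩ := exists_transversal_three_or hbc hda hX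
    · refine (cyc (a := a) (b := c) (c := b) (d := d) (w := w) ha hc hb hd ?_ ?_ hw
        (inter_comm (S b) _ ▸ hx) hy hz).elim
      · simp only [List.nodup_cons, List.mem_cons] at hn ⊢; grind
      · rw [List.nodup_cons]
        refine ⟨?_, hxyz⟩
        simp only [mem_inter] at hx hy hz
        simp; grind
    obtain ⟨x, hx, y, hy, z, hz, hxyz⟩ | ⟨k1, k2, k3⟩ := exists_transversal_three_or hcd hab hX
    · refine (cyc (a := a) (b := c) (c := d) (d := b) (w := w) ha hc hd hb ?_ ?_ hw
        hx (inter_comm (S b) _ ▸ hy) (inter_comm (S a) _ ▸ hz)).elim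
      · simp only [List.nodup_cons, List.mem_cons] at hn ⊢; grind
      · rw [List.nodup_cons]
        refine ⟨?_, hxyz⟩
        simp only [mem_inter] at hx hy hz
        simp; grind
    have e : S c ∩ S d = S b ∩ S c := by
      refine (eq_of_subset_of_card_le ?_ (by omega)).symm
      intro u hu
      have hu' := h2.symm ▸ hu
      simp only [mem_inter] at hu hu' ⊢
      exact ⟨hu.2, hu'.1⟩
    refine ⟨b, hb, c, hc, d, hd, a, ha, ?_, S b ∩ S c, h1, rfl, e, h2, h3.antisymm ?_⟩
    · simp only [List.nodup_cons, List.mem_cons] at hn ⊢; grind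
    · intro u hu
      have hu' := e.symm ▸ hu
      simp only [mem_inter] at hu hu' ⊢
      exact ⟨hu.1, hu'.2⟩
  have pair' : ∀ {a b c d : α} {T : Finset β}, a ∈ Q → b ∈ Q → c ∈ Q → d ∈ Q →
      [a, b, c, d].Nodup → #T = 2 → S a ∩ S b = T → S b ∩ S c = T → S c ∩ S d = T → _ :=
    fun ha hb hc hd hn hT e1 e2 e3 =>
      let ⟨a, ha, b, hb, c, hc, d, hd, hn, h⟩ := pair ha hb hc hd hn hT e1 e2 e3
      (⟨a, ha, b, hb, c, hc, d, hd, hn, Or.inl h⟩ : ∃ a ∈ Q, ∃ b ∈ Q, ∃ c ∈ Q, ∃ d ∈ Q,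
      [a, b, c, d].Nodup ∧
      ((∃ T, #T = 2 ∧ S a ∩ S b = T ∧ S b ∩ S c = T ∧ S c ∩ S d = T ∧ S a ∩ S c = T) ∨
       ∃ U, #U ≤ 3 ∧ S a ∩ S b ⊆ U ∧ S a ∩ S c ⊆ U ∧ S a ∩ S d ⊆ U ∧ S b ∩ S c ⊆ U ∧
        S b ∩ S d ⊆ U ∧ S c ∩ S d ⊆ U))
  have hn' : [b, c, d, a].Nodup := by
    simp only [List.nodup_cons, List.mem_cons] at hn ⊢; grind
  have hn2 : [c, d, a, b].Nodup := by
    simp only [List.nodup_cons, List.mem_cons] at hn ⊢; grind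
  have hn3 : [d, a, b, c].Nodup := by
    simp only [List.nodup_cons, List.mem_cons] at hn ⊢; grind
  obtain ⟨w, hw, hI⟩ | ⟨T, hT, i, hi⟩ | ⟨U, hU, hi⟩ := exists_transversal_or
    (I := ![S a ∩ S b, S b ∩ S c, S c ∩ S d, S d ∩ S a]) (by simp [Fin.forall_fin_succ, *])
  · refine (cyc ha hb hc hd hn ?_ (hI 0) (hI 1) (hI 2) (hI 3)).elim
    simp [hw.eq_iff]
  · fin_cases i
    · exact pair' hb hc hd ha hn' hT (hi 1 (by decide)) (hi 2 (by decide)) (hi 3 (by decide))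
    · exact pair' hc hd ha hb hn2 hT (hi 2 (by decide)) (hi 3 (by decide)) (hi 0 (by decide))
    · exact pair' hd ha hb hc hn3 hT (hi 3 (by decide)) (hi 0 (by decide)) (hi 1 (by decide))
    · exact pair' ha hb hc hd hn hT (hi 0 (by decide)) (hi 1 (by decide)) (hi 2 (by decide))
  · have u1 := hi 0
    have u2 := hi 1
    have u3 := hi 2
    have u4 := hi 3
    simp only [Matrix.cons_val] at u1 u2 u3 u4
    by_cases h1 : S a ∩ S c ⊆ U
    · by_cases h2 : S b ∩ S d ⊆ U
      · exact ⟨a, ha, b, hb, c, hc, d, hd, hn, Or.inr ⟨U, hU, u1, h1, inter_comm (S d) _ ▸ u4, u2,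
          h2, u3⟩⟩
      · obtain ⟨w, hw, hwU⟩ := not_subset.1 h2
        obtain ⟨a, ha, b, hb, c, hc, d, hd, hn, h⟩ :=
          diag hb hc hd ha hn' hbc hcd hda hab hU u2 u3 u4 u1 hw hwU
        exact ⟨a, ha, b, hb, c, hc, d, hd, hn, Or.inl h⟩
    · obtain ⟨w, hw, hwU⟩ := not_subset.1 h1
      obtain ⟨a, ha, b, hb, c, hc, d, hd, hn, h⟩ :=
        diag ha hb hc hd hn hab hbc hcd hda hU u1 u2 u3 u4 hw hwU
      exact ⟨a, ha, b, hb, c, hc, d, hd, hn, Or.inl h⟩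

end

section
variable {α β : Type*} {H : α → β → Prop}

theorem card_union_three [DecidableEq β] (A B C : Finset β) :
    #A + #B + #C ≤ #(A ∪ B ∪ C) + #(A ∩ B) + #(A ∩ C) + #(B ∩ C) := by
  have h1 := card_union_add_card_inter A B
  have h2 := card_union_add_card_inter (A ∪ B) C
  rw [union_inter_distrib_right] at h2
  have h3 := card_union_le (A ∩ C) (B ∩ C)
  omega

theorem card_sdiff_four [DecidableEq β] {A B C D U R : Finset β} (h₁ : A ∩ B ⊆ U) (h₂ : A ∩ C ⊆ U)
    (h₃ : A ∩ D ⊆ U) (h₄ : B ∩ C ⊆ U) (h₅ : B ∩ D ⊆ U) (h₆ : C ∩ D ⊆ U) (hA : A ⊆ R)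
    (hB : B ⊆ R) (hC : C ⊆ R) (hD : D ⊆ R) :
    #(A \ U) + #(B \ U) + #(C \ U) + #(D \ U) ≤ #(R \ U) := by
  have d : ∀ {X Y : Finset β}, X ∩ Y ⊆ U → Disjoint (X \ U) (Y \ U) := fun h => by
    rw [Finset.disjoint_left]
    intro x hx hy
    rw [mem_sdiff] at hx hy
    exact hx.2 (h (mem_inter.2 ⟨hx.1, hy.1⟩))
  rw [← card_union_of_disjoint (d h₁), ← card_union_of_disjoint, ← card_union_of_disjoint]
  · refine card_le_card ?_
    simp only [union_subset_iff]
    exact ⟨⟨⟨sdiff_subset_sdiff hA le_rfl, sdiff_subset_sdiff hB le_rfl⟩,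
      sdiff_subset_sdiff hC le_rfl⟩, sdiff_subset_sdiff hD le_rfl⟩
  · simp only [disjoint_union_left]
    exact ⟨⟨d h₃, d h₅⟩, d h₆⟩
  · simp only [disjoint_union_left]
    exact ⟨d h₂, d h₄⟩

theorem HasC.of_overlap [DecidableEq β] {Q : Finset α} {S : α → Finset β} {R : Finset β} {k : ℕ}
    (hS : ∀ a ∈ Q, ∀ b ∈ S a, H a b) (hR : ∀ a ∈ Q, S a ⊆ R) (hk : ∀ a ∈ Q, k ≤ #(S a))
    (h3 : #R + 5 ≤ 3 * k) (h4 : #R + 10 ≤ 4 * k) {a b c d : α} (hn : [a, b, c, d].Nodup)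
    (ha : a ∈ Q) (hb : b ∈ Q) (hc : c ∈ Q) (hd : d ∈ Q) (hab : 2 ≤ #(S a ∩ S b))
    (hbc : 2 ≤ #(S b ∩ S c)) (hcd : 2 ≤ #(S c ∩ S d)) (hda : 2 ≤ #(S d ∩ S a)) : HasC 4 H := by
  by_contra h
  obtain ⟨a, ha, b, hb, c, hc, d, hd, -, ⟨T, hT, e1, e2, -, e3⟩ | ⟨U, hU, h1, h2, h3, h4, h5, h6⟩⟩ :=
    overlap hS h hn ha hb hc hd hab hbc hcd hda
  · have i1 := card_union_add_card_inter (S a) (S b)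
    have i2 := card_union_add_card_inter (S a ∪ S b) (S c)
    rw [union_inter_distrib_right, e2, e3, union_self, hT] at i2
    rw [e1, hT] at i1
    have := card_le_card (union_subset (union_subset (hR a ha) (hR b hb)) (hR c hc))
    have := hk a ha
    have := hk b hb
    have := hk c hc
    omega
  · have := card_sdiff_four h1 h2 h3 h4 h5 h6 (hR a ha) (hR b hb) (hR c hc) (hR d hd)
    have e : ∀ a ∈ Q, k ≤ #(S a \ U) + #U := fun a ha =>
      (hk a ha).trans (Nat.sub_le_iff_le_add.1 (le_card_sdiff U (S a)))
    have := e a ha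
    have := e b hb
    have := e c hc
    have := e d hd
    by_cases hUR : U ⊆ R
    · have := card_sdiff_add_card_eq_card hUR
      omega
    · obtain ⟨u, hu, hu'⟩ := not_subset.1 hUR
      have := card_le_card (show R \ U ⊆ R from sdiff_subset)
      have i1 := card_lt_card (show U ∩ R ⊂ U from
        inter_subset_left.ssubset_of_ne fun h => hu' (inter_subset_right (h.symm ▸ hu)))
      have e : ∀ a ∈ Q, k ≤ #(S a \ U) + #(U ∩ R) := fun a ha => by
        have := card_sdiff_add_card_inter (S a) U
        have := card_le_card (show S a ∩ U ⊆ U ∩ R from fun x hx => by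
          rw [mem_inter] at hx ⊢; exact ⟨hx.2, hR a ha hx.1⟩)
        have := hk a ha
        omega
      have := e a ha
      have := e b hb
      have := e c hc
      have := e d hd
      have := card_sdiff_add_card_inter R U
      rw [inter_comm] at this
      omega

theorem two_le_card_inter [DecidableEq β] {A B R : Finset β} {k : ℕ} (hA : A ⊆ R) (hB : B ⊆ R)
    (h1 : k ≤ #A) (h2 : k ≤ #B) (hR : #R + 2 ≤ 2 * k) : 2 ≤ #(A ∩ B) := by
  have := card_union_add_card_inter A B
  have := card_le_card (union_subset hA hB)
  omega

theorem exists_four {Q : Finset α} (hQ : 4 ≤ #Q) :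
    ∃ a ∈ Q, ∃ b ∈ Q, ∃ c ∈ Q, ∃ d ∈ Q, [a, b, c, d].Nodup := by
  have h1 := Q.nodup_toList
  have h2 := Q.length_toList
  have h3 : ∀ x ∈ Q.toList, x ∈ Q := fun x => mem_toList.1
  match h : Q.toList with
  | [] | [_] | [_, _] | [_, _, _] => simp [h] at h2; omega
  | a :: b :: c :: d :: l =>
    rw [h] at h1 h3
    exact ⟨a, h3 a (by simp), b, h3 b (by simp), c, h3 c (by simp), d, h3 d (by simp),
      h1.sublist (by simp)⟩

/-- Four rows of large degree. -/
theorem HasC.of_four_rows {Q : Finset α} {R : Finset β} {k : ℕ} (hQ : 4 ≤ #Q)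
    (h : ∀ a ∈ Q, k ≤ #(nb H R a)) (hk : 4 ≤ k) (hR : #R + 2 ≤ 2 * k) : HasC 4 H := by
  classical
  obtain ⟨a, ha, b, hb, c, hc, d, hd, hn⟩ := exists_four hQ
  have := fun {x y} (hx : x ∈ Q) (hy : y ∈ Q) =>
    two_le_card_inter nb_subset nb_subset (h x hx) (h y hy) hR
  exact HasC.of_overlap (S := nb H R) (fun a _ b hb => (mem_nb.1 hb).2) (fun _ _ => nb_subset) h
    (by omega) (by omega) hn ha hb hc hd (this ha hb) (this hb hc) (this hc hd) (this hd ha)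

/-- Among seven large sets, four overlap cyclically. -/
theorem exists_cyclic_overlap [DecidableEq β] {Q : Finset α} {S : α → Finset β} {R : Finset β}
    {k : ℕ} (hR : ∀ a ∈ Q, S a ⊆ R) (hk : ∀ a ∈ Q, k ≤ #(S a)) (hQ : 7 ≤ #Q)
    (hR3 : #R + 4 ≤ 3 * k) : ∃ a ∈ Q, ∃ b ∈ Q, ∃ c ∈ Q, ∃ d ∈ Q, [a, b, c, d].Nodup ∧
      2 ≤ #(S a ∩ S b) ∧ 2 ≤ #(S b ∩ S c) ∧ 2 ≤ #(S c ∩ S d) ∧ 2 ≤ #(S d ∩ S a) := by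
  by_contra! hcon
  have : Nonempty α := ⟨(card_pos.1 (by omega : 0 < #Q)).choose⟩
  obtain ⟨f, hf, hfQ, -⟩ := exists_enum Q (fun _ => 0)
  refine Refute.certGraph_refutes.false (H := fun a b => 2 ≤ #(S a ∩ S b)) (f := f) (g := f)
    (hf.mono (Set.Iio_subset_Iio hQ)) (hf.mono (Set.Iio_subset_Iio hQ)) (fun h => (h rfl).elim)
    (fun h => (h rfl).elim) ?_
  have sym : ∀ a b, 2 ≤ #(S a ∩ S b) → 2 ≤ #(S b ∩ S a) := fun a b h => by rwa [inter_comm]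
  have hedge : ∀ a b, 2 ≤ #(S (f (Refute.edge a b).1) ∩ S (f (Refute.edge a b).2)) →
      2 ≤ #(S (f a) ∩ S (f b)) := fun a b h => by
    rcases le_total a b with hab | hab
    · simpa [Refute.edge, hab] using h
    · exact sym _ _ (by simpa [Refute.edge, hab] using h)
  rw [Refute.sideGraph, Refute.holds_append]
  constructor
  · rw [Refute.holds_map]
    intro t ht
    rw [List.mem_sublistsLen] at ht
    obtain ⟨ht, hl⟩ := ht
    obtain ⟨a, b, c, rfl⟩ := List.length_eq_three.1 hl
    have hm : ∀ x ∈ [a, b, c], x < 7 := fun x hx => List.mem_range.1 (ht.subset hx)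
    left
    by_contra! h
    have ha := hfQ a (by have := hm a (by simp); omega)
    have hb := hfQ b (by have := hm b (by simp); omega)
    have hc := hfQ c (by have := hm c (by simp); omega)
    have h1 := h (a, b) (by simp)
    have h2 := h (a, c) (by simp)
    have h3 := h (b, c) (by simp)
    dsimp only at h1 h2 h3
    have := card_union_three (S (f a)) (S (f b)) (S (f c))
    have := card_le_card (union_subset (union_subset (hR _ ha) (hR _ hb)) (hR _ hc))
    have := hk _ ha
    have := hk _ hb
    have := hk _ hc
    omega
  · simp only [Refute.holds_flatMap, Refute.holds_map, List.mem_filter, List.mem_range]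
    rintro a ha b hb c hc d ⟨hd, hh⟩
    right
    by_contra! h
    simp only [Bool.and_eq_true, decide_eq_true_eq, bne_iff_ne] at hh
    have h1 := hedge _ _ (h (Refute.edge a b) (by simp))
    have h2 := hedge _ _ (h (Refute.edge b c) (by simp))
    have h3 := hedge _ _ (h (Refute.edge c d) (by simp))
    have h4 := hedge _ _ (h (Refute.edge a d) (by simp))
    refine absurd (sym _ _ h4) (not_le.2 (hcon _ (hfQ a (by omega)) _ (hfQ b (by omega)) _
      (hfQ c (by omega)) _ (hfQ d (by omega)) ?_ h1 h2 h3))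
    have inj : ∀ x < 7, ∀ y < 7, x ≠ y → f x ≠ f y := fun x hx y hy hxy h =>
      hxy (hf (by simp; omega) (by simp; omega) h)
    simp only [List.nodup_cons, List.mem_cons, List.not_mem_nil, or_false, not_or,
      not_false_eq_true, List.nodup_nil, and_true]
    refine ⟨⟨inj _ ha _ hb ?_, inj _ ha _ hc ?_, inj _ ha _ hd ?_⟩,
      ⟨inj _ hb _ hc ?_, inj _ hb _ hd ?_⟩, inj _ hc _ hd ?_⟩ <;> omega

end

section
variable {α β : Type*} {H : α → β → Prop}

theorem card_pos_nonempty {U : Finset β} {n : ℕ} (h : n + 1 ≤ #U) : Nonempty β :=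
  ⟨(card_pos.1 (by omega : 0 < #U)).choose⟩

/-- Enumeration of a finite set along a chain of subsets. -/
theorem exists_enum_chain {U V₀ V₁ V₂ V₃ : Finset β} {n : ℕ} (hU : #U = n + 1) (h₀ : V₀ ⊆ V₁)
    (h₁ : V₁ ⊆ V₂) (h₂ : V₂ ⊆ V₃) (h₃ : V₃ ⊆ U) : ∃ f : ℕ → β,
    Set.InjOn f (Set.Iio (n + 1)) ∧ (∀ i < n + 1, f i ∈ U) ∧
    ∀ i < n + 1, (f i ∈ V₀ ↔ i < #V₀) ∧ (f i ∈ V₁ ↔ i < #V₁) ∧ (f i ∈ V₂ ↔ i < #V₂) ∧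
      (f i ∈ V₃ ↔ i < #V₃) := by
  classical
  have := card_pos_nonempty hU.ge
  set key : β → ℕ := fun x => if x ∈ V₀ then 0 else if x ∈ V₁ then 1 else if x ∈ V₂ then 2 else
    if x ∈ V₃ then 3 else 4 with hkey
  have h : ∀ x, (key x ≤ 0 ↔ x ∈ V₀) ∧ (key x ≤ 1 ↔ x ∈ V₁) ∧ (key x ≤ 2 ↔ x ∈ V₂) ∧
      (key x ≤ 3 ↔ x ∈ V₃) := by
    intro x
    have h1 := @h₂ x
    have h2 := @h₁ x
    have h3 := @h₀ x
    simp only [hkey]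
    clear hkey h₀ h₁ h₂ h₃
    grind
  obtain ⟨f, hf, hfU, hk⟩ := exists_enum U key
  rw [hU] at hf hfU hk
  have hc : ∀ {V : Finset β} {k : ℕ}, V ⊆ U → (∀ x, key x ≤ k ↔ x ∈ V) →
      ∀ i < n + 1, f i ∈ V ↔ i < #V := fun {V k} hV hVk i hi => by
    rw [← hVk, hk k i hi]
    simp only [hVk, filter_mem_eq_inter, inter_eq_right.2 hV]
  exact ⟨f, hf, hfU, fun i hi => ⟨hc (h₀.trans (h₁.trans (h₂.trans h₃))) (fun x => (h x).1) i hi,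
    hc (h₁.trans (h₂.trans h₃)) (fun x => (h x).2.1) i hi,
    hc (h₂.trans h₃) (fun x => (h x).2.2.1) i hi, hc h₃ (fun x => (h x).2.2.2) i hi⟩⟩

/-- Enumeration of a finite set starting with a given list. -/
theorem exists_enum_list {Q : Finset α} {n : ℕ} (hQ : n + 1 ≤ #Q) {l : List α} (hl : l.Nodup)
    (h : ∀ x ∈ l, x ∈ Q) : ∃ f : ℕ → α, Set.InjOn f (Set.Iio (n + 1)) ∧ (∀ i < n + 1, f i ∈ Q) ∧
    ∀ (i : ℕ) (hi : i < l.length), f i = l[i] := by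
  classical
  have := card_pos_nonempty hQ
  set t := l ++ (Q \ l.toFinset).toList with ht
  have ht1 : t.Nodup := by
    rw [ht, List.nodup_append]
    refine ⟨hl, nodup_toList _, fun a ha b hb => ?_⟩
    rw [mem_toList, mem_sdiff, List.mem_toFinset] at hb
    rintro rfl
    exact hb.2 ha
  have ht2 : ∀ x ∈ t, x ∈ Q := by
    intro x hx
    rw [ht, List.mem_append, mem_toList, mem_sdiff] at hx
    exact hx.elim (h x) And.left
  have ht3 : t.length = #Q := by
    rw [← List.toFinset_card_of_nodup ht1]
    congr 1
    ext x
    rw [List.mem_toFinset]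
    refine ⟨ht2 x, fun hx => ?_⟩
    rw [ht, List.mem_append, mem_toList, mem_sdiff, List.mem_toFinset]
    tauto
  refine ⟨fun i => t.getD i (Classical.arbitrary α), fun i hi j hj hij => ?_, fun i hi => ?_,
    fun i hi => ?_⟩
  · simp only [Set.mem_Iio] at hi hj
    have hi' : i < t.length := by omega
    have hj' : j < t.length := by omega
    simpa [hi', hj', ht1.getElem_inj_iff] using hij
  · have hi' : i < t.length := by omega
    simpa [hi'] using ht2 _ (List.getElem_mem hi')
  · have hi' : i < t.length := by rw [ht, List.length_append]; omega
    dsimp only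
    rw [List.getD_eq_getElem _ _ hi']
    simp [ht, List.getElem_append_left, hi]

theorem exists_le_card_nb_eq {Q : Finset α} {R : Finset β} {k : ℕ}
    (h : ∀ a ∈ Q, k ≤ #(nb H R a)) : ∃ H' : α → β → Prop, (∀ a b, H' a b → H a b) ∧
      ∀ a ∈ Q, #(nb H' R a) = k := by
  classical
  have : ∀ a, ∃ S ⊆ nb H R a, a ∈ Q → #S = k := fun a => by
    by_cases ha : a ∈ Q
    · obtain ⟨S, h1, h2⟩ := exists_subset_card_eq (h a ha)
      exact ⟨S, h1, fun _ => h2⟩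
    · exact ⟨∅, by simp, fun h => (ha h).elim⟩
  choose S hS hS' using this
  refine ⟨fun a b => b ∈ S a, fun a b hb => (mem_nb.1 (hS a hb)).2, fun a ha => ?_⟩
  rw [← hS' a ha]
  congr 1
  ext b
  rw [mem_nb]
  exact ⟨And.right, fun hb => ⟨nb_subset (hS a hb), hb⟩⟩

theorem card_filter_eq_card {n : ℕ} {R : Finset β} (hR : #R = n) {g : ℕ → β}
    (hg : Set.InjOn g (Set.Iio n)) (hgR : ∀ j < n, g j ∈ R) (P : β → Prop) [DecidablePred P]
    [DecidablePred fun j => P (g j)] : #{j ∈ range n | P (g j)} = #{y ∈ R | P y} := by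
  classical
  have hg' : Set.InjOn g (range n) := by simpa [Set.Iio_def] using hg
  have e : (range n).image g = R := by
    refine eq_of_subset_of_card_le (fun y hy => ?_) ?_
    · obtain ⟨j, hj, rfl⟩ := mem_image.1 hy
      exact hgR j (mem_range.1 hj)
    · rw [card_image_of_injOn hg', card_range, hR]
  rw [← e, ← card_image_of_injOn (s := filter (fun j => P (g j)) (range n)) (f := g)]
  · congr 1
    ext y
    simp only [mem_image, mem_filter, mem_range]
    grind
  · intro x hx y hy
    simp only [coe_filter, Set.mem_ofPred_eq, mem_range] at hx hy
    exact hg hx.1 hy.1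

namespace Refute

theorem nodup_rect {R C : List ℕ} (hR : R.Nodup) (hC : C.Nodup) : (rect R C).Nodup := by
  rw [rect, List.nodup_flatMap]
  refine ⟨fun r _ => hC.map fun a b h => (Prod.mk.inj h).2, ?_⟩
  refine hR.imp fun {a b} hab => ?_
  rw [Function.onFun, List.disjoint_left]
  simp only [List.mem_map]
  rintro _ ⟨c, -, rfl⟩ ⟨c', -, h⟩
  exact hab (Prod.mk.inj h).1.symm

theorem holds_atLeast_row {f : ℕ → α} {g : ℕ → β} {R : Finset β} {k r n : ℕ} (hR : #R = n)
    (hg : Set.InjOn g (Set.Iio n)) (hgR : ∀ j < n, g j ∈ R) (hk : k ≤ #(nb H R (f r))) :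
    Holds (fun i j => H (f i) (g j)) (atLeast k (rect [r] (List.range n))) := by
  classical
  refine holds_atLeast (nodup_rect (by simp) List.nodup_range)
    (T := {j ∈ range n | H (f r) (g j)}.map ⟨fun j => (r, j), fun a b h => (Prod.mk.inj h).2⟩)
    ?_ ?_
  · simp only [mem_map, mem_filter, mem_range, mem_rect]
    rintro _ ⟨j, ⟨hj, hj'⟩, rfl⟩
    exact ⟨⟨List.mem_singleton.2 rfl, List.mem_range.2 hj⟩, hj'⟩
  · rw [card_map, card_filter_eq_card hR hg hgR (fun y => H (f r) y)]
    convert hk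
    ext; simp

theorem holds_atLeast_col {f : ℕ → α} {g : ℕ → β} {L : Finset α} {k c n : ℕ} (hL : #L = n)
    (hf : Set.InjOn f (Set.Iio n)) (hfL : ∀ j < n, f j ∈ L) (hk : k ≤ #(nb (flip H) L (g c))) :
    Holds (fun i j => H (f i) (g j)) (atLeast k (rect (List.range n) [c])) := by
  classical
  refine holds_atLeast (nodup_rect List.nodup_range (by simp))
    (T := {j ∈ range n | H (f j) (g c)}.map ⟨fun j => (j, c), fun a b h => (Prod.mk.inj h).1⟩)
    ?_ ?_
  · simp only [mem_map, mem_filter, mem_range, mem_rect]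
    rintro _ ⟨j, ⟨hj, hj'⟩, rfl⟩
    exact ⟨⟨List.mem_range.2 hj, List.mem_singleton.2 rfl⟩, hj'⟩
  · rw [card_map, card_filter_eq_card hL hf hfL (fun x => H x (g c))]
    convert hk
    ext; simp [flip]

theorem holds_rowsAtLeast {f : ℕ → α} {g : ℕ → β} {R : Finset β} {k m n : ℕ} (hR : #R = n)
    (hg : Set.InjOn g (Set.Iio n)) (hgR : ∀ j < n, g j ∈ R)
    (hk : ∀ i < m, k ≤ #(nb H R (f i))) :
    Holds (fun i j => H (f i) (g j)) (rowsAtLeast k m n) := by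
  rw [rowsAtLeast, holds_flatMap]
  exact fun i hi => holds_atLeast_row hR hg hgR (hk i (List.mem_range.1 hi))

theorem holds_row {h : ℕ → ℕ → Prop} {r n : ℕ} {S : List ℕ} (h₁ : ∀ c ∈ S, h r c)
    (h₀ : ∀ c < n, c ∉ S → ¬ h r c) : Holds h (row r n S) := by
  rw [row, holds_append, holds_ones, holds_zeros]
  constructor <;> intro e he <;> rw [mem_rect] at he <;> simp at he
  · rw [he.1]; exact h₁ _ he.2
  · rw [he.1]; exact h₀ _ he.2.1 he.2.2

theorem holds_disj {h : ℕ → ℕ → Prop} {a b : ℕ} {C : List ℕ} (h₀ : ∀ c ∈ C, h a c → ¬ h b c) :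
    Holds h (disj a b C) := by
  rw [disj, holds_map]
  intro c hc
  right
  by_cases hac : h a c
  · exact ⟨(b, c), by simp, h₀ c hc hac⟩
  · exact ⟨(a, c), by simp, hac⟩

end Refute

end

section
variable {α β : Type*} {H : α → β → Prop}

theorem HasC.of_seven_rows {Q : Finset α} {R : Finset β} {k : ℕ} (hQ : 7 ≤ #Q) (hk : 5 ≤ k)
    (hR : #R ≤ 2 * k) (h : ∀ a ∈ Q, k ≤ #(nb H R a)) : HasC 4 H := by
  classical
  obtain ⟨a, ha, b, hb, c, hc, d, hd, hn, h1, h2, h3, h4⟩ :=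
    exists_cyclic_overlap (S := nb H R) (fun _ _ => nb_subset) h hQ (by omega)
  exact HasC.of_overlap (S := nb H R) (fun a _ b hb => (mem_nb.1 hb).2) (fun _ _ => nb_subset) h
    (by omega) (by omega) hn ha hb hc hd h1 h2 h3 h4

theorem HasC.of_pair [DecidableEq β] {Q : Finset α} {R T : Finset β} (hQ : 7 ≤ #Q) (hR : #R = 8)
    (h : ∀ a ∈ Q, #(nb H R a) = 4) {a b c d : α} (hn : [a, b, c, d].Nodup) (ha : a ∈ Q)
    (hb : b ∈ Q) (hc : c ∈ Q) (hd : d ∈ Q) (hT : #T = 2) (e₁ : nb H R a ∩ nb H R b = T)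
    (e₂ : nb H R b ∩ nb H R c = T) (e₃ : nb H R c ∩ nb H R d = T) : HasC 4 H := by
  by_contra h₄
  obtain ⟨f, hf, hfQ, hfl⟩ := exists_enum_list (n := 6) hQ hn (by simp [*])
  have f0 : f 0 = a := hfl 0 (by simp)
  have f1 : f 1 = b := hfl 1 (by simp)
  have f2 : f 2 = c := hfl 2 (by simp)
  have f3 : f 3 = d := hfl 3 (by simp)
  have hTa : T ⊆ nb H R a := e₁ ▸ inter_subset_left
  obtain ⟨g, hg, hgR, hgV⟩ := exists_enum_chain hR hTa
    (subset_union_left (s₂ := nb H R b)) (Subset.refl _) (union_subset nb_subset nb_subset)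
  have hu : #(nb H R a ∪ nb H R b) = 6 := by
    have := card_union_add_card_inter (nb H R a) (nb H R b)
    rw [e₁, hT, h a ha, h b hb] at this
    omega
  rw [hu, hT, h a ha] at hgV
  have t : ∀ j < 8, (H a (g j) ∧ H b (g j) ↔ j < 2) ∧ (H b (g j) ∧ H c (g j) ↔ j < 2) ∧
      (H c (g j) ∧ H d (g j) ↔ j < 2) := fun j hj => by
    refine ⟨?_, ?_, ?_⟩ <;> rw [← (hgV j hj).1]
    · simp [← e₁, hgR j hj]
    · simp [← e₂, hgR j hj]
    · simp [← e₃, hgR j hj]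
  have ta : ∀ j < 8, H a (g j) ↔ j < 4 := fun j hj => by
    rw [← (hgV j hj).2.1]
    simp [hgR j hj]
  have tb : ∀ j < 8, H b (g j) ↔ j < 2 ∨ 4 ≤ j ∧ j < 6 := fun j hj => by
    have h1 := (hgV j hj).2.2.1
    have h2 := (t j hj).1
    have h3 := ta j hj
    simp only [mem_union, mem_nb, hgR j hj, true_and] at h1
    by_cases hb : H b (g j) <;> simp only [h3, hb, and_true, and_false, or_true, or_false, true_iff,
      false_iff] at h1 h2 ⊢ <;> omega
  refine Refute.certPair_refutes.false hf hg (fun _ => h₄) (fun h => (h rfl).elim) ?_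
  simp only [Refute.sidePair, Refute.holds_append]
  refine ⟨⟨⟨⟨⟨?_, ?_⟩, ?_⟩, ?_⟩, ?_⟩, ?_⟩
  · exact Refute.holds_rowsAtLeast hR hg hgR fun i hi => (h _ (hfQ i hi)).ge
  · refine Refute.holds_row ?_ ?_
    · simp [f0, ta]
    · intro j hj
      rw [f0, ta j hj]
      simp; omega
  · refine Refute.holds_row ?_ ?_
    · simp [f1, tb]
    · intro j hj
      rw [f1, tb j hj]
      simp; omega
  · rw [Refute.holds_ones]
    rintro ⟨i, j⟩ he
    rw [Refute.mem_rect] at he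
    simp only [List.mem_cons, List.not_mem_nil, or_false] at he
    have := (t j (by omega)).2.2.2 (by omega)
    obtain ⟨rfl | rfl, -⟩ := he
    · exact f2 ▸ this.1
    · exact f3 ▸ this.2
  · refine Refute.holds_disj fun j hj h1 h2 => ?_
    rw [f1] at h1
    rw [f2] at h2
    simp only [List.mem_cons, List.not_mem_nil, or_false] at hj
    have := (t j (by omega)).2.1.1 ⟨h1, h2⟩
    omega
  · refine Refute.holds_disj fun j hj h1 h2 => ?_
    rw [f2] at h1
    rw [f3] at h2
    simp only [List.mem_cons, List.not_mem_nil, or_false] at hj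
    have := (t j (by omega)).2.2.1 ⟨h1, h2⟩
    omega

theorem HasC.of_triple [DecidableEq β] {Q : Finset α} {R U : Finset β} (hQ : 7 ≤ #Q) (hR : #R = 8)
    (h : ∀ a ∈ Q, #(nb H R a) = 4) {a b c d : α} (hn : [a, b, c, d].Nodup) (ha : a ∈ Q)
    (hb : b ∈ Q) (hc : c ∈ Q) (hd : d ∈ Q) (hU : #U = 3) (e₁ : nb H R a ∩ nb H R b ⊆ U)
    (e₂ : nb H R a ∩ nb H R c ⊆ U) (e₃ : nb H R a ∩ nb H R d ⊆ U) (e₄ : nb H R b ∩ nb H R c ⊆ U)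
    (e₅ : nb H R b ∩ nb H R d ⊆ U) (e₆ : nb H R c ∩ nb H R d ⊆ U) (ub : U ⊆ nb H R b)
    (uc : U ⊆ nb H R c) (ud : U ⊆ nb H R d) : HasC 4 H := by
  by_contra h₄
  obtain ⟨f, hf, hfQ, hfl⟩ := exists_enum_list (n := 6) hQ hn (by simp [*])
  have f0 : f 0 = a := hfl 0 (by simp)
  have f1 : f 1 = b := hfl 1 (by simp)
  have f2 : f 2 = c := hfl 2 (by simp)
  have f3 : f 3 = d := hfl 3 (by simp)
  obtain ⟨g, hg, hgR, hgV⟩ := exists_enum_chain hR ub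
    (subset_union_left (s₂ := nb H R c)) (subset_union_left (s₂ := nb H R d))
    (union_subset (union_subset nb_subset nb_subset) nb_subset)
  replace e₄ := e₄.antisymm (subset_inter ub uc)
  replace e₅ := e₅.antisymm (subset_inter ub ud)
  replace e₆ := e₆.antisymm (subset_inter uc ud)
  have hu : #(nb H R b ∪ nb H R c) = 5 := by
    have := card_union_add_card_inter (nb H R b) (nb H R c)
    rw [e₄, hU, h b hb, h c hc] at this
    omega
  have hu' : #(nb H R b ∪ nb H R c ∪ nb H R d) = 6 := by
    have := card_union_add_card_inter (nb H R b ∪ nb H R c) (nb H R d)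
    rw [union_inter_distrib_right, e₅, e₆, union_self, hu, hU, h d hd] at this
    omega
  rw [hu, hu', hU, h b hb] at hgV
  simp only [mem_union, mem_nb] at hgV
  have t : ∀ j < 8, (H b (g j) ↔ j < 4) ∧ (H c (g j) ↔ j < 3 ∨ j = 4) ∧
      (H d (g j) ↔ j < 3 ∨ j = 5) ∧ (H a (g j) → j < 3 ∨ 6 ≤ j) := fun j hj => by
    have hm : ∀ {x}, g j ∈ nb H R x ↔ H x (g j) := by simp [hgR j hj]
    obtain ⟨h0, h1, h2, h3⟩ := hgV j hj
    simp only [hgR j hj, true_and] at h0 h1 h2 h3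
    have k1 := @e₁ (g j)
    have k2 := @e₂ (g j)
    have k3 := @e₃ (g j)
    have k4 := congrArg (g j ∈ ·) e₄
    have k5 := congrArg (g j ∈ ·) e₅
    have k6 := congrArg (g j ∈ ·) e₆
    simp only [mem_inter, hm, h0, eq_iff_iff] at k1 k2 k3 k4 k5 k6
    clear hgV h₄ hm e₁ e₂ e₃ e₄ e₅ e₆ hfQ hfl
    rw [h1] at h2 h3 k1 k4 k5 ⊢
    by_cases kc : H c (g j) <;> by_cases kd : H d (g j) <;> by_cases ka : H a (g j) <;>
      simp only [kc, kd, ka, and_true, and_false, true_and, false_and, or_true, or_false, true_iff,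
        false_iff, forall_const, false_imp_iff] at k1 k2 k3 k4 k5 k6 h2 h3 ⊢ <;> omega
  refine Refute.certTriple_refutes.false hf hg (fun _ => h₄) (fun h => (h rfl).elim) ?_
  simp only [Refute.sideTriple, Refute.holds_append]
  refine ⟨⟨⟨⟨?_, ?_⟩, ?_⟩, ?_⟩, ?_⟩
  · exact Refute.holds_rowsAtLeast hR hg hgR fun i hi => (h _ (hfQ i hi)).ge
  · refine Refute.holds_row ?_ fun j hj => ?_
    · simp [f1, t]
    · rw [f1, (t j hj).1]; simp; omega
  · refine Refute.holds_row ?_ fun j hj => ?_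
    · simp [f2, t]
    · rw [f2, (t j hj).2.1]; simp; omega
  · refine Refute.holds_row ?_ fun j hj => ?_
    · simp [f3, t]
    · rw [f3, (t j hj).2.2.1]; simp; omega
  · rw [Refute.holds_zeros]
    rintro ⟨i, j⟩ he h1
    rw [Refute.mem_rect] at he
    simp only [List.mem_cons, List.not_mem_nil, or_false] at he
    obtain ⟨rfl, hj⟩ := he
    rw [f0] at h1
    have := (t j (by omega)).2.2.2 h1
    omega

theorem HasC.of_seven_rows_eight {Q : Finset α} {R : Finset β} (hQ : 7 ≤ #Q) (hR : #R = 8)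
    (h : ∀ a ∈ Q, 4 ≤ #(nb H R a)) : HasC 4 H := by
  classical
  obtain ⟨H', hH, h⟩ := exists_le_card_nb_eq h
  refine HasC.mono hH ?_
  clear hH
  by_contra h₄
  obtain ⟨a, ha, b, hb, c, hc, d, hd, hn, h1, h2, h3, h4⟩ :=
    exists_cyclic_overlap (S := nb H' R) (fun _ _ => nb_subset) (fun a ha => (h a ha).ge) hQ
      (by omega)
  obtain ⟨a, ha, b, hb, c, hc, d, hd, hn, ⟨T, hT, e1, e2, e3, -⟩ | ⟨U, hU, h1, h2, h3, h4, h5, h6⟩⟩ :=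
    overlap (S := nb H' R) (fun a _ b hb => (mem_nb.1 hb).2) h₄ hn ha hb hc hd h1 h2 h3 h4
  · exact h₄ (HasC.of_pair hQ hR h hn ha hb hc hd hT e1 e2 e3)
  have r : ∀ {x y}, nb H' R x ∩ nb H' R y ⊆ U → nb H' R x ∩ nb H' R y ⊆ U ∩ R := fun h =>
    subset_inter h (inter_subset_left.trans nb_subset)
  have := card_sdiff_four (r h1) (r h2) (r h3) (r h4) (r h5) (r h6) (nb_subset (a := a))
    (nb_subset (a := b)) (nb_subset (a := c)) (nb_subset (a := d))
  have hUR := card_sdiff_add_card_eq_card (inter_subset_right (s₁ := U) (s₂ := R))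
  have hUle := card_le_card (inter_subset_left (s₁ := U) (s₂ := R))
  generalize U ∩ R = U at r this hUR hUle
  have key : ∀ x ∈ Q, 4 ≤ #(nb H' R x \ U) + #U ∧
      (¬ U ⊆ nb H' R x → 5 ≤ #(nb H' R x \ U) + #U) := fun x hx => by
    have k1 := card_sdiff_add_card_inter (nb H' R x) U
    rw [h x hx] at k1
    have k2 := card_le_card (inter_subset_right (s₁ := nb H' R x) (s₂ := U))
    refine ⟨by omega, fun hns => ?_⟩
    have k3 := card_lt_card ((inter_subset_right : nb H' R x ∩ U ⊆ U).ssubset_of_ne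
      fun h => hns (inter_eq_right.1 h))
    omega
  have ka := key a ha
  have kb := key b hb
  have kc := key c hc
  have kd := key d hd
  have ra := r h1
  have rb := r h2
  have rc := r h3
  have rd := r h4
  have re := r h5
  have rf := r h6
  have hU3 : #U = 3 := by omega
  refine h₄ ?_
  by_cases ua : U ⊆ nb H' R a
  · by_cases ub : U ⊆ nb H' R b
    · by_cases uc : U ⊆ nb H' R c
      · refine HasC.of_triple hQ hR h (a := d) (b := a) (c := b) (d := c) (U := U) ?_ hd ha hb hc
          hU3 ?_ ?_ ?_ ?_ ?_ ?_ ua ub uc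
        · simp only [List.nodup_cons, List.mem_cons] at hn ⊢; grind
        all_goals first | assumption | (rw [inter_comm]; assumption)
      · have ud : U ⊆ nb H' R d := by
          by_contra ud
          have := kc.2 uc
          have := kd.2 ud
          omega
        refine HasC.of_triple hQ hR h (a := c) (b := a) (c := b) (d := d) (U := U) ?_ hc ha hb hd
          hU3 ?_ ?_ ?_ ?_ ?_ ?_ ua ub ud
        · simp only [List.nodup_cons, List.mem_cons] at hn ⊢; grind
        all_goals first | assumption | (rw [inter_comm]; assumption)
    · have uc : U ⊆ nb H' R c := by
        by_contra uc
        have := kb.2 ub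
        have := kc.2 uc
        omega
      have ud : U ⊆ nb H' R d := by
        by_contra ud
        have := kb.2 ub
        have := kd.2 ud
        omega
      refine HasC.of_triple hQ hR h (a := b) (b := a) (c := c) (d := d) (U := U) ?_ hb ha hc hd
        hU3 ?_ ?_ ?_ ?_ ?_ ?_ ua uc ud
      · simp only [List.nodup_cons, List.mem_cons] at hn ⊢; grind
      all_goals first | assumption | (rw [inter_comm]; assumption)
  · have : ∀ x ∈ Q, x = b ∨ x = c ∨ x = d → U ⊆ nb H' R x := by
      intro x hx h'
      by_contra hux
      have := (key x hx).2 hux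
      have := ka.2 ua
      rcases h' with rfl | rfl | rfl <;> omega
    exact HasC.of_triple hQ hR h hn ha hb hc hd hU3 ra rb rc rd re rf (this b hb (by simp))
      (this c hc (by simp)) (this d hd (by simp))

end

section
variable {α β : Type*} {H : α → β → Prop}

theorem HasC.of_block {Q : Finset α} {V : Finset β} (hQ : 4 ≤ #Q) (hV : 4 ≤ #V)
    (h : ∀ a ∈ Q, ∀ b ∈ V, H a b) : HasC 4 H := by
  obtain ⟨a, ha, b, hb, c, hc, d, hd, hn⟩ := exists_four hQ
  obtain ⟨w, hw, x, hx, y, hy, z, hz, hn'⟩ := exists_four hV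
  exact HasC.of_four hn hn' (h a ha w hw) (h b hb w hw) (h b hb x hx) (h c hc x hx) (h c hc y hy)
    (h d hd y hy) (h d hd z hz) (h a ha z hz)

theorem HasC.of_meet [DecidableEq β] {Q : Finset α} {R : Finset β} {t : ℕ} {C : Refute.Cert}
    (hC : C.Refutes 6 7 7 7 (Refute.sideMeet t)) (hD : C.D = []) (hQ : 6 ≤ #Q) (hR : #R = 7)
    (h : ∀ a ∈ Q, #(nb H R a) = 4) {a b : α} (ha : a ∈ Q) (hb : b ∈ Q) (hab : a ≠ b)
    (ht : #(nb H R a ∩ nb H R b) = t) : HasC 4 H := by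
  by_contra h₄
  obtain ⟨f, hf, hfQ, hfl⟩ := exists_enum_list (n := 5) (l := [a, b]) hQ (by simp [hab])
    (by simp [*])
  have f0 : f 0 = a := hfl 0 (by simp)
  have f1 : f 1 = b := hfl 1 (by simp)
  obtain ⟨g, hg, hgR, hgV⟩ := exists_enum_chain hR
    (inter_subset_left (s₁ := nb H R a) (s₂ := nb H R b))
    (subset_union_left (s₂ := nb H R b)) (Subset.refl _) (union_subset nb_subset nb_subset)
  have hu := card_union_add_card_inter (nb H R a) (nb H R b)
  rw [ht, h a ha, h b hb] at hu
  rw [ht, h a ha] at hgV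
  have ht4 := ht ▸ h a ha ▸ card_le_card (inter_subset_left (s₁ := nb H R a) (s₂ := nb H R b))
  have hu7 := hR ▸ card_le_card (union_subset (nb_subset (H := H) (R := R) (a := a))
    (nb_subset (H := H) (R := R) (a := b)))
  have ta : ∀ j < 7, (H a (g j) ↔ j < 4) ∧ (H b (g j) ↔ j < t ∨ 4 ≤ j ∧ j < 8 - t) :=
    fun j hj => by
    obtain ⟨h0, h1, h2, -⟩ := hgV j hj
    simp only [mem_inter, mem_union, mem_nb, hgR j hj, true_and] at h0 h1 h2
    refine ⟨h1, ?_⟩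
    rw [h1] at h0 h2
    by_cases hb : H b (g j) <;> simp only [hb, and_true, and_false, or_true, or_false, true_iff,
      false_iff] at h0 h2 ⊢ <;> omega
  refine hC.false hf hg (fun _ => h₄) (fun h => (h hD).elim) ?_
  simp only [Refute.sideMeet, Refute.holds_append]
  refine ⟨⟨?_, ?_⟩, ?_⟩
  · exact Refute.holds_rowsAtLeast hR hg hgR fun i hi => (h _ (hfQ i hi)).ge
  · refine Refute.holds_row ?_ fun j hj => ?_
    · simp [f0, ta]
    · rw [f0, (ta j hj).1]; simp; omega
  · refine Refute.holds_row (fun j hj => ?_) fun j hj hj' => ?_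
    · simp only [List.mem_append, List.mem_range, List.mem_map] at hj
      obtain hj | ⟨i, hi, rfl⟩ := hj
      · rw [f1, (ta j (by omega)).2]; omega
      · rw [f1, (ta _ (by omega)).2]; omega
    · simp only [List.mem_append, List.mem_range, List.mem_map] at hj'
      rw [f1, (ta j hj).2]
      intro hj2
      obtain hj2 | hj2 := hj2
      · exact hj' (Or.inl hj2)
      · exact hj' (Or.inr ⟨j - 4, by omega, by omega⟩)

theorem HasC.of_blocks [DecidableEq α] [DecidableEq β] {P Q W : Finset α} {R S T : Finset β}
    {c : β} (hP : #P = 3) (hQ : #Q = 3) (hW : #W = 3) (hPQ : Disjoint P Q)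
    (hPW : Disjoint (P ∪ Q) W) (hR : #R = 7) (hS : #S = 4) (hT : #T = 4) (hSR : S ⊆ R)
    (hTR : T ⊆ R) (hST : S ∩ T = {c}) (h₁ : ∀ a ∈ P, ∀ b ∈ S, H a b)
    (h₂ : ∀ a ∈ Q, ∀ b ∈ T, H a b) (h₃ : ∀ a ∈ W, ¬ H a c) :
    HasC 4 H ∨ HasC 7 fun a b => ¬ H a b := by
  by_contra! h
  have hc := hST ▸ mem_singleton_self c
  rw [mem_inter] at hc
  have hPQ' := card_union_of_disjoint hPQ
  have hall := card_union_of_disjoint hPW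
  have hST' := card_union_add_card_inter S T
  rw [hST, card_singleton, hS, hT] at hST'
  have hSTR : S ∪ T = R := eq_of_subset_of_card_le (union_subset hSR hTR) (by omega)
  obtain ⟨f, hf, hfU, hfV⟩ := exists_enum_chain (n := 8) (U := (P ∪ Q) ∪ W) (by omega)
    (subset_union_left (s₁ := P) (s₂ := Q)) (Subset.refl _) (Subset.refl _) subset_union_left
  obtain ⟨g, hg, hgR, hgV⟩ := exists_enum_chain hR (erase_subset c S) (Subset.refl _)
    (Subset.refl _) hSR
  rw [hPQ', hP, hQ] at hfV
  rw [card_erase_of_mem hc.1, hS] at hgV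
  have fP : ∀ i < 3, f i ∈ P := fun i hi => (hfV i (by omega)).1.2 hi
  have fQ : ∀ i < 6, 3 ≤ i → f i ∈ Q := fun i hi hi' =>
    (mem_union.1 ((hfV i (by omega)).2.1.2 hi)).resolve_left fun h => by
      have := (hfV i (by omega)).1.1 h
      omega
  have fW : ∀ i < 9, 6 ≤ i → f i ∈ W := fun i hi hi' =>
    (mem_union.1 (hfU i hi)).resolve_left fun h => by
      have := (hfV i hi).2.1.1 h
      omega
  have gS : ∀ j < 4, g j ∈ S := fun j hj => (hgV j (by omega)).2.1.2 hj
  have g3 : g 3 = c := by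
    by_contra h
    have := (hgV 3 (by omega)).1.1 (mem_erase.2 ⟨h, gS 3 (by omega)⟩)
    omega
  have gT : ∀ j < 7, 3 ≤ j → g j ∈ T := fun j hj hj' => by
    obtain rfl | hj3 := hj'.eq_or_lt
    · rw [g3]; exact hc.2
    · have := hgR j hj
      rw [← hSTR, mem_union] at this
      exact this.resolve_left fun h => by
        have := (hgV j (by omega)).2.1.1 h
        omega
  refine Refute.certBlocks_refutes.false hf hg (fun _ => h.1) (fun _ => h.2) ?_
  simp only [Refute.sideBlocks, Refute.holds_append, Refute.holds_ones, Refute.holds_zeros,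
    Refute.mem_rect]
  simp only [List.mem_cons, List.not_mem_nil, or_false]
  refine ⟨⟨?_, ?_⟩, ?_⟩ <;> rintro ⟨i, j⟩ he <;> dsimp only at he ⊢
  · exact h₁ _ (fP i (by omega)) _ (gS j (by omega))
  · exact h₂ _ (fQ i (by omega) (by omega)) _ (gT j (by omega) (by omega))
  · rw [he.2, g3]
    exact h₃ _ (fW i (by omega) (by omega))

theorem HasC.of_six_rows_seven {Q L : Finset α} {R B : Finset β} (hQ : 6 ≤ #Q) (hL : #L = 7)
    (hR : #R = 7) (h : ∀ a ∈ Q, 4 ≤ #(nb H R a)) (hB : #B = 3) (hBR : Disjoint R B)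
    (hLB : ∀ y ∈ R, ∀ b ∈ B, #(nb (flip H) L y) ≤ #(nb (flip H) L b)) :
    HasC 4 H ∨ HasC 7 fun a b => ¬ H a b := by
  classical
  by_contra! hcon
  obtain ⟨h₄, h₇⟩ := hcon
  obtain ⟨H', hH, h⟩ := exists_le_card_nb_eq h
  have h₄' : ¬ HasC 4 H' := fun h => h₄ (h.mono hH)
  have hnb : ∀ {a b}, b ∈ nb H' R a → H a b := fun h => hH _ _ (mem_nb.1 h).2
  have hpair : ∀ a ∈ Q, ∀ b ∈ Q, nb H' R a ≠ nb H' R b → #(nb H' R a ∩ nb H' R b) = 1 := by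
    intro a ha b hb hne
    have hab : a ≠ b := fun h => hne (h ▸ rfl)
    have h1 := card_union_add_card_inter (nb H' R a) (nb H' R b)
    have h2 := card_le_card (union_subset (nb_subset (H := H') (R := R) (a := a))
      (nb_subset (H := H') (R := R) (a := b)))
    have h3 := card_lt_card ((inter_subset_left : nb H' R a ∩ nb H' R b ⊆ _).ssubset_of_ne
      fun h' => hne (eq_of_subset_of_card_le (inter_eq_left.1 h') (by rw [h a ha, h b hb])))
    rw [h a ha] at h1 h3
    rw [h b hb] at h1
    have h4 : #(nb H' R a ∩ nb H' R b) ≠ 2 := fun h' => h₄' (HasC.of_meet Refute.certMeetTwo_refutes rfl hQ hR h ha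
      hb hab h')
    have h5 : #(nb H' R a ∩ nb H' R b) ≠ 3 := fun h' => h₄' (HasC.of_meet Refute.certMeetThree_refutes rfl hQ hR h
      ha hb hab h')
    omega
  have hclass : ∀ a ∈ Q, #{x ∈ Q | nb H' R x = nb H' R a} ≤ 3 := by
    intro a ha
    by_contra! h4
    refine h₄ (HasC.of_block h4 (h a ha).ge fun x hx y hy => ?_)
    rw [← (mem_filter.1 hx).2] at hy
    exact hnb hy
  obtain ⟨a, ha⟩ := card_pos.1 (by omega : 0 < #Q)
  have hsum := card_filter_add_card_filter_not (s := Q) (fun x => nb H' R x = nb H' R a)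
  have hca := hclass a ha
  obtain ⟨b, hb⟩ := card_pos.1 (by omega : 0 < #{x ∈ Q | ¬ nb H' R x = nb H' R a})
  rw [mem_filter] at hb
  have hab := hpair b hb.1 a ha hb.2
  have hrest : {x ∈ Q | ¬ nb H' R x = nb H' R a} ⊆ {x ∈ Q | nb H' R x = nb H' R b} := by
    intro x hx
    rw [mem_filter] at hx ⊢
    refine ⟨hx.1, ?_⟩
    by_contra hxb
    have h1 := card_union_three (nb H' R b) (nb H' R a) (nb H' R x)
    rw [hab, inter_comm _ (nb H' R x), inter_comm _ (nb H' R x), hpair x hx.1 a ha hx.2,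
      hpair x hx.1 b hb.1 hxb, h a ha, h b hb.1, h x hx.1] at h1
    have h2 := card_le_card (union_subset (union_subset (nb_subset (H := H') (R := R) (a := b))
      (nb_subset (H := H') (R := R) (a := a))) (nb_subset (H := H') (R := R) (a := x)))
    omega
  have hcb := hclass b hb.1
  have hrc := card_le_card hrest
  rw [inter_comm] at hab
  obtain ⟨c, hc⟩ := card_eq_one.1 hab
  have hcm : c ∈ nb H' R a ∩ nb H' R b := hc ▸ mem_singleton_self c
  rw [mem_inter] at hcm
  have hcR : c ∈ R := nb_subset hcm.1
  have hcL : #(nb (flip H) L c) ≤ 4 := by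
    by_contra! h5
    have hcB : c ∉ B := Finset.disjoint_left.1 hBR hcR
    refine h₄ (HasC.swap (HasC.of_four_rows (H := flip H) (Q := insert c B) (R := L) (k := 5) ?_
      (fun y hy => ?_) (by omega) (by omega)))
    · rw [card_insert_of_notMem hcB]; omega
    · obtain rfl | hy := mem_insert.1 hy
      · exact h5
      · exact h5.trans_le (hLB c hcR y hy)
  obtain ⟨W, hW, hW3⟩ := exists_subset_card_eq (s := L \ nb (flip H) L c) (n := 3) (by
    have := card_sdiff_add_card_eq_card (nb_subset (H := flip H) (R := L) (a := c))
    omega)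
  have hWc : ∀ x ∈ W, ¬ H x c := fun x hx hxc => by
    have := mem_sdiff.1 (hW hx)
    exact this.2 (mem_nb.2 ⟨this.1, hxc⟩)
  have hPS : ∀ x ∈ Q.filter (fun x => nb H' R x = nb H' R a), ∀ y ∈ nb H' R a, H x y := by
    intro x hx y hy
    rw [← (mem_filter.1 hx).2] at hy
    exact hnb hy
  have hQT : ∀ x ∈ Q.filter (fun x => ¬ nb H' R x = nb H' R a), ∀ y ∈ nb H' R b, H x y := by
    intro x hx y hy
    rw [← (mem_filter.1 (hrest hx)).2] at hy
    exact hnb hy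
  have hd : Disjoint ({x ∈ Q | nb H' R x = nb H' R a} ∪ {x ∈ Q | ¬ nb H' R x = nb H' R a}) W := by
    rw [disjoint_right]
    intro x hx hx'
    obtain hx' | hx' := mem_union.1 hx'
    · exact hWc x hx (hPS x hx' c hcm.1)
    · exact hWc x hx (hQT x hx' c hcm.2)
  obtain h | h := HasC.of_blocks (H := H) (P := {x ∈ Q | nb H' R x = nb H' R a})
    (Q := {x ∈ Q | ¬ nb H' R x = nb H' R a}) (W := W) (R := R) (S := nb H' R a) (T := nb H' R b)
    (by omega) (by omega) hW3 (disjoint_filter_filter_not _ _ _) hd hR (h a ha) (h b hb.1)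
    nb_subset nb_subset hc hPS hQT hWc
  · exact h₄ h
  · exact h₇ h

end

section
variable {α β : Type*} {H : α → β → Prop}

/-- Rows of size 3 in five columns contain a block of size 3 by 3. -/
theorem exists_block_five {Q : Finset α} {R : Finset β} (hQ : 5 ≤ #Q) (hR : #R = 5)
    (h : ∀ a ∈ Q, 3 ≤ #(nb H R a)) : HasC 4 H ∨
      ∃ P S, #P = 3 ∧ #S = 3 ∧ P ⊆ Q ∧ S ⊆ R ∧ ∀ a ∈ P, ∀ b ∈ S, H a b := by
  classical
  by_contra! hcon
  obtain ⟨h₄, h₃⟩ := hcon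
  obtain ⟨f, hf, hfQ, -⟩ := exists_enum_list (n := 4) (l := []) hQ (by simp) (by simp)
  obtain ⟨V, hV, hV3⟩ := exists_subset_card_eq (h _ (hfQ 0 (by omega)))
  obtain ⟨g, hg, hgR, hgV⟩ := exists_enum_chain hR (Subset.refl V) (Subset.refl V) (Subset.refl V)
    (hV.trans nb_subset)
  rw [hV3] at hgV
  refine Refute.certFive_refutes.false hf hg (fun _ => h₄) (fun h => (h rfl).elim) ?_
  simp only [Refute.sideFive, Refute.holds_append]
  refine ⟨⟨?_, ?_⟩, ?_⟩
  · exact Refute.holds_rowsAtLeast hR hg hgR fun i hi => h _ (hfQ i hi)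
  · rw [Refute.holds_ones]
    rintro ⟨i, j⟩ he
    simp only [Refute.mem_rect, List.mem_cons, List.not_mem_nil, or_false] at he
    rw [he.1]
    exact (mem_nb.1 (hV ((hgV j (by omega)).1.2 (by omega)))).2
  · rw [Refute.holds_flatMap]
    intro K hK
    rw [Refute.holds_map]
    intro C hC
    right
    rw [List.mem_sublistsLen] at hK hC
    have hK1 : ∀ i ∈ K, i < 5 := fun i hi => List.mem_range.1 (hK.1.subset hi)
    have hC1 : ∀ i ∈ C, i < 5 := fun i hi => List.mem_range.1 (hC.1.subset hi)
    obtain ⟨a, ha, b, hb, hab⟩ := h₃ (K.toFinset.image f) (C.toFinset.image g)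
      (by rw [card_image_of_injOn (hf.mono fun i hi => hK1 i (by simpa using hi)),
        List.toFinset_card_of_nodup (hK.1.nodup List.nodup_range), hK.2])
      (by rw [card_image_of_injOn (hg.mono fun i hi => hC1 i (by simpa using hi)),
        List.toFinset_card_of_nodup (hC.1.nodup List.nodup_range), hC.2])
      (image_subset_iff.2 fun i hi => hfQ i (hK1 i (by simpa using hi)))
      (image_subset_iff.2 fun i hi => hgR i (hC1 i (by simpa using hi)))
    obtain ⟨i, hi, rfl⟩ := mem_image.1 ha
    obtain ⟨j, hj, rfl⟩ := mem_image.1 hb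
    exact ⟨(i, j), Refute.mem_rect.2 ⟨by simpa using hi, by simpa using hj⟩, hab⟩

theorem HasC.of_ears {P : Finset α} {S : Finset β} (hP : #P = 3) (hS : #S = 3)
    (h : ∀ a ∈ P, ∀ b ∈ S, H a b) {a : α} {b : β} (ha : a ∉ P) (hb : b ∉ S)
    (hb2 : 2 ≤ #(nb (flip H) P b)) (ha2 : 2 ≤ #(nb H S a)) : HasC 4 H := by
  classical
  obtain ⟨x₁, hx₁, x₂, hx₂, hx⟩ := one_lt_card.1 hb2
  obtain ⟨y₁, hy₁, y₂, hy₂, hy⟩ := one_lt_card.1 ha2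
  rw [mem_nb] at hx₁ hx₂ hy₁ hy₂
  obtain ⟨x₃, hx₃, hx₃'⟩ := exists_mem_notMem_of_card_lt_card (s := {x₁, x₂}) (t := P)
    (by rw [card_pair hx]; omega)
  obtain ⟨y₃, hy₃, hy₃'⟩ := exists_mem_notMem_of_card_lt_card (s := {y₁, y₂}) (t := S)
    (by rw [card_pair hy]; omega)
  have n₁ : x₁ ≠ a := fun h => ha (h ▸ hx₁.1)
  have n₂ : x₂ ≠ a := fun h => ha (h ▸ hx₂.1)
  have n₃ : a ≠ x₃ := fun h => ha (h ▸ hx₃)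
  have n₄ : b ≠ y₁ := fun h => hb (h ▸ hy₁.1)
  have n₅ : b ≠ y₂ := fun h => hb (h ▸ hy₂.1)
  have n₆ : b ≠ y₃ := fun h => hb (h ▸ hy₃)
  simp only [mem_insert, mem_singleton, not_or] at hx₃' hy₃'
  refine HasC.of_four (a := x₁) (b := x₂) (c := a) (d := x₃) (w := b) (x := y₁) (y := y₂)
    (z := y₃) ?_ ?_ hx₁.2 hx₂.2 (h _ hx₂.1 _ hy₁.1) hy₁.2 hy₂.2 (h _ hx₃ _ hy₂.1) (h _ hx₃ _ hy₃)
    (h _ hx₁.1 _ hy₃)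
  · simp [hx, n₁, n₂, n₃, Ne.symm hx₃'.1, Ne.symm hx₃'.2]
  · simp [hy, n₄, n₅, n₆, Ne.symm hy₃'.1, Ne.symm hy₃'.2]

theorem exists_enum_monotone {U : Finset β} {n : ℕ} (hU : #U = n + 1) (key : β → ℕ) :
    ∃ f : ℕ → β, Set.InjOn f (Set.Iio (n + 1)) ∧ (∀ i < n + 1, f i ∈ U) ∧
      (∀ j < n + 1, ∀ i ≤ j, key (f i) ≤ key (f j)) := by
  have := card_pos_nonempty hU.ge
  obtain ⟨f, hf, hfU, hk⟩ := exists_enum U key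
  rw [hU] at hf hfU hk
  exact ⟨f, hf, hfU, fun j hj i hij =>
    (hk _ i (by omega)).2 (hij.trans_lt ((hk _ j hj).1 le_rfl))⟩

theorem injOn_ite {f g : ℕ → α} {U V : Finset α} {k n : ℕ} (hf : Set.InjOn f (Set.Iio k))
    (hfU : ∀ i < k, f i ∈ U) (hg : Set.InjOn g (Set.Iio n)) (hgV : ∀ i < n, g i ∈ V)
    (hUV : Disjoint U V) :
    Set.InjOn (fun i => if i < k then f i else g (i - k)) (Set.Iio (k + n)) := by
  rw [Finset.disjoint_left] at hUV
  intro i hi j hj h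
  rw [Set.mem_Iio] at hi hj
  dsimp only at h
  split_ifs at h with h1 h2 h2
  · exact hf h1 h2 h
  · exact (hUV (hfU i h1) (h ▸ hgV _ (by omega))).elim
  · exact (hUV (hfU j h2) (h ▸ hgV _ (by omega))).elim
  · have := hg (Set.mem_Iio.2 (by omega)) (Set.mem_Iio.2 (by omega)) h
    omega

/-- Enumerations of three rows and of columns with at most one neighbour among these rows, sorted by
that neighbour. -/
theorem exists_enum_labels {P : Finset α} {U : Finset β} {n : ℕ} (hP : #P = 3) (hU : #U = n + 1)
    (h : ∀ b ∈ U, #(nb (flip H) P b) ≤ 1) (tie : β → Prop) : ∃ (f : ℕ → α) (g : ℕ → β) (l m k : ℕ),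
      Set.InjOn f (Set.Iio 3) ∧ (∀ i < 3, f i ∈ P) ∧ Set.InjOn g (Set.Iio (n + 1)) ∧
      (∀ i < n + 1, g i ∈ U) ∧ m ≤ l ∧ k ≤ m ∧ l + m + k ≤ n + 1 ∧
      (∀ j < n + 1, ∀ i < 3, H (f i) (g j) ↔ Refute.lab l (l + m) (l + m + k) j = i) ∧
      ∀ j < n, Refute.lab l (l + m) (l + m + k) j = Refute.lab l (l + m) (l + m + k) (j + 1) →
        tie (g (j + 1)) → tie (g j) := by
  classical
  obtain ⟨f, hf, hfP, hfk⟩ := exists_enum_monotone hP fun a => #U - #(nb H U a)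
  have := card_pos_nonempty hU.ge
  have hone : ∀ b ∈ U, ∀ i < 3, ∀ j < 3, H (f i) b → H (f j) b → i = j := by
    intro b hb i hi j hj h1 h2
    exact hf hi hj (card_le_one.1 (h b hb) _ (mem_nb.2 ⟨hfP i hi, h1⟩) _ (mem_nb.2 ⟨hfP j hj, h2⟩))
  set lb : β → ℕ := fun b => if H (f 0) b then 0 else if H (f 1) b then 1 else
    if H (f 2) b then 2 else 3 with hlb
  have hH : ∀ b ∈ U, ∀ i < 3, H (f i) b ↔ lb b = i := by
    intro b hb i hi
    have h01 := hone b hb 0 (by omega) 1 (by omega)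
    have h02 := hone b hb 0 (by omega) 2 (by omega)
    have h12 := hone b hb 1 (by omega) 2 (by omega)
    interval_cases i <;> simp only [hlb] <;> split_ifs <;> simp_all
  obtain ⟨g, hg, hgU, hgk⟩ := exists_enum U fun b => 2 * lb b + if tie b then 0 else 1
  rw [hU] at hg hgU hgk
  have hc : ∀ i < 3, nb H U (f i) = {b ∈ U | lb b = i} := fun i hi => by
    ext b
    simp +contextual [hH, hi]
  have hle : ∀ i, #{b ∈ U | lb b ≤ i + 1} = #{b ∈ U | lb b ≤ i} + #{b ∈ U | lb b = i + 1} := by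
    intro i
    rw [← card_union_of_disjoint (disjoint_filter.2 fun _ _ h1 => by omega), ← filter_or]
    simp only [Nat.le_succ_iff]
  have hle0 := filter_congr (s := U) (p := fun b => lb b ≤ 0) (q := fun b => lb b = 0) (by simp)
  have hgl : ∀ j < n + 1, ∀ i, lb (g j) ≤ i ↔ j < #{b ∈ U | lb b ≤ i} := fun j hj i => by
    have e : ∀ b, lb b ≤ i ↔ (2 * lb b + if tie b then 0 else 1) ≤ 2 * i + 1 := fun b => by
      split_ifs <;> omega
    simp only [e]
    exact hgk _ j hj
  have h1 := hle 0
  have h2 := hle 1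
  rw [hle0] at h1
  norm_num at h1 h2
  rw [← hc 0 (by omega), ← hc 1 (by omega)] at h1
  rw [← hc 2 (by omega), h1] at h2
  have hlab : ∀ j < n + 1, Refute.lab #(nb H U (f 0)) (#(nb H U (f 0)) + #(nb H U (f 1)))
      (#(nb H U (f 0)) + #(nb H U (f 1)) + #(nb H U (f 2))) j = lb (g j) := by
    intro j hj
    have e0 := hgl j hj 0
    have e1 := hgl j hj 1
    have e2 := hgl j hj 2
    rw [hle0, ← hc 0 (by omega)] at e0
    rw [h1] at e1
    rw [h2] at e2
    have e3 : lb (g j) ≤ 3 := by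
      simp only [hlb]
      split_ifs <;> omega
    rw [Refute.lab]
    split_ifs <;> omega
  have hs : ∀ i, #(nb H U (f i)) ≤ #U := fun i => card_le_card nb_subset
  refine ⟨f, g, #(nb H U (f 0)), #(nb H U (f 1)), #(nb H U (f 2)), hf, hfP, hg, hgU, ?_, ?_, ?_,
    fun j hj i hi => ?_, fun j hj hl ht => ?_⟩
  · have := hfk 1 (by omega) 0 (by omega)
    have := hs 0
    have := hs 1
    omega
  · have := hfk 2 (by omega) 1 (by omega)
    have := hs 1
    have := hs 2
    omega
  · rw [← h2, ← hU]
    exact card_le_card (filter_subset _ _)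
  · rw [hlab j hj]
    exact hH _ (hgU j hj) i hi
  · rw [hlab j (by omega), hlab (j + 1) (by omega)] at hl
    have h3 := (hgk (2 * lb (g (j + 1)) + 0) (j + 1) (by omega)).1 (by simp [ht])
    have h4 := (hgk (2 * lb (g (j + 1)) + 0) j (by omega)).2 (by omega)
    by_contra ht'
    simp [ht', hl] at h4

end

namespace Refute

theorem exists_refutes_sideEight {l m k : ℕ} (hm : m ≤ l) (hk : k ≤ m) (hs : l + m + k ≤ 5) :
    ∃ C : Cert, C.Refutes 8 8 8 5 (sideEight l (l + m) (l + m + k)) := by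
  have hl : l ≤ 5 := by omega
  interval_cases l <;> interval_cases m <;> (try omega) <;> interval_cases k <;> try omega
  · exact ⟨_, certEight000_refutes⟩
  · exact ⟨_, certEight111_refutes⟩
  · exact ⟨_, certEight122_refutes⟩
  · exact ⟨_, certEight123_refutes⟩
  · exact ⟨_, certEight222_refutes⟩
  · exact ⟨_, certEight233_refutes⟩
  · exact ⟨_, certEight234_refutes⟩
  · exact ⟨_, certEight244_refutes⟩
  · exact ⟨_, certEight245_refutes⟩
  · exact ⟨_, certEight333_refutes⟩
  · exact ⟨_, certEight344_refutes⟩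
  · exact ⟨_, certEight345_refutes⟩
  · exact ⟨_, certEight355_refutes⟩
  · exact ⟨_, certEight444_refutes⟩
  · exact ⟨_, certEight455_refutes⟩
  · exact ⟨_, certEight555_refutes⟩

theorem exists_refutes_sideNine {l m k : ℕ} (hm : m ≤ l) (hk : k ≤ m) (hs : l + m + k ≤ 3) :
    ∃ C : Cert, C.Refutes 9 9 9 6 (sideNine l (l + m) (l + m + k)) := by
  have hl : l ≤ 3 := by omega
  interval_cases l <;> interval_cases m <;> (try omega) <;> interval_cases k <;> try omega
  · exact ⟨_, certNine000_refutes⟩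
  · exact ⟨_, certNine111_refutes⟩
  · exact ⟨_, certNine122_refutes⟩
  · exact ⟨_, certNine123_refutes⟩
  · exact ⟨_, certNine222_refutes⟩
  · exact ⟨_, certNine233_refutes⟩
  · exact ⟨_, certNine333_refutes⟩

theorem holds_labels {h : ℕ → ℕ → Prop} {n o a b c : ℕ}
    (H : ∀ j < n, ∀ i < 3, h i (o + j) ↔ lab a b c j = i) : Holds h (labels n o a b c) := by
  rw [labels, holds_flatMap]
  intro j hj
  rw [holds_append, holds_ones, holds_zeros]
  rw [List.mem_range] at hj
  constructor <;> intro e he <;>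
    simp only [List.mem_map, List.mem_filter, List.mem_range, beq_iff_eq, bne_iff_ne] at he <;>
    obtain ⟨i, ⟨hi, hij⟩, rfl⟩ := he
  · exact (H j hj i hi).2 hij.symm
  · exact fun h => hij ((H j hj i hi).1 h).symm

end Refute

section
variable {α β : Type*} {H : α → β → Prop}

open Classical in
theorem exists_le_of_ite_le {p q : ℕ → Prop}
    (h : (if p 0 then 0 else if p 1 then 1 else if p 2 then 2 else 3) ≤
      if q 0 then 0 else if q 1 then 1 else if q 2 then 2 else 3) {c : ℕ} (hc : c < 3) (hq : q c) :
    ∃ i ≤ c, p i := by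
  by_contra! hp
  have h0 := hp 0
  have h1 := hp 1
  have h2 := hp 2
  clear hp
  interval_cases c <;> split_ifs at h <;> simp_all

theorem HasC.of_block_eight {P A : Finset α} {S U : Finset β} (hP : #P = 3) (hA : #A = 5)
    (hPA : Disjoint P A) (hS : #S = 3) (hU : #U = 5) (hSU : Disjoint S U)
    (h : ∀ a ∈ P, ∀ b ∈ S, H a b) (hl : ∀ b ∈ U, #(nb (flip H) P b) ≤ 1) :
    HasC 4 H ∨ HasC 5 fun a b => ¬ H a b := by
  classical
  by_contra! hcon
  obtain ⟨s, hs, hsS, -⟩ := exists_enum_monotone hS fun _ => 0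
  obtain ⟨t, ht, htA, htk⟩ := exists_enum_monotone hA fun a =>
    if H a (s 0) then 0 else if H a (s 1) then 1 else if H a (s 2) then 2 else 3
  obtain ⟨f, g, l, m, k, hf, hfP, hg, hgU, hm, hk, hlm, hH, htie⟩ :=
    exists_enum_labels hP hU hl fun b => H (t 4) b
  obtain ⟨C, hC⟩ := Refute.exists_refutes_sideEight hm hk hlm
  refine hC.false (injOn_ite hf hfP ht htA hPA) (injOn_ite hs hsS hg hgU hSU) (fun _ => hcon.1)
    (fun _ => hcon.2) ?_
  simp only [Refute.sideEight, Refute.holds_append]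
  refine ⟨⟨⟨?_, ?_⟩, ?_⟩, ?_⟩
  · rw [Refute.holds_ones]
    rintro ⟨i, j⟩ he
    simp only [Refute.mem_rect, List.mem_cons, List.not_mem_nil, or_false] at he
    dsimp only
    rw [if_pos (by omega), if_pos (by omega)]
    exact h _ (hfP i (by omega)) _ (hsS j (by omega))
  · refine Refute.holds_labels fun j hj i hi => ?_
    rw [if_pos hi, if_neg (by omega), Nat.add_sub_cancel_left]
    exact hH j hj i hi
  · have key : ∀ r, 3 ≤ r → r ≤ 6 → ∀ c < 3, H (t (r + 1 - 3)) (s c) →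
        ∃ i ≤ c, H (t (r - 3)) (s i) := by
      intro r hr hr' c hc hrc
      exact exists_le_of_ite_le (p := fun c => H (t (r - 3)) (s c))
        (q := fun c => H (t (r + 1 - 3)) (s c)) (htk _ (by omega) _ (by omega)) hc hrc
    have key' : ∀ r, 3 ≤ r → r ≤ 6 → ∀ c < 3,  Refute.Holds (fun i j =>
        H (if i < 3 then f i else t (i - 3)) (if j < 3 then s j else g (j - 3)))
        (Refute.imp (Refute.rect [r] (List.range (c + 1)))
          (Refute.rect [r + 1] (List.range (c + 1)))) := by
      intro r hr hr' c hc
      rw [Refute.holds_imp]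
      rintro ⟨i, j⟩ he
      simp only [Refute.mem_rect, List.mem_cons, List.not_mem_nil, or_false, List.mem_range] at he
      obtain ⟨rfl, hj⟩ := he
      dsimp only
      rw [if_neg (by omega), if_pos (by omega)]
      intro hrj
      obtain ⟨i, hi, hri⟩ := key r hr hr' j (by omega) hrj
      refine ⟨(r, i), Refute.mem_rect.2 ⟨by simp, List.mem_range.2 (by omega)⟩, ?_⟩
      dsimp only
      rwa [if_neg (by omega), if_pos (by omega)]
    rw [Refute.holds_flatMap]
    intro r hr
    simp only [List.mem_cons, List.not_mem_nil, or_false] at hr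
    rw [Refute.holds_flatMap]
    simp only [List.forall_mem_cons, List.not_mem_nil, false_imp_iff, implies_true, and_true]
    exact ⟨key' r (by omega) (by omega) 0 (by omega), key' r (by omega) (by omega) 1 (by omega),
      key' r (by omega) (by omega) 2 (by omega)⟩
  · rw [Refute.holds_flatMap]
    intro j hj
    rw [List.mem_range] at hj
    split_ifs with hlab
    · rw [Refute.holds_imp]
      simp only [List.mem_singleton, forall_eq, exists_eq_left]
      have e : 4 + j - 3 = j + 1 := by omega
      rw [if_neg (by omega), if_neg (by omega), if_neg (by omega), Nat.add_sub_cancel_left, e]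
      exact htie j hj hlab
    · exact Refute.holds_nil

end

section
variable {α β : Type*} {H : α → β → Prop}

theorem card_nb_le_one_or {P : Finset α} {S : Finset β} (hP : #P = 3) (hS : #S = 3)
    (h : ∀ a ∈ P, ∀ b ∈ S, H a b) (h₄ : ¬ HasC 4 H) :
    (∀ b ∉ S, #(nb (flip H) P b) ≤ 1) ∨ ∀ a ∉ P, #(nb H S a) ≤ 1 := by
  by_contra! hcon
  obtain ⟨⟨b, hb, hb2⟩, a, ha, ha2⟩ := hcon
  exact h₄ (HasC.of_ears hP hS h ha hb hb2 ha2)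

theorem HasC.of_five_rows [Fintype α] [Fintype β] {Q : Finset α} {R : Finset β}
    (hα : Fintype.card α = 8) (hβ : Fintype.card β = 8) (hQ : 5 ≤ #Q) (hR : #R = 5)
    (h : ∀ a ∈ Q, 3 ≤ #(nb H R a)) : HasC 4 H ∨ HasC 5 fun a b => ¬ H a b := by
  classical
  by_contra! hcon
  obtain h₄ | ⟨P, S, hP, hS, -, -, hPS⟩ := exists_block_five hQ hR h
  · exact hcon.1 h₄
  have hP' : #Pᶜ = 5 := by rw [card_compl, hα, hP]
  have hS' : #Sᶜ = 5 := by rw [card_compl, hβ, hS]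
  obtain hl | hl := card_nb_le_one_or hP hS hPS hcon.1
  · obtain h | h := HasC.of_block_eight hP hP' disjoint_compl_right hS hS' disjoint_compl_right hPS
      fun b hb => hl b (mem_compl.1 hb)
    · exact hcon.1 h
    · exact hcon.2 h
  · obtain h | h := HasC.of_block_eight (H := flip H) hS hS' disjoint_compl_right hP hP'
      disjoint_compl_right (fun b hb a ha => hPS a ha b hb) fun a ha => hl a (mem_compl.1 ha)
    · exact hcon.1 h.swap
    · exact hcon.2 h.swap

theorem exists_enum_three [DecidableEq α] {f g h : ℕ → α} {U V W : Finset α}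
    (hf : Set.InjOn f (Set.Iio 3)) (hfU : ∀ i < 3, f i ∈ U) (hg : Set.InjOn g (Set.Iio 3))
    (hgV : ∀ i < 3, g i ∈ V) (hh : Set.InjOn h (Set.Iio 3)) (hhW : ∀ i < 3, h i ∈ W)
    (hUV : Disjoint U V) (hW : Disjoint (U ∪ V) W) : ∃ F : ℕ → α, Set.InjOn F (Set.Iio 9) ∧
      (∀ i < 6, F i ∈ U ∪ V) ∧ ∀ i < 3, F i = f i ∧ F (3 + i) = g i ∧ F (6 + i) = h i := by
  have hm : ∀ i < 6, (if i < 3 then f i else g (i - 3)) ∈ U ∪ V := fun i hi => by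
    split_ifs with h3
    · exact mem_union_left _ (hfU i h3)
    · exact mem_union_right _ (hgV _ (by omega))
  refine ⟨_, injOn_ite (k := 6) (n := 3) (injOn_ite (k := 3) (n := 3) hf hfU hg hgV hUV) hm hh hhW
    hW, fun i hi => ?_, fun i hi => ⟨?_, ?_, ?_⟩⟩
  · rw [if_pos hi]; exact hm i hi
  · rw [if_pos (by omega), if_pos hi]
  · rw [if_pos (by omega), if_neg (by omega), Nat.add_sub_cancel_left]
  · rw [if_neg (by omega), Nat.add_sub_cancel_left]

theorem HasC.of_block_nine {X W A : Finset α} {Y Z B : Finset β} [DecidableEq α] [DecidableEq β]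
    (hX : #X = 3) (hW : #W = 3) (hA : #A = 3) (hXW : Disjoint X W) (hXA : Disjoint (X ∪ W) A)
    (hY : #Y = 3) (hZ : #Z = 3) (hB : #B = 3) (hYZ : Disjoint Y Z) (hYB : Disjoint (Y ∪ Z) B)
    (h : ∀ a ∈ X, ∀ b ∈ Y, H a b) (h₁ : ∀ a ∈ X, ∀ b ∈ Z, ¬ H a b)
    (h₂ : ∀ a ∈ W, ∀ b ∈ Y, ¬ H a b) (hAd : ∀ a ∈ A, 3 ≤ #(nb H (Y ∪ Z) a))
    (hBd : ∀ b ∈ B, 3 ≤ #(nb (flip H) (X ∪ W) b)) (hl : ∀ b ∈ B, #(nb (flip H) X b) ≤ 1) :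
    HasC 4 H ∨ HasC 6 fun a b => ¬ H a b := by
  classical
  by_contra! hcon
  have hXW' := card_union_of_disjoint hXW
  have hYZ' := card_union_of_disjoint hYZ
  rw [hX, hW] at hXW'
  rw [hY, hZ] at hYZ'
  obtain ⟨x, b, l, m, k, hx, hxX, hb, hbB, hm, hk, hlm, hH, -⟩ :=
    exists_enum_labels hX hB hl fun _ => True
  obtain ⟨w, hw, hwW, hwk⟩ := exists_enum_monotone hW fun w => if H w (b 0) then 0 else 1
  obtain ⟨a, ha, haA, hak⟩ := exists_enum_monotone hA fun a => if H a (b 0) then 0 else 1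
  obtain ⟨y, hy, hyY, -⟩ := exists_enum_monotone hY fun _ => 0
  obtain ⟨z, hz, hzZ, hzk⟩ := exists_enum_monotone hZ fun z => if H (a 0) z then 0 else 1
  obtain ⟨f, hf, hfL, hfe⟩ := exists_enum_three hx hxX hw hwW ha haA hXW hXA
  obtain ⟨g, hg, hgR, hge⟩ := exists_enum_three hy hyY hz hzZ hb hbB hYZ hYB
  obtain ⟨C, hC⟩ := Refute.exists_refutes_sideNine hm hk hlm
  have fX : ∀ i < 3, f i ∈ X := fun i hi => (hfe i hi).1 ▸ hxX i hi
  have fW : ∀ i < 3, f (3 + i) ∈ W := fun i hi => (hfe i hi).2.1 ▸ hwW i hi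
  have fA : ∀ i < 3, f (6 + i) ∈ A := fun i hi => (hfe i hi).2.2 ▸ haA i hi
  have gY : ∀ i < 3, g i ∈ Y := fun i hi => (hge i hi).1 ▸ hyY i hi
  have gZ : ∀ i < 3, g (3 + i) ∈ Z := fun i hi => (hge i hi).2.1 ▸ hzZ i hi
  have gB : ∀ i < 3, g (6 + i) ∈ B := fun i hi => (hge i hi).2.2 ▸ hbB i hi
  have hcomp : ∀ {p q : Prop}, ((if q then 0 else 1) ≤ if p then 0 else 1) → p → q :=
    fun {p q} h hp => by
      by_contra hq
      simp [hp, hq] at h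
  have himp : ∀ i j i' j', (H (f i') (g j') → H (f i) (g j)) →
      Refute.Holds (fun i j => H (f i) (g j)) (Refute.imp [(i, j)] [(i', j')]) := by
    intro i j i' j' h
    rw [Refute.holds_imp]
    simpa using h
  refine hC.false hf hg (fun _ => hcon.1) (fun _ => hcon.2) ?_
  simp only [Refute.sideNine, Refute.holds_append]
  refine ⟨⟨⟨⟨⟨⟨⟨?_, ?_⟩, ?_⟩, ?_⟩, ?_⟩, ?_⟩, ?_⟩, ?_⟩
  · rw [Refute.holds_ones]
    rintro ⟨i, j⟩ he
    simp only [Refute.mem_rect, List.mem_cons, List.not_mem_nil, or_false] at he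
    exact h _ (fX i (by omega)) _ (gY j (by omega))
  · rw [Refute.holds_zeros]
    rintro ⟨i, j⟩ he
    simp only [Refute.mem_rect, List.mem_cons, List.not_mem_nil, or_false] at he
    obtain ⟨j, rfl⟩ := Nat.exists_eq_add_of_le (by omega : 3 ≤ j)
    exact h₁ _ (fX i (by omega)) _ (gZ j (by omega))
  · rw [Refute.holds_zeros]
    rintro ⟨i, j⟩ he
    simp only [Refute.mem_rect, List.mem_cons, List.not_mem_nil, or_false] at he
    obtain ⟨i, rfl⟩ := Nat.exists_eq_add_of_le (by omega : 3 ≤ i)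
    exact h₂ _ (fW i (by omega)) _ (gY j (by omega))
  · refine Refute.holds_labels fun j hj i hi => ?_
    rw [(hfe i hi).1, (hge j hj).2.2]
    exact hH j hj i hi
  · rw [Refute.holds_flatMap]
    simp only [List.forall_mem_cons, List.not_mem_nil, false_imp_iff, implies_true, and_true]
    have := fun i hi => Refute.holds_atLeast_row (f := f) (r := 6 + i) hYZ'
      (hg.mono (Set.Iio_subset_Iio (by omega))) hgR (hAd _ (fA i hi))
    exact ⟨this 0 (by omega), this 1 (by omega), this 2 (by omega)⟩
  · rw [Refute.holds_flatMap]
    simp only [List.forall_mem_cons, List.not_mem_nil, false_imp_iff, implies_true, and_true]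
    have := fun i hi => Refute.holds_atLeast_col (g := g) (c := 6 + i) hXW'
      (hf.mono (Set.Iio_subset_Iio (by omega))) hfL (hBd _ (gB i hi))
    exact ⟨this 0 (by omega), this 1 (by omega), this 2 (by omega)⟩
  · rw [Refute.holds_flatMap]
    simp only [List.forall_mem_cons, List.not_mem_nil, false_imp_iff, implies_true, and_true]
    have hw' : ∀ i < 2, H (f (3 + (i + 1))) (g (6 + 0)) → H (f (3 + i)) (g (6 + 0)) := by
      intro i hi
      rw [(hge 0 (by omega)).2.2, (hfe i (by omega)).2.1, (hfe (i + 1) (by omega)).2.1]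
      exact hcomp (hwk (i + 1) (by omega) i (by omega))
    have ha' : ∀ i < 2, H (f (6 + (i + 1))) (g (6 + 0)) → H (f (6 + i)) (g (6 + 0)) := by
      intro i hi
      rw [(hge 0 (by omega)).2.2, (hfe i (by omega)).2.2, (hfe (i + 1) (by omega)).2.2]
      exact hcomp (hak (i + 1) (by omega) i (by omega))
    exact ⟨himp _ _ _ _ (hw' 0 (by omega)), himp _ _ _ _ (hw' 1 (by omega)),
      himp _ _ _ _ (ha' 0 (by omega)), himp _ _ _ _ (ha' 1 (by omega))⟩
  · rw [Refute.holds_flatMap]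
    simp only [List.forall_mem_cons, List.not_mem_nil, false_imp_iff, implies_true, and_true]
    have hz' : ∀ i < 2, H (f (6 + 0)) (g (3 + (i + 1))) → H (f (6 + 0)) (g (3 + i)) := by
      intro i hi
      rw [(hfe 0 (by omega)).2.2, (hge i (by omega)).2.1, (hge (i + 1) (by omega)).2.1]
      exact hcomp (hzk (i + 1) (by omega) i (by omega))
    exact ⟨himp _ _ _ _ (hz' 0 (by omega)), himp _ _ _ _ (hz' 1 (by omega))⟩

end

section
variable {α β : Type*} {H K : α → β → Prop}

theorem exists_mem_of_sublistsLen {R : Finset β} {g : ℕ → β} (hR : #R = 6)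
    (hg : Set.InjOn g (Set.Iio 6)) (hgR : ∀ j < 6, g j ∈ R) {q : List ℕ}
    (hq : q ∈ List.sublistsLen 4 (List.range 6)) (a : α) :
    (#(nb K R a) ≤ 3 → ∃ j ∈ q, ¬ K a (g j)) ∧ (3 ≤ #(nb K R a) → ∃ j ∈ q, K a (g j)) := by
  classical
  rw [List.mem_sublistsLen] at hq
  have hq6 : ∀ j ∈ q, j < 6 := fun j hj => List.mem_range.1 (hq.1.subset hj)
  have hT : #(q.toFinset.image g) = 4 := by
    rw [card_image_of_injOn (hg.mono fun i hi => hq6 i (by simpa using hi)),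
      List.toFinset_card_of_nodup (hq.1.nodup List.nodup_range), hq.2]
  constructor <;> intro h <;> by_contra! hcon
  · have : q.toFinset.image g ⊆ nb K R a := image_subset_iff.2 fun j hj => by
      rw [List.mem_toFinset] at hj
      exact mem_nb.2 ⟨hgR j (hq6 j hj), hcon j hj⟩
    have := card_le_card this
    omega
  · have h1 : q.toFinset.image g ∪ nb K R a ⊆ R := union_subset
      (image_subset_iff.2 fun j hj => hgR j (hq6 j (by simpa using hj))) nb_subset
    have h2 : Disjoint (q.toFinset.image g) (nb K R a) := by
      rw [Finset.disjoint_left]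
      intro b hb hb'
      obtain ⟨j, hj, rfl⟩ := mem_image.1 hb
      exact hcon j (by simpa using hj) (mem_nb.1 hb').2
    have := card_le_card h1
    rw [card_union_of_disjoint h2] at this
    omega

/-- A cubic graph with sides of size 6 without octagons is a union of complete graphs. -/
theorem forall_of_cubic {L : Finset α} {R : Finset β} (hL : #L = 6) (hR : #R = 6)
    (hr : ∀ a b, K a b → #(nb K R a) = 3) (hc : ∀ a b, K a b → #(nb (flip K) L b) = 3)
    (h₄ : ¬ HasC 4 K) {x₀ : α} {y₀ : β} (hx₀ : x₀ ∈ L) (hy₀ : y₀ ∈ R) (h₀ : K x₀ y₀) :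
    ∀ x ∈ nb (flip K) L y₀, ∀ y ∈ nb K R x₀, K x y := by
  classical
  intro x hx y hy
  by_contra hxy
  have hxx : x ≠ x₀ := fun h => hxy (h ▸ (mem_nb.1 hy).2)
  have hyy : y ≠ y₀ := fun h => hxy (h ▸ (mem_nb.1 hx).2)
  have hx₀' : x₀ ∈ nb (flip K) L y₀ := mem_nb.2 ⟨hx₀, h₀⟩
  have hy₀' : y₀ ∈ nb K R x₀ := mem_nb.2 ⟨hy₀, h₀⟩
  obtain ⟨f, hf, hfL, hfV⟩ := exists_enum_chain hL (V₀ := {x₀}) (V₁ := {x₀, x}) (by simp)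
    (insert_subset hx₀' (singleton_subset_iff.2 hx)) (Subset.refl _) nb_subset
  obtain ⟨g, hg, hgR, hgV⟩ := exists_enum_chain hR (V₀ := {y₀}) (V₁ := {y₀, y}) (by simp)
    (insert_subset hy₀' (singleton_subset_iff.2 hy)) (Subset.refl _) nb_subset
  rw [hr _ _ h₀, card_pair hyy.symm, card_singleton] at hgV
  rw [hc _ _ h₀, card_pair hxx.symm, card_singleton] at hfV
  have f0 : f 0 = x₀ := by simpa using (hfV 0 (by omega)).1
  have g0 : g 0 = y₀ := by simpa using (hgV 0 (by omega)).1
  have f1 : f 1 = x := by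
    have h1 := hfV 1 (by omega)
    simpa [(by simpa using h1.1 : f 1 ≠ x₀)] using h1.2.1
  have g1 : g 1 = y := by
    have h1 := hgV 1 (by omega)
    simpa [(by simpa using h1.1 : g 1 ≠ y₀)] using h1.2.1
  have hr' : ∀ a, #(nb K R a) ≤ 3 := fun a => by
    obtain h | ⟨b, hb⟩ := (nb K R a).eq_empty_or_nonempty
    · simp [h]
    · exact (hr a b (mem_nb.1 hb).2).le
  have hc' : ∀ b, #(nb (flip K) L b) ≤ 3 := fun b => by
    obtain h | ⟨a, ha⟩ := (nb (flip K) L b).eq_empty_or_nonempty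
    · simp [h]
    · exact (hc a b (mem_nb.1 ha).2).le
  have hx0 : ∀ j < 6, K (f 0) (g j) ↔ j < 3 := fun j hj => by
    rw [← (hgV j hj).2.2.1, f0]
    simp [hgR j hj]
  have hy0 : ∀ i < 6, K (f i) (g 0) ↔ i < 3 := fun i hi => by
    rw [← (hfV i hi).2.2.1, g0]
    simp [hfL i hi, flip]
  refine Refute.certCubic_refutes.false hf hg (fun _ => h₄) (fun h => (h rfl).elim) ?_
  simp only [Refute.sideCubic, Refute.holds_append, Refute.holds_ones, Refute.holds_zeros]
  refine ⟨⟨⟨⟨⟨?_, ?_⟩, ?_⟩, ?_⟩, ?_⟩, ?_⟩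
  · rintro ⟨i, j⟩ he
    simp only [Refute.mem_rect, List.mem_cons, List.not_mem_nil, or_false] at he
    rw [he.1]
    exact (hx0 j (by omega)).2 (by omega)
  · rintro ⟨i, j⟩ he
    simp only [Refute.mem_rect, List.mem_cons, List.not_mem_nil, or_false] at he
    dsimp only
    rw [he.1, hx0 j (by omega)]
    omega
  · rintro ⟨i, j⟩ he
    simp only [Refute.mem_rect, List.mem_cons, List.not_mem_nil, or_false] at he
    rw [he.2]
    exact (hy0 i (by omega)).2 (by omega)
  · rintro ⟨i, j⟩ he
    simp only [Refute.mem_rect, List.mem_cons, List.not_mem_nil, or_false] at he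
    dsimp only
    rw [he.2, hy0 i (by omega)]
    omega
  · rw [Refute.holds_flatMap]
    intro i hi
    rw [Refute.holds_flatMap]
    intro q hq
    have hrq := fun a => exists_mem_of_sublistsLen (K := K) hR hg hgR hq a
    have hcq := fun b => exists_mem_of_sublistsLen (K := flip K) hL hf hfL hq b
    intro p hp
    simp only [List.mem_cons, List.mem_flatMap, List.not_mem_nil, or_false] at hp
    obtain rfl | rfl | ⟨j, hj, rfl | rfl⟩ := hp
    · right
      obtain ⟨k, hk, h⟩ := (hrq (f i)).1 (hr' _)
      exact ⟨(i, k), Refute.mem_rect.2 ⟨by simp, hk⟩, h⟩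
    · right
      obtain ⟨k, hk, h⟩ := (hcq (g i)).1 (hc' _)
      exact ⟨(k, i), Refute.mem_rect.2 ⟨hk, by simp⟩, h⟩
    · by_cases hij : K (f i) (g j)
      · left
        obtain ⟨k, hk, h⟩ := (hrq (f i)).2 (hr _ _ hij).ge
        exact ⟨(i, k), Refute.mem_rect.2 ⟨by simp, hk⟩, h⟩
      · right
        exact ⟨(i, j), by simp, hij⟩
    · by_cases hij : K (f j) (g i)
      · left
        obtain ⟨k, hk, h⟩ := (hcq (g i)).2 (hc _ _ hij).ge
        exact ⟨(k, i), Refute.mem_rect.2 ⟨hk, by simp⟩, h⟩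
      · right
        exact ⟨(j, i), by simp, hij⟩
  · intro p hp
    rw [List.mem_singleton] at hp
    subst hp
    right
    exact ⟨(1, 1), by simp [Refute.mem_rect], by simpa [f1, g1] using hxy⟩

theorem HasC.of_rows [Fintype α] [Fintype β] {m p q : ℕ} {Q L : Finset α} {R : Finset β}
    (hα : Fintype.card α = m + 3) (hβ : Fintype.card β = m + 3) (hm : 5 ≤ m) (hm6 : m ≠ 6)
    (hL : #L = m) (hR : #R = m) (hR' : ∀ y ∈ R, ∀ b ∉ R, #(nb (flip H) L y) ≤ #(nb (flip H) L b))
    (hQ : q + 3 ≤ #Q) (h : ∀ a ∈ Q, p ≤ #(nb H R a)) (hq : 0 < q) (hqp : q ≤ p) (hmp : m ≤ p + q) :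
    HasC 4 H ∨ HasC m fun a b => ¬ H a b := by
  classical
  by_cases hp : p ≤ 3
  · obtain rfl : m = 5 := by omega
    exact HasC.of_five_rows hα hβ (by omega) hR fun a ha => (by omega : 3 ≤ p).trans (h a ha)
  by_cases hmp' : m + 2 ≤ 2 * p
  · exact Or.inl (HasC.of_four_rows (by omega) h (by omega) (by omega))
  by_cases hp5 : 5 ≤ p
  · exact Or.inl (HasC.of_seven_rows (by omega) hp5 (by omega) h)
  obtain rfl : p = 4 := by omega
  obtain rfl | rfl : m = 7 ∨ m = 8 := by omega
  · refine HasC.of_six_rows_seven (B := Rᶜ) (by omega) hL hR h ?_ disjoint_compl_right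
      fun y hy b hb => hR' y hy b (mem_compl.1 hb)
    rw [card_compl, hβ, hR]
  · exact Or.inl (HasC.of_seven_rows_eight (by omega) hR h)

end

section
variable {α β : Type*} {H K : α → β → Prop}

theorem card_nb_le_three [Fintype α] {L : Finset α} {R : Finset β} (hα : Fintype.card α = 9)
    (hL : #L = 6) (hR : #R = 6) (hLe : ∀ x ∈ L, ∀ a ∉ L, #(nb H R x) ≤ #(nb H R a))
    (h₄ : ¬ HasC 4 H) : ∀ x ∈ L, #(nb H R x) ≤ 3 := by
  classical
  intro x hx
  by_contra! h
  refine h₄ (HasC.of_four_rows (Q := insert x Lᶜ) (R := R) (k := 4) ?_ (fun a ha => ?_) le_rfl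
    (by omega))
  · rw [card_insert_of_notMem (by simpa using hx), card_compl, hα, hL]
  · obtain rfl | ha := mem_insert.1 ha
    · exact h
    · exact h.trans_le (hLe x hx a (mem_compl.1 ha))

theorem HasC.of_core_six [Fintype α] [Fintype β] {L : Finset α} {R : Finset β}
    (hα : Fintype.card α = 9) (hβ : Fintype.card β = 9) (hL : #L = 6) (hR : #R = 6)
    (hLe : ∀ x ∈ L, ∀ a ∉ L, #(nb H R x) ≤ #(nb H R a))
    (hRe : ∀ y ∈ R, ∀ b ∉ R, #(nb (flip H) L y) ≤ #(nb (flip H) L b))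
    (hK : ∀ a b, K a b → a ∈ L ∧ b ∈ R ∧ H a b)
    (hd : ∀ a b, K a b → 6 ≤ #(nb K R a) + #(nb (flip K) L b)) {x₀ : α} {y₀ : β} (h₀ : K x₀ y₀) :
    HasC 4 H ∨ HasC 6 fun a b => ¬ H a b := by
  classical
  by_contra! hcon
  have hx3 := card_nb_le_three hα hL hR hLe hcon.1
  have hy3 := card_nb_le_three (H := flip H) hβ hR hL hRe fun h => hcon.1 h.swap
  have hKr : ∀ a, nb K R a ⊆ nb H R a := fun a b h =>
    mem_nb.2 ⟨(mem_nb.1 h).1, (hK _ _ (mem_nb.1 h).2).2.2⟩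
  have hKc : ∀ b, nb (flip K) L b ⊆ nb (flip H) L b := fun b a h =>
    mem_nb.2 ⟨(mem_nb.1 h).1, (hK _ _ (mem_nb.1 h).2).2.2⟩
  have hdeg : ∀ a b, K a b → #(nb K R a) = 3 ∧ #(nb (flip K) L b) = 3 := fun a b h => by
    have h1 := (card_le_card (hKr a)).trans (hx3 a (hK a b h).1)
    have h2 := (card_le_card (hKc b)).trans (hy3 b (hK a b h).2.1)
    have := hd a b h
    omega
  obtain ⟨hx₀, hy₀, -⟩ := hK _ _ h₀
  have hXY := forall_of_cubic hL hR (fun a b h => (hdeg a b h).1) (fun a b h => (hdeg a b h).2)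
    (fun h => hcon.1 (h.mono fun a b h => (hK a b h).2.2)) hx₀ hy₀ h₀
  obtain ⟨hY, hX⟩ := hdeg _ _ h₀
  have hXL : nb (flip K) L y₀ ⊆ L := nb_subset
  have hYR : nb K R x₀ ⊆ R := nb_subset
  have hA := (card_le_card (hKr x₀))
  have hB := (card_le_card (hKc y₀))
  rw [hY] at hA
  rw [hX] at hB
  generalize nb (flip K) L y₀ = X at *
  generalize nb K R x₀ = Y at *
  have hXY' : ∀ a ∈ X, ∀ b ∈ Y, H a b := fun a ha b hb => (hK _ _ (hXY a ha b hb)).2.2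
  have hr : ∀ a ∈ X, Y = nb H R a := fun a ha =>
    eq_of_subset_of_card_le (fun b hb => mem_nb.2 ⟨hYR hb, hXY' a ha b hb⟩)
      (hY.symm ▸ hx3 a (hXL ha))
  have hc : ∀ b ∈ Y, X = nb (flip H) L b := fun b hb =>
    eq_of_subset_of_card_le (fun a ha => mem_nb.2 ⟨hXL ha, hXY' a ha b hb⟩)
      (hX.symm ▸ hy3 b (hYR hb))
  have h₁ : ∀ a ∈ X, ∀ b ∈ R \ Y, ¬ H a b := fun a ha b hb h => by
    rw [mem_sdiff] at hb
    refine hb.2 ?_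
    rw [hr a ha]
    exact mem_nb.2 ⟨hb.1, h⟩
  have h₂ : ∀ a ∈ L \ X, ∀ b ∈ Y, ¬ H a b := fun a ha b hb h => by
    rw [mem_sdiff] at ha
    refine ha.2 ?_
    rw [hc b hb]
    exact mem_nb.2 ⟨ha.1, h⟩
  have eL := union_sdiff_of_subset hXL
  have eR := union_sdiff_of_subset hYR
  have hZ : #(R \ Y) = 3 := by rw [card_sdiff_of_subset hYR, hR, hY]
  have hW : #(L \ X) = 3 := by rw [card_sdiff_of_subset hXL, hL, hX]
  have hA' : #Lᶜ = 3 := by rw [card_compl, hα, hL]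
  have hB' : #Rᶜ = 3 := by rw [card_compl, hβ, hR]
  have dX : Disjoint X (L \ X) := disjoint_sdiff
  have dY : Disjoint Y (R \ Y) := disjoint_sdiff
  have dL : Disjoint (X ∪ L \ X) Lᶜ := eL.symm ▸ disjoint_compl_right
  have dR : Disjoint (Y ∪ R \ Y) Rᶜ := eR.symm ▸ disjoint_compl_right
  have hAd : ∀ a ∈ Lᶜ, 3 ≤ #(nb H (Y ∪ R \ Y) a) := fun a ha => by
    rw [eR]
    exact hA.trans (hLe _ hx₀ a (mem_compl.1 ha))
  have hBd : ∀ b ∈ Rᶜ, 3 ≤ #(nb (flip H) (X ∪ L \ X) b) := fun b hb => by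
    rw [eL]
    exact hB.trans (hRe _ hy₀ b (mem_compl.1 hb))
  obtain hl | hl := card_nb_le_one_or hX hY hXY' hcon.1
  · obtain h | h := HasC.of_block_nine hX hW hA' dX dL hY hZ hB' dY dR hXY' h₁ h₂ hAd hBd
      fun b hb => hl b fun h => mem_compl.1 hb (hYR h)
    · exact hcon.1 h
    · exact hcon.2 h
  · obtain h | h := HasC.of_block_nine (H := flip H) hY hZ hB' dY dR hX hW hA' dX dL
      (fun b hb a ha => hXY' a ha b hb) (fun b hb a ha => h₂ a ha b hb)
      (fun b hb a ha => h₁ a ha b hb) hBd hAd fun a ha => hl a fun h => mem_compl.1 ha (hXL h)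
    · exact hcon.1 h.swap
    · exact hcon.2 h.swap

theorem card_union_compl_nb [Fintype α] [DecidableEq α] {L : Finset α} {m : ℕ}
    (hα : Fintype.card α = m + 3) (hL : #L = m) (b : β) :
    #(nb (flip K) L b ∪ Lᶜ) = #(nb (flip K) L b) + 3 := by
  rw [card_union_of_disjoint (disjoint_compl_right.mono_left nb_subset), card_compl, hα, hL]
  omega

theorem hasC_or_hasC_compl [Fintype α] [Fintype β] (H : α → β → Prop) {m : ℕ} (hm : 5 ≤ m)
    (hα : Fintype.card α = m + 3) (hβ : Fintype.card β = m + 3) :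
    HasC 4 H ∨ HasC m fun a b => ¬ H a b := by
  classical
  by_contra! hcon
  obtain ⟨L, R, hL, hR, hLe, hRe⟩ := exists_extremal H (m := m) (by omega) (by omega)
  obtain ⟨K, hK, ⟨a, b, hab⟩, hd⟩ := exists_core hL hR hcon.2
  replace hd : ∀ a b, K a b → m ≤ #(nb K R a) + #(nb (flip K) L b) := fun a b h => by
    convert hd a b h using 3 <;> ext <;> simp [flip]
  by_cases hm6 : m = 6
  · subst hm6
    obtain h | h := HasC.of_core_six hα hβ hL hR hLe hRe hK hd hab
    · exact hcon.1 h
    · exact hcon.2 h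
  obtain ⟨⟨x, y⟩, hxy, hmin⟩ := exists_min_image (univ.filter fun e : α × β => K e.1 e.2)
    (fun e => #(nb K R e.1) + #(nb (flip K) L e.2)) ⟨(a, b), by simpa using hab⟩
  simp only [mem_filter, mem_univ, true_and, Prod.forall] at hxy hmin
  obtain ⟨hx, hy, -⟩ := hK _ _ hxy
  have hKr : ∀ a, #(nb K R a) ≤ #(nb H R a) := fun a => card_le_card fun b h =>
    mem_nb.2 ⟨(mem_nb.1 h).1, (hK _ _ (mem_nb.1 h).2).2.2⟩
  have hKc : ∀ b, #(nb (flip K) L b) ≤ #(nb (flip H) L b) := fun b => card_le_card fun a h =>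
    mem_nb.2 ⟨(mem_nb.1 h).1, (hK _ _ (mem_nb.1 h).2).2.2⟩
  have hrow : ∀ a ∈ nb (flip K) L y ∪ Lᶜ, #(nb K R x) ≤ #(nb H R a) := fun a ha => by
    obtain ha | ha := mem_union.1 ha
    · have := hmin a y (mem_nb.1 ha).2
      have := hKr a
      omega
    · exact (hKr x).trans (hLe x hx a (mem_compl.1 ha))
  have hcol : ∀ b ∈ nb (flip (flip K)) R x ∪ Rᶜ, #(nb (flip K) L y) ≤ #(nb (flip H) L b) :=
      fun b hb => by
    obtain hb | hb := mem_union.1 hb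
    · have := hmin x b (mem_nb.1 hb).2
      have := hKc b
      omega
    · exact (hKc y).trans (hRe y hy b (mem_compl.1 hb))
  have hp : 0 < #(nb K R x) := card_pos.2 ⟨y, mem_nb.2 ⟨hy, hxy⟩⟩
  have hq : 0 < #(nb (flip K) L y) := card_pos.2 ⟨x, mem_nb.2 ⟨hx, hxy⟩⟩
  have hpq := hd x y hxy
  obtain hle | hle := le_total #(nb (flip K) L y) #(nb K R x)
  · obtain h | h := HasC.of_rows hα hβ hm hm6 hL hR hRe (card_union_compl_nb hα hL y).ge hrow hq
      hle hpq
    · exact hcon.1 h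
    · exact hcon.2 h
  · obtain h | h := HasC.of_rows (H := flip H) hβ hα hm hm6 hR hL hLe
      (card_union_compl_nb hβ hR x).ge hcol hp hle (hpq.trans (Nat.add_comm _ _).le)
    · exact hcon.1 h.swap
    · exact hcon.2 h.swap

end

theorem Fin.val_eq_of_sub_val_eq_one {N : ℕ} {u v : Fin N} (h : (u - v).val = 1) :
    u.val = v.val + 1 ∨ u.val = 0 ∧ v.val + 1 = N := by
  rw [Fin.sub_def] at h
  have h : (N - v.val + u.val) % N = 1 := h
  have hu := u.isLt
  have hv := v.isLt
  by_cases huv : v.val ≤ u.val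
  · rw [show N - v.val + u.val = (u.val - v.val) + N by omega, Nat.add_mod_right,
      Nat.mod_eq_of_lt (by omega)] at h
    omega
  · rw [Nat.mod_eq_of_lt (by omega)] at h
    omega

theorem HasC.hasCycleLen {α β : Type*} {G : SimpleGraph (α ⊕ β)} {h : α → β → Prop} {k : ℕ}
    (hk : 2 ≤ k) (hh : ∀ a b, h a b → G.Adj (inl a) (inr b)) (hc : HasC k h) :
    HasCycleLen G (2 * k) := by
  obtain ⟨r, c, hr, hc, hrc⟩ := hc
  refine (cycleGraph_isContained_iff (by omega)).1 ?_
  let f : Fin (2 * k) → α ⊕ β := fun i =>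
    if i.val % 2 = 0 then inl (r ⟨i / 2, by omega⟩) else inr (c ⟨i / 2, by omega⟩)
  have hrot : ∀ i : Fin k, (finRotate k i).val = if i.val + 1 = k then 0 else i.val + 1 := by
    obtain ⟨k, rfl⟩ : ∃ l, k = l + 1 := ⟨k - 1, by omega⟩
    intro i
    split_ifs with hi
    · rw [show i = Fin.last k from Fin.ext (by simpa using hi), finRotate_last]
      rfl
    · exact coe_finRotate_of_ne_last fun h => hi (by rw [h]; rfl)
  have hadj : ∀ u v : Fin (2 * k), (u - v).val = 1 → G.Adj (f v) (f u) := by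
    intro u v huv
    have huv := Fin.val_eq_of_sub_val_eq_one huv
    have hu := u.isLt
    by_cases hv : v.val % 2 = 0
    · have hu2 : ¬ u.val % 2 = 0 := by omega
      simp only [f, hv, hu2, if_true, if_false]
      convert hh _ _ (hrc ⟨v / 2, by omega⟩).1 using 4
      omega
    · have hu2 : u.val % 2 = 0 := by omega
      simp only [f, hv, hu2, if_true, if_false]
      convert (hh _ _ (hrc ⟨v / 2, by omega⟩).2).symm using 3
      refine Fin.ext ?_
      rw [hrot]
      simp only
      split_ifs <;> omega
  refine ⟨⟨⟨f, fun {u v} h => ?_⟩, fun u v h => Fin.ext ?_⟩⟩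
  · obtain h | h := cycleGraph_adj'.1 h
    · exact (hadj _ _ h).symm
    · exact hadj _ _ h
  · have h : f u = f v := h
    simp only [f] at h
    split_ifs at h
    · have := congrArg Fin.val (hr (inl_injective h))
      simp only at this
      omega
    · have := congrArg Fin.val (hc (inr_injective h))
      simp only at this
      omega

/-- Upper bound in Theorem 7: for `n ≥ 5`, every subgraph `G` of `K_{n+3,n+3}`
contains `C_{2n}`, or its bipartite complement contains `C_8`. -/
theorem stmt15 (n : ℕ) (hn : 5 ≤ n)
    (G : SimpleGraph (Fin (n + 3) ⊕ Fin (n + 3))) (hG : G ≤ Kbb (n + 3)) :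
    HasCycleLen G (2 * n) ∨ HasCycleLen (Kbb (n + 3) \ G) 8 := by
  obtain h | h := hasC_or_hasC_compl (fun a b => ¬ G.Adj (inl a) (inr b)) hn
    (Fintype.card_fin _) (Fintype.card_fin _)
  · exact .inr (h.hasCycleLen (by omega) fun a b hab => by simp [hab])
  · exact .inl (h.hasCycleLen (by omega) fun a b hab => not_not.1 hab)
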